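/- There exists a function F : ℂ → ℂ, meromorphic on all of ℂ, such that F(s) = Σ_{m,n ≥ 1} 1/(m·n·(m+n)·(m+2n))^s for every s with Re(s) > 1 (sum over all pairs of positive integers), and such that for every positive integer k: F is analytic at s = −2k, F(−2k) = 0, and F′(−2k) = 0 (a zero of order at least 2 at every negative even integer). -/

import Mathlib

open Complex

namespace WittenB2

open MeasureTheory Set Filter Topology

/-- Holomorphy of a parametric integral of locally dominated holomorphic functions. -/
theorem differentiableOn_integral_of_dominated {α : Type*} [MeasurableSpace α] {μ : Measure α}
    {U : Set ℂ} (hU : IsOpen U) {f : ℂ → α → ℂ}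
    (hmeas : ∀ s ∈ U, AEStronglyMeasurable (f s) μ)
    (hdiff : ∀ᵐ a ∂μ, DifferentiableOn ℂ (fun s => f s a) U)
    (hbound : ∀ s₀ ∈ U, ∃ V ∈ 𝓝 s₀, ∃ b : α → ℝ, Integrable b μ ∧
      ∀ᵐ a ∂μ, ∀ s ∈ V, ‖f s a‖ ≤ b a) :
    DifferentiableOn ℂ (fun s => ∫ a, f s a ∂μ) U := by
  intro s₀ hs₀
  obtain ⟨V, hV, b, hb, hfb⟩ := hbound s₀ hs₀
  obtain ⟨ε, hε, hball⟩ := Metric.mem_nhds_iff.1 (Filter.inter_mem hV (hU.mem_nhds hs₀))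
  have hε2 : 0 < ε / 2 := by positivity
  have hsub : ∀ s ∈ Metric.ball s₀ (ε / 2), Metric.closedBall s (ε / 2) ⊆ V ∩ U := by
    intro s hs z hz
    apply hball
    rw [Metric.mem_ball] at *
    rw [Metric.mem_closedBall] at hz
    linarith [dist_triangle z s s₀]
  have hint : Integrable (f s₀) μ :=
    hb.mono' (hmeas s₀ hs₀) (hfb.mono fun a ha => ha s₀ (mem_of_mem_nhds hV))
  have hderiv : ∀ᵐ a ∂μ, ∀ s ∈ Metric.ball s₀ (ε / 2),
      HasDerivAt (fun z => f z a) (deriv (fun z => f z a) s) s := by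
    filter_upwards [hdiff] with a ha s hs
    have hsU : s ∈ U := (hsub s hs (Metric.mem_closedBall_self hε2.le)).2
    exact (ha.differentiableAt (hU.mem_nhds hsU)).hasDerivAt
  have hF' : AEStronglyMeasurable (fun a => deriv (fun z => f z a) s₀) μ := by
    have hu : Tendsto (fun n : ℕ => s₀ + ((ε / 2 / 2 / (n + 1) : ℝ) : ℂ)) atTop (𝓝[≠] s₀) := by
      have h0 : Tendsto (fun n : ℕ => (ε / 2 / 2 / (n + 1) : ℝ)) atTop (𝓝 0) :=
        tendsto_const_div_atTop_nhds_zero_nat (ε / 2 / 2) |>.comp (tendsto_add_atTop_nat 1)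
          |>.congr fun n => by simp
      refine tendsto_nhdsWithin_iff.2 ⟨?_, Eventually.of_forall fun n => ?_⟩
      · have := (Complex.continuous_ofReal.tendsto 0).comp h0
        simpa using this.const_add s₀
      · have : (0 : ℝ) < ε / 2 / 2 / (n + 1) := by positivity
        simp only [mem_compl_iff, mem_singleton_iff, add_eq_left, ofReal_eq_zero]
        exact this.ne'
    refine aestronglyMeasurable_of_tendsto_ae atTop
      (f := fun (n : ℕ) a => slope (fun z => f z a) s₀ (s₀ + ((ε / 2 / 2 / (n + 1) : ℝ) : ℂ)))
      (fun n => ?_) ?_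
    · simp only [slope_def_field, div_eq_mul_inv]
      refine ((hmeas _ ?_).sub (hmeas _ hs₀)).mul_const _
      refine (hsub s₀ (Metric.mem_ball_self hε2) ?_).2
      have h1 : (0 : ℝ) < ε / 2 / 2 / (n + 1) := by positivity
      have h2 : ε / 2 / 2 / (n + 1) ≤ ε / 2 / 2 :=
        div_le_self (by positivity) (by linarith [(Nat.cast_nonneg n : (0 : ℝ) ≤ n)])
      simp only [← div_eq_mul_inv]
      rw [mem_closedBall_iff_norm, add_sub_cancel_left, Complex.norm_real, Real.norm_of_nonneg h1.le]
      linarith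
    · filter_upwards [hderiv] with a ha
      exact (hasDerivAt_iff_tendsto_slope.1 (ha s₀ (Metric.mem_ball_self hε2))).comp hu
  have hF'b : ∀ᵐ a ∂μ, ∀ s ∈ Metric.ball s₀ (ε / 2),
      ‖deriv (fun z => f z a) s‖ ≤ b a / (ε / 2) := by
    filter_upwards [hdiff, hfb] with a ha hba s hs
    refine norm_deriv_le_of_forall_mem_sphere_norm_le hε2 ?_ fun z hz => ?_
    · refine DifferentiableOn.diffContOnCl ?_
      rw [closure_ball _ hε2.ne']
      exact ha.mono fun z hz => (hsub s hs hz).2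
    · exact hba z (hsub s hs (Metric.sphere_subset_closedBall hz)).1
  refine (hasDerivAt_integral_of_dominated_loc_of_deriv_le (Metric.ball_mem_nhds s₀ hε2)
    ?_ hint hF' hF'b (hb.div_const _) hderiv).2.differentiableAt.differentiableWithinAt
  filter_upwards [hU.mem_nhds hs₀] with s hs using hmeas s hs

/-- The Planck kernel `1 / (exp (2πt) - 1)`. -/
noncomputable def planck (t : ℝ) : ℝ := 1 / (Real.exp (2 * Real.pi * t) - 1)

theorem exp_two_pi_sub_one_pos {t : ℝ} (ht : 0 < t) : 0 < Real.exp (2 * Real.pi * t) - 1 := by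
  have : 0 < 2 * Real.pi * t := by positivity
  linarith [Real.add_one_lt_exp this.ne']

theorem planck_nonneg {t : ℝ} (ht : 0 < t) : 0 ≤ planck t :=
  one_div_nonneg.2 (exp_two_pi_sub_one_pos ht).le

theorem planck_le {t : ℝ} (ht : 0 < t) : planck t ≤ t⁻¹ * Real.exp (-(2 * t)) := by
  have h1 : 2 * Real.pi * t * Real.exp (Real.pi * t) ≤ Real.exp (2 * Real.pi * t) - 1 := by
    have h := Real.self_le_sinh_iff.2 (by positivity : 0 ≤ Real.pi * t)
    rw [Real.sinh_eq] at h
    have e1 : Real.exp (2 * Real.pi * t) = Real.exp (Real.pi * t) * Real.exp (Real.pi * t) := by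
      rw [← Real.exp_add]; ring_nf
    have e2 : Real.exp (Real.pi * t) * Real.exp (-(Real.pi * t)) = 1 := by
      rw [← Real.exp_add]; simp
    have := mul_le_mul_of_nonneg_left h (Real.exp_pos (Real.pi * t)).le
    nlinarith
  have h2 : t * Real.exp (2 * t) ≤ 2 * Real.pi * t * Real.exp (Real.pi * t) := by
    have h3 := Real.pi_gt_three
    have : Real.exp (2 * t) ≤ Real.exp (Real.pi * t) := Real.exp_le_exp.2 (by nlinarith)
    have h4 : t ≤ 2 * Real.pi * t := by nlinarith
    exact mul_le_mul h4 this (Real.exp_pos _).le (by positivity)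
  rw [planck, Real.exp_neg, ← mul_inv, ← one_div]
  exact one_div_le_one_div_of_le (by positivity) (h2.trans h1)

theorem measurable_planck : Measurable planck := by
  unfold planck; fun_prop

/-- Polynomial growth is absorbed by an exponential. -/
theorem one_add_pow_le (K : ℕ) {t : ℝ} (ht : 0 ≤ t) :
    (1 + t) ^ K ≤ K.factorial * Real.exp 1 * Real.exp t := by
  have := Real.pow_div_factorial_le_exp (1 + t) (by positivity) K
  rw [div_le_iff₀ (by positivity), Real.exp_add] at this
  linarith

theorem norm_cpow_le_of_norm_le {s : ℂ} {M : ℝ} (hs : ‖s‖ ≤ M) (z : ℂ) :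
    ‖z ^ (-s)‖ ≤ ‖z‖ ^ (-s.re) * Real.exp (Real.pi * M) := by
  refine (Complex.norm_cpow_le z (-s)).trans ?_
  rw [div_eq_mul_inv, ← Real.exp_neg, Complex.neg_re]
  refine mul_le_mul_of_nonneg_left (Real.exp_le_exp.2 ?_) (by positivity)
  have h1 := Complex.abs_arg_le_pi z
  have h2 := (Complex.abs_im_le_norm s).trans hs
  calc -(z.arg * (-s).im) = z.arg * s.im := by simp
    _ ≤ |z.arg * s.im| := le_abs_self _
    _ = |z.arg| * |s.im| := abs_mul _ _
    _ ≤ Real.pi * M := mul_le_mul h1 h2 (abs_nonneg _) Real.pi_pos.le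

theorem integrableOn_rpow_mul_exp {x : ℝ} (hx : -1 < x) :
    IntegrableOn (fun t : ℝ => t ^ x * Real.exp (-t)) (Ioi 0) := by
  have := Real.GammaIntegral_convergent (s := x + 1) (by linarith)
  simpa [mul_comm] using this

/-- The majorant used for all integrals against the Planck kernel. -/
theorem rpow_mul_planck_le (K J : ℕ) {σ t : ℝ} (ht : 0 < t) :
    t ^ (-σ) * (t ^ J * (1 + t) ^ K) * planck t ≤
      K.factorial * Real.exp 1 * (t ^ (J - 1 - σ) * Real.exp (-t)) := by
  have h1 := one_add_pow_le K ht.le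
  have h2 := planck_le ht
  have e : t ^ (J - 1 - σ) = t ^ (-σ) * t ^ J * t⁻¹ := by
    rw [← Real.rpow_natCast t J, ← Real.rpow_neg_one, ← Real.rpow_add ht, ← Real.rpow_add ht]
    ring_nf
  have e2 : Real.exp t * Real.exp (-(2 * t)) = Real.exp (-t) := by
    rw [← Real.exp_add]; ring_nf
  calc t ^ (-σ) * (t ^ J * (1 + t) ^ K) * planck t
      ≤ t ^ (-σ) * (t ^ J * (K.factorial * Real.exp 1 * Real.exp t)) *
        (t⁻¹ * Real.exp (-(2 * t))) := by
        have := planck_nonneg ht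
        gcongr
    _ = K.factorial * Real.exp 1 * (t ^ (-σ) * t ^ J * t⁻¹ *
          (Real.exp t * Real.exp (-(2 * t)))) := by ring
    _ = _ := by rw [e, e2]

/-- The Taylor coefficients of `w ↦ (1 + w) ^ (-s)`. -/
noncomputable def binomCoeff : ℕ → ℂ → ℂ
  | 0, _ => 1
  | j + 1, s => -s * binomCoeff j (s + 1) / (j + 1)

theorem differentiable_binomCoeff (j : ℕ) : Differentiable ℂ (binomCoeff j) := by
  induction j with
  | zero => exact differentiable_const 1
  | succ j ih =>
    change Differentiable ℂ fun s => -s * binomCoeff j (s + 1) / (j + 1)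
    have : Differentiable ℂ fun s => binomCoeff j (s + 1) :=
      ih.comp (differentiable_id.add_const 1)
    fun_prop

theorem binomCoeff_neg_eq_zero {j K : ℕ} (h : K < j) : binomCoeff j (-K) = 0 := by
  induction j generalizing K with
  | zero => omega
  | succ j ih =>
    rcases K with _ | K
    · simp [binomCoeff]
    · have : (-((K + 1 : ℕ) : ℂ)) + 1 = -(K : ℂ) := by push_cast; ring
      rw [binomCoeff, this, ih (by omega)]
      simp

/-- The Taylor remainder of order `J` of `w ↦ (1 + w) ^ (-s)`. -/
noncomputable def binomRem (J : ℕ) (s w : ℂ) : ℂ :=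
  (1 + w) ^ (-s) - ∑ j ∈ Finset.range J, binomCoeff j s * w ^ j

theorem one_add_mem_slitPlane {w : ℂ} (hw : 0 ≤ w.re) : 1 + w ∈ slitPlane :=
  Or.inl (by simp; linarith)

theorem hasDerivAt_binomRem (J : ℕ) (s : ℂ) {w : ℂ} (hw : 0 ≤ w.re) :
    HasDerivAt (binomRem (J + 1) s) (-s * binomRem J (s + 1) w) w := by
  have h1 : HasDerivAt (fun w : ℂ => (1 + w) ^ (-s)) (-s * (1 + w) ^ (-s - 1) * 1) w :=
    ((hasDerivAt_id w).const_add 1).cpow_const (one_add_mem_slitPlane hw)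
  have h2 : HasDerivAt (fun w : ℂ => ∑ j ∈ Finset.range (J + 1), binomCoeff j s * w ^ j)
      (∑ j ∈ Finset.range (J + 1), binomCoeff j s * (j * w ^ (j - 1))) w :=
    HasDerivAt.fun_sum fun j _ => (hasDerivAt_pow j w).const_mul _
  refine (h1.sub h2).congr_deriv ?_
  rw [Finset.sum_range_succ', binomRem, mul_sub, Finset.mul_sum]
  have e : -s - 1 = -(s + 1) := by ring
  rw [e]
  simp only [Nat.cast_zero, zero_mul, mul_zero, add_zero, mul_one, Nat.add_sub_cancel]
  congr 1
  refine Finset.sum_congr rfl fun j _ => ?_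
  rw [binomCoeff]
  have : (j : ℂ) + 1 ≠ 0 := by exact_mod_cast Nat.succ_ne_zero j
  push_cast
  field_simp

theorem norm_one_add_cpow_le {s w : ℂ} {M : ℕ} (hs : ‖s‖ ≤ M) (hw : 0 ≤ w.re) :
    ‖(1 + w) ^ (-s)‖ ≤ (1 + ‖w‖) ^ M * Real.exp (Real.pi * M) := by
  refine (norm_cpow_le_of_norm_le hs _).trans ?_
  have h1 : 1 ≤ ‖1 + w‖ := by
    have := (Complex.re_le_norm (1 + w))
    simp at this
    linarith
  have h2 : ‖1 + w‖ ≤ 1 + ‖w‖ := by simpa using norm_add_le 1 w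
  have h3 : -s.re ≤ M := ((neg_le_abs _).trans (Complex.abs_re_le_norm s)).trans hs
  gcongr
  calc ‖1 + w‖ ^ (-s.re) ≤ ‖1 + w‖ ^ (M : ℝ) := Real.rpow_le_rpow_of_exponent_le h1 h3
    _ = ‖1 + w‖ ^ M := Real.rpow_natCast _ _
    _ ≤ _ := by gcongr

theorem norm_binomRem_le (J : ℕ) {s w : ℂ} {M : ℕ} (hs : ‖s‖ + J ≤ M) (hw : 0 ≤ w.re) :
    ‖binomRem J s w‖ ≤
      (∏ i ∈ Finset.range J, ‖s + i‖) * ‖w‖ ^ J * ((1 + ‖w‖) ^ M * Real.exp (Real.pi * M)) := by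
  induction J generalizing s w with
  | zero =>
    simpa [binomRem] using norm_one_add_cpow_le (by simpa using hs) hw
  | succ J ih =>
    have hs' : ‖s + 1‖ + J ≤ M := by
      have := norm_add_le s 1
      push_cast at hs
      simp at this
      linarith
    have hseg : ∀ z ∈ segment ℝ 0 w, 0 ≤ z.re ∧ ‖z‖ ≤ ‖w‖ := by
      rw [segment_eq_image]
      rintro _ ⟨t, ⟨ht0, ht1⟩, rfl⟩
      simp only [smul_zero, zero_add, real_smul, re_ofReal_mul, norm_mul, norm_real,
        Real.norm_of_nonneg ht0]
      exact ⟨mul_nonneg ht0 hw, mul_le_of_le_one_left (norm_nonneg _) ht1⟩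
    have hmv := (convex_segment (0 : ℂ) w).norm_image_sub_le_of_norm_hasDerivWithin_le
      (𝕜 := ℂ) (f := binomRem (J + 1) s) (f' := fun z => -s * binomRem J (s + 1) z)
      (C := ‖s‖ * ((∏ i ∈ Finset.range J, ‖s + 1 + i‖) * ‖w‖ ^ J *
        ((1 + ‖w‖) ^ M * Real.exp (Real.pi * M))))
      (fun z hz => (hasDerivAt_binomRem J s (hseg z hz).1).hasDerivWithinAt)
      (fun z hz => by
        rw [norm_mul, norm_neg]
        refine mul_le_mul_of_nonneg_left ((ih hs' (hseg z hz).1).trans ?_) (norm_nonneg _)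
        have := (hseg z hz).2
        gcongr)
      (left_mem_segment ℝ 0 w) (right_mem_segment ℝ 0 w)
    have h0 : binomRem (J + 1) s 0 = 0 := by
      simp [binomRem, Finset.sum_range_succ', binomCoeff]
    rw [h0, sub_zero, sub_zero] at hmv
    refine hmv.trans (le_of_eq ?_)
    rw [Finset.prod_range_succ']
    simp only [Nat.cast_add, Nat.cast_one, Nat.cast_zero, add_zero]
    have : ∀ i : ℕ, s + 1 + (i : ℂ) = s + ((i : ℂ) + 1) := fun i => by ring
    simp only [this]
    ring

/-- The factor `(1 + it)^{-s} (1 + iβt)^{-s}`. -/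
noncomputable def pairPow (β : ℝ) (s : ℂ) (t : ℝ) : ℂ :=
  (1 + t * I) ^ (-s) * (1 + β * t * I) ^ (-s)

/-- The product of the Taylor polynomials of the two factors of `pairPow`. -/
noncomputable def pairPoly (J : ℕ) (β : ℝ) (s : ℂ) (t : ℝ) : ℂ :=
  (∑ p ∈ Finset.range J, binomCoeff p s * (t * I) ^ p) *
    ∑ q ∈ Finset.range J, binomCoeff q s * (β * t * I) ^ q

theorem norm_pairPow_sub_pairPoly_le (J : ℕ) {β t : ℝ} {s : ℂ} {M : ℕ} (hs : ‖s‖ + J ≤ M)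
    (hβ : |β| ≤ 1) :
    ‖pairPow β s t - pairPoly J β s t‖ ≤
      (∏ i ∈ Finset.range J, ‖s + i‖) * (2 + ∏ i ∈ Finset.range J, ‖s + i‖) *
        Real.exp (Real.pi * M) ^ 2 * (|t| ^ J * (1 + |t|) ^ (2 * M + J)) := by
  set Q := ∏ i ∈ Finset.range J, ‖s + i‖ with hQ
  have hQ0 : 0 ≤ Q := Finset.prod_nonneg fun _ _ => norm_nonneg _
  have hsM : ‖s‖ ≤ M := by have := (Nat.cast_nonneg J : (0 : ℝ) ≤ J); linarith
  set E := Real.exp (Real.pi * M)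
  have hE0 : 0 ≤ E := (Real.exp_pos _).le
  have ht0 := abs_nonneg t
  have key : ∀ γ : ℝ, |γ| ≤ 1 → ‖(1 + γ * t * I) ^ (-s)‖ ≤ (1 + |t|) ^ M * E ∧
      ‖binomRem J s (γ * t * I)‖ ≤ Q * |t| ^ J * ((1 + |t|) ^ M * E) := by
    intro γ hγ
    have hre : 0 ≤ ((γ : ℂ) * t * I).re := by simp
    have hn : ‖(γ : ℂ) * t * I‖ ≤ |t| := by
      simp only [norm_mul, norm_real, norm_I, mul_one, Real.norm_eq_abs]
      exact mul_le_of_le_one_left ht0 hγ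
    refine ⟨(norm_one_add_cpow_le hsM hre).trans (by gcongr),
      (norm_binomRem_le J hs hre).trans (by gcongr)⟩
  obtain ⟨hA, ha⟩ := key 1 (by simp)
  obtain ⟨hB, hb⟩ := key β hβ
  have e : pairPow β s t - pairPoly J β s t =
      binomRem J s ((1 : ℝ) * t * I) * (1 + β * t * I) ^ (-s) +
      (1 + (1 : ℝ) * t * I) ^ (-s) * binomRem J s (β * t * I) -
      binomRem J s ((1 : ℝ) * t * I) * binomRem J s (β * t * I) := by
    simp only [pairPow, pairPoly, binomRem, ofReal_one, one_mul]
    ring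
  rw [e]
  have h3 : |t| ^ J ≤ (1 + |t|) ^ J := by gcongr; linarith
  have h4 : 1 ≤ (1 + |t|) ^ J := one_le_pow₀ (by linarith)
  calc _ ≤ Q * |t| ^ J * ((1 + |t|) ^ M * E) * ((1 + |t|) ^ M * E) +
        (1 + |t|) ^ M * E * (Q * |t| ^ J * ((1 + |t|) ^ M * E)) +
        Q * |t| ^ J * ((1 + |t|) ^ M * E) * (Q * |t| ^ J * ((1 + |t|) ^ M * E)) := by
        refine (norm_sub_le _ _).trans (add_le_add ((norm_add_le _ _).trans (add_le_add ?_ ?_)) ?_)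
          <;> rw [norm_mul] <;> gcongr
    _ = E ^ 2 * (|t| ^ J * (1 + |t|) ^ (2 * M)) * Q * (2 * 1 + Q * |t| ^ J) := by ring
    _ ≤ E ^ 2 * (|t| ^ J * (1 + |t|) ^ (2 * M)) * Q *
        (2 * (1 + |t|) ^ J + Q * (1 + |t|) ^ J) := by gcongr
    _ = _ := by ring

theorem pairPow_neg_eq_pairPoly {J K : ℕ} (h : K < J) {β : ℝ} (hβ : |β| ≤ 1) (t : ℝ) :
    pairPow β (-K) t = pairPoly J β (-K) t := by
  have := norm_pairPow_sub_pairPoly_le J (t := t) (s := -K) (M := K + J) (by simp) hβ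
  have h0 : ∏ i ∈ Finset.range J, ‖(-K : ℂ) + i‖ = 0 :=
    Finset.prod_eq_zero (Finset.mem_range.2 h) (by simp)
  rw [h0] at this
  simpa [sub_eq_zero] using this

theorem prod_norm_add_le {J M : ℕ} {s : ℂ} (hs : ‖s‖ + J ≤ M) :
    ∏ i ∈ Finset.range J, ‖s + i‖ ≤ (M : ℝ) ^ J := by
  calc ∏ i ∈ Finset.range J, ‖s + i‖ ≤ ∏ _i ∈ Finset.range J, (M : ℝ) := by
        refine Finset.prod_le_prod (fun _ _ => norm_nonneg _) fun i hi => ?_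
        have h1 := norm_add_le s i
        have h2 : (i : ℝ) ≤ J := by exact_mod_cast (Finset.mem_range.1 hi).le
        simp at h1
        linarith
    _ = _ := by simp

theorem pairPoly_one (β : ℝ) (s : ℂ) (t : ℝ) : pairPoly 1 β s t = 1 := by
  simp [pairPoly, binomCoeff]

theorem continuous_pairPow (β : ℝ) (s : ℂ) : Continuous (pairPow β s) := by
  have : ∀ γ : ℝ, Continuous fun t : ℝ => (1 + (γ : ℂ) * t * I) ^ (-s) := fun γ =>
    Continuous.cpow (by fun_prop) continuous_const fun t => one_add_mem_slitPlane (by simp)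
  unfold pairPow
  exact (by simpa using this 1 : Continuous _).mul (this β)

theorem continuous_pairPoly (J : ℕ) (β : ℝ) (s : ℂ) : Continuous (pairPoly J β s) := by
  unfold pairPoly; fun_prop

theorem differentiable_pairPow (β t : ℝ) : Differentiable ℂ fun s => pairPow β s t := by
  have : ∀ γ : ℝ, Differentiable ℂ fun s : ℂ => (1 + (γ : ℂ) * t * I) ^ (-s) := fun γ s =>
    (differentiableAt_id.neg).const_cpow
      (Or.inl (slitPlane_ne_zero (one_add_mem_slitPlane (by simp))))
  unfold pairPow
  exact (by simpa using this 1 : Differentiable ℂ _).mul (this β)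

theorem differentiable_pairPoly (J : ℕ) (β t : ℝ) :
    Differentiable ℂ fun s => pairPoly J β s t := by
  unfold pairPoly
  refine Differentiable.mul ?_ ?_ <;>
  exact Differentiable.fun_sum fun p _ => (differentiable_binomCoeff p).mul_const _

theorem hasSum_planck {t : ℝ} (ht : 0 < t) :
    HasSum (fun l : ℕ => Real.exp (-(2 * Real.pi * (l + 1)) * t)) (planck t) := by
  have h1 : Real.exp (-(2 * Real.pi * t)) < 1 := Real.exp_lt_one_iff.2 (by
    have : 0 < 2 * Real.pi * t := by positivity
    linarith)
  have h := (hasSum_geometric_of_lt_one (Real.exp_pos _).le h1).mul_left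
    (Real.exp (-(2 * Real.pi * t)))
  have h2 := exp_two_pi_sub_one_pos ht
  convert! h using 1
  · funext l
    rw [← Real.exp_nat_mul, ← Real.exp_add]
    ring_nf
  · have h3 : (0 : ℝ) < 1 - Real.exp (-(2 * Real.pi * t)) := by linarith
    have h4 : Real.exp (2 * Real.pi * t) * Real.exp (-(2 * Real.pi * t)) = 1 := by
      rw [← Real.exp_add]; simp
    rw [planck, ← div_eq_mul_inv, div_eq_div_iff h2.ne' h3.ne']
    linarith

/-- The Mellin-type integral `∫ t^{-s} g(t) / (exp (2πt) - 1) dt`. -/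
noncomputable def planckInt (s : ℂ) (g : ℝ → ℂ) : ℂ :=
  ∫ t in Ioi (0 : ℝ), (t : ℂ) ^ (-s) * g t * planck t

theorem norm_planckInt_integrand_le {s : ℂ} {g : ℝ → ℂ} {J K : ℕ} {C t : ℝ} (hC : 0 ≤ C)
    (hg : ‖g t‖ ≤ C * (t ^ J * (1 + t) ^ K)) (ht : 0 < t) :
    ‖(t : ℂ) ^ (-s) * g t * planck t‖ ≤
      C * (K.factorial * Real.exp 1) * (t ^ (J - 1 - s.re) * Real.exp (-t)) := by
  rw [norm_mul, norm_mul, norm_cpow_eq_rpow_re_of_pos ht, norm_real,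
    Real.norm_of_nonneg (planck_nonneg ht), neg_re]
  calc t ^ (-s.re) * ‖g t‖ * planck t
      ≤ t ^ (-s.re) * (C * (t ^ J * (1 + t) ^ K)) * planck t := by
        have := planck_nonneg ht
        gcongr
    _ = C * (t ^ (-s.re) * (t ^ J * (1 + t) ^ K) * planck t) := by ring
    _ ≤ C * (K.factorial * Real.exp 1 * (t ^ (J - 1 - s.re) * Real.exp (-t))) := by
        exact mul_le_mul_of_nonneg_left (rpow_mul_planck_le K J ht) hC
    _ = _ := by ring

theorem aestronglyMeasurable_planckInt_integrand (s : ℂ) {g : ℝ → ℂ} (hg : Measurable g) :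
    AEStronglyMeasurable (fun t : ℝ => (t : ℂ) ^ (-s) * g t * planck t)
      (volume.restrict (Ioi 0)) := by
  have := measurable_planck
  exact Measurable.aestronglyMeasurable (by fun_prop)

theorem integrableOn_planckInt_integrand {s : ℂ} {g : ℝ → ℂ} {J K : ℕ} {C : ℝ} (hC : 0 ≤ C)
    (hm : Measurable g) (hg : ∀ t, 0 < t → ‖g t‖ ≤ C * (t ^ J * (1 + t) ^ K)) (hs : s.re < J) :
    IntegrableOn (fun t : ℝ => (t : ℂ) ^ (-s) * g t * planck t) (Ioi 0) := by
  refine Integrable.mono' ((integrableOn_rpow_mul_exp (x := J - 1 - s.re) (by linarith)).const_mul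
    (C * (K.factorial * Real.exp 1))) (aestronglyMeasurable_planckInt_integrand s hm) ?_
  exact (ae_restrict_mem measurableSet_Ioi).mono fun t ht =>
    norm_planckInt_integrand_le hC (hg t ht) ht

theorem norm_planckInt_le {s : ℂ} {g : ℝ → ℂ} {J K : ℕ} {C : ℝ} (hC : 0 ≤ C)
    (hg : ∀ t, 0 < t → ‖g t‖ ≤ C * (t ^ J * (1 + t) ^ K)) (hs : s.re < J) :
    ‖planckInt s g‖ ≤ C * (K.factorial * Real.exp 1) *
      ∫ t in Ioi (0 : ℝ), t ^ (J - 1 - s.re) * Real.exp (-t) := by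
  rw [← integral_const_mul]
  refine norm_integral_le_of_norm_le
    ((integrableOn_rpow_mul_exp (x := J - 1 - s.re) (by linarith)).const_mul _) ?_
  exact (ae_restrict_mem measurableSet_Ioi).mono fun t ht =>
    norm_planckInt_integrand_le hC (hg t ht) ht

theorem differentiableOn_planckInt {g : ℂ → ℝ → ℂ} {U : Set ℂ} (hU : IsOpen U) {J : ℕ}
    (hm : ∀ s, Measurable (g s)) (hd : ∀ t, 0 < t → DifferentiableOn ℂ (fun s => g s t) U)
    (hb : ∀ s₀ ∈ U, ∃ V ∈ 𝓝 s₀, ∃ C : ℝ, 0 ≤ C ∧ ∃ K : ℕ, ∀ s ∈ V, ∀ t, 0 < t →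
      ‖g s t‖ ≤ C * (t ^ J * (1 + t) ^ K)) (hJ : ∀ s ∈ U, s.re < J) :
    DifferentiableOn ℂ (fun s => planckInt s (g s)) U := by
  refine differentiableOn_integral_of_dominated hU
    (fun s _ => aestronglyMeasurable_planckInt_integrand s (hm s)) ?_ ?_
  · refine (ae_restrict_mem measurableSet_Ioi).mono fun t (ht : 0 < t) => ?_
    refine (DifferentiableOn.mul ?_ (hd t ht)).mul_const _
    exact (differentiable_id.neg.const_cpow (Or.inl (by exact_mod_cast ht.ne'))).differentiableOn
  · intro s₀ hs₀
    obtain ⟨V, hV, C, hC, K, h⟩ := hb s₀ hs₀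
    obtain ⟨σ₁, h1, h1'⟩ := exists_between (hJ s₀ hs₀)
    have hW : {s : ℂ | s.re < σ₁ ∧ s₀.re - 1 < s.re} ∈ 𝓝 s₀ := by
      refine IsOpen.mem_nhds ?_ ⟨h1, by linarith⟩
      exact (isOpen_lt continuous_re continuous_const).inter
        (isOpen_lt continuous_const continuous_re)
    refine ⟨V ∩ _, Filter.inter_mem hV hW, fun t => C * (K.factorial * Real.exp 1) *
      (t ^ (J - 1 - σ₁) * Real.exp (-t) + t ^ (J - 1 - (s₀.re - 1)) * Real.exp (-t)), ?_, ?_⟩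
    · exact ((integrableOn_rpow_mul_exp (by linarith)).add
        (integrableOn_rpow_mul_exp (by linarith))).const_mul _
    · refine (ae_restrict_mem measurableSet_Ioi).mono fun t (ht : 0 < t) s hs => ?_
      refine (norm_planckInt_integrand_le hC (h s hs.1 t ht) ht).trans ?_
      beta_reduce
      rw [← add_mul]
      have hs1 : s.re < σ₁ := hs.2.1
      have hs2 : s₀.re - 1 < s.re := hs.2.2
      gcongr
      rcases le_total t 1 with h | h
      · have := Real.rpow_le_rpow_of_exponent_ge ht h
          (by linarith : (J : ℝ) - 1 - σ₁ ≤ J - 1 - s.re)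
        have h0 : 0 ≤ t ^ ((J : ℝ) - 1 - (s₀.re - 1)) := by positivity
        linarith
      · have := Real.rpow_le_rpow_of_exponent_le h
          (by linarith : (J : ℝ) - 1 - s.re ≤ J - 1 - (s₀.re - 1))
        have h0 : 0 ≤ t ^ ((J : ℝ) - 1 - σ₁) := by positivity
        linarith

theorem two_mul_sin_mul_planckInt_one {s : ℂ} (hs : s.re < 0) :
    2 * sin (Real.pi * s / 2) * planckInt s (fun _ => 1) = riemannZeta s := by
  have h1 : 0 < (1 - s).re := by simp; linarith
  have hsum : Summable fun l : ℕ => 1 / ((2 * Real.pi * (l + 1)) : ℝ) ^ (1 - s).re := by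
    have := (Real.summable_one_div_nat_add_rpow 1 (1 - s).re).2 (by simp; linarith)
    refine (this.mul_left (1 / (2 * Real.pi) ^ (1 - s).re)).congr fun l => ?_
    rw [Real.mul_rpow (x := 2 * Real.pi) (y := l + 1) (by positivity) (by positivity),
      abs_of_nonneg (by positivity),
      one_div_mul_one_div]
  have h2 := hasSum_mellin (a := fun _ : ℕ => 1) (p := fun l => 2 * Real.pi * (l + 1))
    (F := fun t => (planck t : ℂ)) (s := 1 - s) (fun l => Or.inr (by positivity)) h1
    (fun t ht => by
      have := (hasSum_planck ht).mapL Complex.ofRealCLM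
      simpa using this) (by simpa using hsum)
  have h3 : mellin (fun t => (planck t : ℂ)) (1 - s) = planckInt s (fun _ => 1) := by
    simp only [mellin, planckInt]
    congr 1
    funext t
    rw [smul_eq_mul, mul_one]
    ring_nf
  have h4 : riemannZeta (1 - s) = ∑' n : ℕ, 1 / (n + 1 : ℂ) ^ (1 - s) :=
    zeta_eq_tsum_one_div_nat_add_one_cpow (by simp; linarith)
  have h5 : planckInt s (fun _ => 1) =
      Gamma (1 - s) * (2 * Real.pi) ^ (-(1 - s)) * riemannZeta (1 - s) := by
    rw [← h3, ← h2.tsum_eq, h4, ← tsum_mul_left]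
    refine tsum_congr fun l => ?_
    have : (((2 * Real.pi * (l + 1) : ℝ)) : ℂ) ^ (1 - s) =
        (2 * Real.pi : ℂ) ^ (1 - s) * (l + 1) ^ (1 - s) := by
      have := mul_cpow_ofReal_nonneg (a := 2 * Real.pi) (b := l + 1)
        (by positivity) (by positivity) (1 - s)
      push_cast at this ⊢
      exact this
    rw [this, cpow_neg]
    field_simp
  have h6 := riemannZeta_one_sub (s := 1 - s)
    (fun n h => by
      have := congrArg Complex.re h
      simp at this
      have := (Nat.cast_nonneg n : (0 : ℝ) ≤ n)
      linarith)
    (fun h => by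
      have := congrArg Complex.re h
      simp at this
      linarith)
  have h7 : cos (Real.pi * (1 - s) / 2) = sin (Real.pi * s / 2) := by
    rw [← Complex.cos_pi_div_two_sub]
    ring_nf
  rw [sub_sub_cancel, h7] at h6
  rw [h5, h6]
  ring

theorem differentiableOn_planckInt_pow (n : ℕ) :
    DifferentiableOn ℂ (fun s => planckInt s (fun t => (t : ℂ) ^ n)) {s | s.re < n} := by
  refine differentiableOn_planckInt (isOpen_lt continuous_re continuous_const) (J := n)
    (fun _ => by fun_prop) (fun t _ => differentiableOn_const _) (fun s₀ _ => ?_) (fun s hs => hs)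
  refine ⟨univ, univ_mem, 1, zero_le_one, 0, fun s _ t ht => ?_⟩
  simp [abs_of_pos ht]

/-- The Taylor remainder of `pairPow`, rescaled by `1 / m`. -/
noncomputable def pairRem (J : ℕ) (β m : ℝ) (s : ℂ) (t : ℝ) : ℂ :=
  pairPow β s (t / m) - pairPoly J β s (t / m)

theorem measurable_pairRem (J : ℕ) (β m : ℝ) (s : ℂ) : Measurable (pairRem J β m s) := by
  have h1 := (continuous_pairPow β s).measurable
  have h2 := (continuous_pairPoly J β s).measurable
  unfold pairRem
  fun_prop

theorem norm_pairRem_le {J : ℕ} {β m t : ℝ} {s : ℂ} {M : ℕ} (hs : ‖s‖ + J ≤ M) (hβ : |β| ≤ 1)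
    (hm : 1 ≤ |m|) (ht : 0 < t) :
    ‖pairRem J β m s t‖ ≤ ((M : ℝ) ^ J * (2 + (M : ℝ) ^ J) * Real.exp (Real.pi * M) ^ 2 *
      (1 / |m|) ^ J) * (t ^ J * (1 + t) ^ (2 * M + J)) := by
  refine (norm_pairPow_sub_pairPoly_le J hs hβ).trans ?_
  have hm0 : 0 < |m| := by linarith
  have hQ := prod_norm_add_le hs
  have hQ0 : 0 ≤ ∏ i ∈ Finset.range J, ‖s + i‖ := Finset.prod_nonneg fun _ _ => norm_nonneg _
  have h1 : |t / m| ≤ t := by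
    rw [abs_div, abs_of_pos ht]
    exact div_le_self ht.le hm
  have h2 : |t / m| = 1 / |m| * t := by rw [abs_div, abs_of_pos ht]; ring
  calc _ ≤ (M : ℝ) ^ J * (2 + (M : ℝ) ^ J) * Real.exp (Real.pi * M) ^ 2 *
        ((1 / |m| * t) ^ J * (1 + t) ^ (2 * M + J)) := by
        rw [← h2]
        gcongr
    _ = _ := by rw [mul_pow]; ring

theorem pairRem_bound_locally (J : ℕ) {β : ℝ} (hβ : |β| ≤ 1) (s₀ : ℂ) :
    ∃ C : ℝ, 0 ≤ C ∧ ∃ K : ℕ, ∀ s ∈ Metric.ball s₀ 1, ∀ m : ℝ, 1 ≤ |m| → ∀ t, 0 < t →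
      ‖pairRem J β m s t‖ ≤ C * (1 / |m|) ^ J * (t ^ J * (1 + t) ^ K) := by
  obtain ⟨M, hM⟩ := exists_nat_ge (‖s₀‖ + 1 + J)
  refine ⟨(M : ℝ) ^ J * (2 + (M : ℝ) ^ J) * Real.exp (Real.pi * M) ^ 2, by positivity,
    2 * M + J, fun s hs m hm t ht => norm_pairRem_le ?_ hβ hm ht⟩
  have : ‖s‖ ≤ ‖s₀‖ + 1 := by
    have := norm_le_norm_add_norm_sub' s s₀
    rw [mem_ball_iff_norm] at hs
    linarith
  linarith

theorem differentiableOn_planckInt_pairRem (J : ℕ) {β m : ℝ} (hβ : |β| ≤ 1) (hm : 1 ≤ |m|) :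
    DifferentiableOn ℂ (fun s => planckInt s (pairRem J β m s)) {s | s.re < J} := by
  refine differentiableOn_planckInt (isOpen_lt continuous_re continuous_const)
    (measurable_pairRem J β m) (fun t _ => Differentiable.differentiableOn ?_) (fun s₀ _ => ?_)
    (fun s hs => hs)
  · exact (differentiable_pairPow β (t / m)).sub (differentiable_pairPoly J β (t / m))
  · obtain ⟨C, hC, K, h⟩ := pairRem_bound_locally J hβ s₀
    exact ⟨_, Metric.ball_mem_nhds s₀ one_pos, C * (1 / |m|) ^ J, by positivity, K,
      fun s hs t ht => h s hs m hm t ht⟩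

theorem integrableOn_vertical {h : ℂ → ℂ} {x δ C : ℝ} (hδ : 0 < δ)
    (hc : ContinuousOn (fun t : ℝ => h (x - t * I)) (Ici 0))
    (hb : ∀ t : ℝ, 0 ≤ t → ‖h (x - t * I)‖ ≤ C * Real.exp (-δ * t)) :
    IntegrableOn (fun t : ℝ => h (x - t * I)) (Ioi 0) := by
  refine Integrable.mono' ((integrableOn_exp_mul_Ioi (neg_neg_of_pos hδ) 0).const_mul C)
    ((hc.mono Ioi_subset_Ici_self).aestronglyMeasurable measurableSet_Ioi) ?_
  exact (ae_restrict_mem measurableSet_Ioi).mono fun t (ht : 0 < t) => hb t ht.le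

/-- Cauchy's theorem on a lower half-strip. -/
theorem integral_eq_of_lower_strip {α β δ C : ℝ} (hαβ : α ≤ β) (hδ : 0 < δ) {h : ℂ → ℂ}
    (hc : ContinuousOn h {z | α ≤ z.re ∧ z.re ≤ β ∧ z.im ≤ 0})
    (hd : DifferentiableOn ℂ h {z | α < z.re ∧ z.re < β ∧ z.im < 0})
    (hb : ∀ z : ℂ, α ≤ z.re → z.re ≤ β → z.im ≤ 0 → ‖h z‖ ≤ C * Real.exp (δ * z.im)) :
    ∫ x in α..β, h x = -I * (∫ t in Ioi (0 : ℝ), h (α - t * I)) +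
      I * ∫ t in Ioi (0 : ℝ), h (β - t * I) := by
  have hvert : ∀ x : ℝ, α ≤ x → x ≤ β → Tendsto (fun T : ℝ => ∫ y in (-T)..0, h (x + y * I))
      atTop (𝓝 (∫ t in Ioi (0 : ℝ), h (x - t * I))) := by
    intro x h1 h2
    have hI := integrableOn_vertical (h := h) (x := x) (C := C) hδ
      (hc.comp (by fun_prop) fun t (ht : 0 ≤ t) => by simp [h1, h2, ht])
      (fun t ht => (hb _ (by simp [h1]) (by simp [h2]) (by simp [ht])).trans (by simp))
    refine (intervalIntegral_tendsto_integral_Ioi 0 hI tendsto_id).congr fun T => ?_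
    have := intervalIntegral.integral_comp_neg (a := -T) (b := 0)
      (fun t : ℝ => h (x - t * I))
    simp only [neg_zero, neg_neg] at this
    rw [id, ← this]
    simp
  have hbot : Tendsto (fun T : ℝ => ∫ x in α..β, h (x + (-T : ℝ) * I)) atTop (𝓝 0) := by
    have h0 : Tendsto (fun T : ℝ => C * Real.exp (δ * -T) * |β - α|) atTop (𝓝 0) := by
      have : Tendsto (fun T : ℝ => Real.exp (δ * -T)) atTop (𝓝 0) :=
        Real.tendsto_exp_atBot.comp ((tendsto_neg_atTop_atBot).const_mul_atBot hδ)
      simpa using (this.const_mul C).mul_const |β - α|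
    refine squeeze_zero_norm' ?_ h0
    filter_upwards [eventually_ge_atTop 0] with T hT
    refine intervalIntegral.norm_integral_le_of_norm_le_const fun x hx => ?_
    rw [uIoc_of_le hαβ] at hx
    refine (hb _ ?_ ?_ ?_).trans ?_ <;> simp [hx.1.le, hx.2, hT]
  have hrect : ∀ T : ℝ, 0 ≤ T → ∫ x in α..β, h x = (∫ x in α..β, h (x + (-T : ℝ) * I)) +
      I * (∫ y in (-T)..0, h (β + y * I)) - I * ∫ y in (-T)..0, h (α + y * I) := by
    intro T hT
    have := integral_boundary_rect_eq_zero_of_continuousOn_of_differentiableOn h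
      (α + (-T : ℝ) * I) β (hc.mono ?_) (hd.mono ?_)
    · simp only [add_re, ofReal_re, mul_re, I_re, mul_zero, ofReal_im, I_im, sub_self, add_zero,
        add_im, mul_im, mul_one, zero_add, ofReal_zero, zero_mul, smul_eq_mul] at this
      linear_combination -this
    · intro z hz
      simp only [mem_reProdIm, add_re, ofReal_re, mul_re, I_re, mul_zero, ofReal_im, I_im,
        sub_self, add_zero, add_im, mul_im, mul_one, zero_add, uIcc_of_le hαβ,
        uIcc_of_le (neg_nonpos.2 hT)] at hz
      exact ⟨hz.1.1, hz.1.2, hz.2.2⟩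
    · intro z hz
      simp only [mem_reProdIm, add_re, ofReal_re, mul_re, I_re, mul_zero, ofReal_im, I_im,
        sub_self, add_zero, add_im, mul_im, mul_one, zero_add, min_eq_left hαβ,
        max_eq_right hαβ, max_eq_right (neg_nonpos.2 hT)] at hz
      exact ⟨hz.1.1, hz.1.2, hz.2.2⟩
  have hlim := (hbot.add ((hvert β hαβ le_rfl).const_mul I)).sub
    ((hvert α le_rfl hαβ).const_mul I)
  have hconst : Tendsto (fun _ : ℝ => ∫ x in α..β, h x) atTop (𝓝 (∫ x in α..β, h x)) :=
    tendsto_const_nhds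
  have := tendsto_nhds_unique (hconst.congr' ?_) hlim
  · rw [this]; ring
  · filter_upwards [eventually_ge_atTop 0] with T hT using hrect T hT

theorem exp_fourier_vertical (l : ℕ) (k : ℤ) (t : ℝ) :
    Complex.exp (-(2 * Real.pi * (l + 1)) * I * (k - t * I)) =
      Real.exp (-(2 * Real.pi * (l + 1)) * t) := by
  have : -(2 * Real.pi * (l + 1)) * I * ((k : ℂ) - t * I) =
      ((-(l + 1 : ℤ) * k : ℤ) : ℂ) * (2 * Real.pi * I) +
        ((-(2 * Real.pi * (l + 1)) * t : ℝ) : ℂ) := by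
    push_cast
    ring_nf
    rw [I_sq]
    ring
  rw [this, Complex.exp_add, Complex.exp_int_mul_two_pi_mul_I, one_mul, ofReal_exp]

/-- Fourier coefficients over an interval with integer end points, as Laplace integrals. -/
theorem fourier_integral_eq_of_strip {a b : ℤ} {C : ℝ} (hab : a ≤ b) {f : ℂ → ℂ}
    (hc : ContinuousOn f {z | a ≤ z.re ∧ z.re ≤ b ∧ z.im ≤ 0})
    (hd : DifferentiableOn ℂ f {z | a < z.re ∧ z.re < b ∧ z.im < 0})
    (hb : ∀ z : ℂ, a ≤ z.re → z.re ≤ b → z.im ≤ 0 → ‖f z‖ ≤ C * Real.exp (-z.im)) (l : ℕ) :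
    ∫ x in (a : ℝ)..b, f x * Complex.exp (-(2 * Real.pi * (l + 1)) * I * x) =
      -I * (∫ t in Ioi (0 : ℝ), f (a - t * I) * Real.exp (-(2 * Real.pi * (l + 1)) * t)) +
      I * ∫ t in Ioi (0 : ℝ), f (b - t * I) * Real.exp (-(2 * Real.pi * (l + 1)) * t) := by
  have hab' : (a : ℝ) ≤ b := by exact_mod_cast hab
  have hδ : 0 < 2 * Real.pi * (l + 1) - 1 := by
    have := Real.pi_gt_three
    have := (Nat.cast_nonneg l : (0 : ℝ) ≤ l)
    nlinarith
  have := integral_eq_of_lower_strip (C := C)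
    (h := fun z => f z * Complex.exp (-(2 * Real.pi * (l + 1)) * I * z)) hab' hδ
    (hc.mul (by fun_prop)) (hd.mul (by fun_prop)) (fun z h1 h2 h3 => by
      rw [norm_mul, Complex.norm_exp]
      refine (mul_le_mul_of_nonneg_right (hb z h1 h2 h3) (Real.exp_pos _).le).trans (le_of_eq ?_)
      rw [mul_assoc, ← Real.exp_add]
      congr 2
      have : -(2 * Real.pi * (l + 1)) * I * z =
        ((-(2 * Real.pi * (l + 1)) : ℝ) : ℂ) * (I * z) := by push_cast; ring
      rw [this, re_ofReal_mul]
      simp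
      ring)
  rw [this]
  simp only [ofReal_intCast, exp_fourier_vertical]

theorem hasSum_integral_planck {D : ℝ → ℂ}
    (hm : AEStronglyMeasurable D (volume.restrict (Ioi 0)))
    (hD : IntegrableOn (fun t => D t * planck t) (Ioi 0)) :
    HasSum (fun l : ℕ => ∫ t in Ioi (0 : ℝ), D t * Real.exp (-(2 * Real.pi * (l + 1)) * t))
      (∫ t in Ioi (0 : ℝ), D t * planck t) := by
  have hs : ∀ᵐ t ∂(volume.restrict (Ioi (0 : ℝ))), HasSum
      (fun l : ℕ => ‖D t‖ * Real.exp (-(2 * Real.pi * (l + 1)) * t)) (‖D t‖ * planck t) :=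
    (ae_restrict_mem measurableSet_Ioi).mono fun t ht => (hasSum_planck ht).mul_left _
  refine hasSum_integral_of_dominated_convergence
    (fun l t => ‖D t‖ * Real.exp (-(2 * Real.pi * (l + 1)) * t)) (fun l => ?_)
    (fun l => Eventually.of_forall fun t => ?_) (hs.mono fun t h => h.summable) ?_ ?_
  · exact hm.mul (Continuous.aestronglyMeasurable (by fun_prop))
  · rw [norm_mul, norm_real, Real.norm_of_nonneg (Real.exp_pos _).le]
  · refine hD.norm.congr ?_
    filter_upwards [hs, ae_restrict_mem measurableSet_Ioi] with t h ht
    rw [h.tsum_eq, norm_mul, norm_real, Real.norm_of_nonneg (planck_nonneg ht)]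
  · refine (ae_restrict_mem measurableSet_Ioi).mono fun t ht => HasSum.mul_left _ ?_
    simpa using (hasSum_planck ht).mapL Complex.ofRealCLM

open scoped FourierTransform in
/-- Poisson summation when the Fourier coefficients are Laplace transforms. -/
theorem tsum_eq_integral_add_planck {F : ℝ → ℂ} (hF : Continuous F) {p : ℝ} (hp : 1 < p)
    (hdecay : F =O[cocompact ℝ] fun x => |x| ^ (-p)) {Dm Dp : ℝ → ℂ}
    (hmm : AEStronglyMeasurable Dm (volume.restrict (Ioi 0)))
    (hmp : AEStronglyMeasurable Dp (volume.restrict (Ioi 0)))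
    (hDm : IntegrableOn (fun t => Dm t * planck t) (Ioi 0))
    (hDp : IntegrableOn (fun t => Dp t * planck t) (Ioi 0))
    (hm : ∀ l : ℕ, ∫ x : ℝ, F x * Complex.exp (-(2 * Real.pi * (l + 1)) * I * x) =
      ∫ t in Ioi (0 : ℝ), Dm t * Real.exp (-(2 * Real.pi * (l + 1)) * t))
    (hp' : ∀ l : ℕ, ∫ x : ℝ, F x * Complex.exp (2 * Real.pi * (l + 1) * I * x) =
      ∫ t in Ioi (0 : ℝ), Dp t * Real.exp (-(2 * Real.pi * (l + 1)) * t)) :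
    ∑' n : ℤ, F n = (∫ x, F x) + ((∫ t in Ioi (0 : ℝ), Dm t * planck t) +
      ∫ t in Ioi (0 : ℝ), Dp t * planck t) := by
  have e : ∀ y : ℝ, 𝓕 F y = ∫ x : ℝ, F x * Complex.exp (-(2 * Real.pi * y) * I * x) := by
    intro y
    rw [Real.fourier_eq' F y]
    congr 1
    funext x
    rw [smul_eq_mul, mul_comm]
    congr 2
    simp
    ring
  have hsm := hasSum_integral_planck hmm hDm
  have hsp := hasSum_integral_planck hmp hDp
  have h1 : HasSum (fun n : ℕ => 𝓕 F ((n : ℤ) : ℝ))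
      ((∫ x, F x) + ∫ t in Ioi (0 : ℝ), Dm t * planck t) := by
    rw [← hasSum_nat_add_iff' 1]
    simp only [Finset.range_one, Finset.sum_singleton, Nat.cast_zero, Int.cast_zero]
    convert! hsm using 1
    · funext l
      rw [e, ← hm]
      push_cast
      rfl
    · rw [e]
      simp
  have h2 : HasSum (fun n : ℕ => 𝓕 F (((-((n : ℤ) + 1) : ℤ)) : ℝ))
      (∫ t in Ioi (0 : ℝ), Dp t * planck t) := by
    convert! hsp using 1
    funext l
    rw [e, ← hp']
    push_cast
    congr 1
    funext x
    congr 3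
    ring
  have h3 := HasSum.of_nat_of_neg_add_one (f := fun n : ℤ => 𝓕 F (n : ℝ)) h1 h2
  have := Real.tsum_eq_tsum_fourier_of_rpow_decay_of_summable hF hp hdecay h3.summable 0
  simp only [zero_add] at this
  rw [this, ← add_assoc, ← h3.tsum_eq]
  refine tsum_congr fun n => ?_
  simp

theorem continuousOn_vertical {f : ℂ → ℂ} {S : Set ℂ} (hc : ContinuousOn f S) {x ε : ℝ}
    (hS : ∀ t : ℝ, 0 ≤ t → (x : ℂ) + ε * t * I ∈ S) :
    AEStronglyMeasurable (fun t : ℝ => f (x + ε * t * I)) (volume.restrict (Ioi 0)) :=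
  (hc.comp (f := fun t : ℝ => (x : ℂ) + ε * t * I) (s := Ioi 0) (by fun_prop)
    fun t (ht : 0 < t) => hS t ht.le).aestronglyMeasurable measurableSet_Ioi

/-- Fourier coefficients over `[0, m]` as Laplace integrals, for both signs of the frequency. -/
theorem fourier_integral_eq {m : ℕ} {C : ℝ} {f : ℂ → ℂ}
    (hc : ContinuousOn f {z | 0 ≤ z.re ∧ z.re ≤ m})
    (hd : DifferentiableOn ℂ f {z | 0 < z.re ∧ z.re < m})
    (hb : ∀ z : ℂ, 0 ≤ z.re → z.re ≤ m → ‖f z‖ ≤ C * Real.exp |z.im|) {ε : ℝ}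
    (hε : ε = 1 ∨ ε = -1) (l : ℕ) :
    ∫ x in (0 : ℝ)..m, f x * Complex.exp (ε * (2 * Real.pi * (l + 1)) * I * x) =
      ε * I * (∫ t in Ioi (0 : ℝ),
        f ((0 : ℝ) + ε * t * I) * Real.exp (-(2 * Real.pi * (l + 1)) * t)) -
      ε * I * ∫ t in Ioi (0 : ℝ),
        f ((m : ℝ) + ε * t * I) * Real.exp (-(2 * Real.pi * (l + 1)) * t) := by
  rcases hε with rfl | rfl
  · have := fourier_integral_eq_of_strip (a := -m) (b := 0) (by simp) (f := fun z => f (-z))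
      (C := C)
      (hc.comp (by fun_prop) fun z hz => by
        have h1 := hz.1
        have h2 := hz.2.1
        simp at h1 h2 ⊢
        exact ⟨h2, by linarith⟩)
      (hd.comp (by fun_prop) fun z hz => by
        have h1 := hz.1
        have h2 := hz.2.1
        simp at h1 h2 ⊢
        exact ⟨h2, by linarith⟩)
      (fun z ha hb' hc' => by
        have := hb (-z) (by simpa using hb') (by simp at ha ⊢; linarith)
        rwa [neg_im, abs_of_nonneg (by linarith)] at this) l
    have hneg := intervalIntegral.integral_comp_neg (a := 0) (b := (m : ℝ))
      (fun x : ℝ => f (-x) * Complex.exp (-(2 * Real.pi * (l + 1)) * I * x))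
    simp only [Int.cast_zero, Int.cast_neg, Int.cast_natCast] at this
    rw [neg_zero, this] at hneg
    simp only [ofReal_neg, neg_neg, neg_mul, mul_neg] at hneg
    simp only [ofReal_one, one_mul]
    rw [hneg]
    simp [sub_eq_add_neg, add_comm]
  · have := fourier_integral_eq_of_strip (a := 0) (b := m) (by positivity) (f := f) (C := C)
      (hc.mono fun z hz => by simpa using And.intro hz.1 hz.2.1)
      (hd.mono fun z hz => by simpa using And.intro hz.1 hz.2.1)
      (fun z ha hb' hc' => by
        have := hb z (by simpa using ha) (by simpa using hb')
        rwa [abs_of_nonpos hc'] at this) l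
    simp only [Int.cast_zero, Int.cast_natCast] at this
    simp only [ofReal_neg, ofReal_one, neg_one_mul]
    rw [this]
    simp [sub_eq_add_neg]

theorem integrableOn_mul_exp_of_planck {D : ℝ → ℂ}
    (hm : AEStronglyMeasurable D (volume.restrict (Ioi 0)))
    (hD : IntegrableOn (fun t => D t * planck t) (Ioi 0)) (l : ℕ) :
    IntegrableOn (fun t => D t * Real.exp (-(2 * Real.pi * (l + 1)) * t)) (Ioi 0) := by
  refine hD.norm.mono' (hm.mul (Continuous.aestronglyMeasurable (by fun_prop))) ?_
  refine (ae_restrict_mem measurableSet_Ioi).mono fun t ht => ?_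
  rw [norm_mul, norm_mul, norm_real, norm_real, Real.norm_of_nonneg (planck_nonneg ht),
    Real.norm_of_nonneg (Real.exp_pos _).le]
  exact mul_le_mul_of_nonneg_left
    (le_hasSum (hasSum_planck ht) l fun _ _ => (Real.exp_pos _).le) (norm_nonneg _)

/-- The Abel–Plana formula on `[0, m]` for a function vanishing at the end points. -/
theorem sum_eq_integral_add_planck {m : ℕ} {C : ℝ} {f : ℂ → ℂ}
    (hc : ContinuousOn f {z | 0 ≤ z.re ∧ z.re ≤ m})
    (hd : DifferentiableOn ℂ f {z | 0 < z.re ∧ z.re < m})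
    (hb : ∀ z : ℂ, 0 ≤ z.re → z.re ≤ m → ‖f z‖ ≤ C * Real.exp |z.im|)
    (h0 : f 0 = 0) (hfm : f m = 0)
    (hi : ∀ x : ℝ, x = 0 ∨ x = m → ∀ ε : ℝ, ε = 1 ∨ ε = -1 →
      IntegrableOn (fun t : ℝ => f (x + ε * t * I) * planck t) (Ioi 0)) :
    ∑ n ∈ Finset.range (m + 1), f n = (∫ x in (0 : ℝ)..m, f x) +
      (-I * (∫ t in Ioi (0 : ℝ), f ((0 : ℝ) + (-1 : ℝ) * t * I) * planck t) +
       I * (∫ t in Ioi (0 : ℝ), f ((m : ℝ) + (-1 : ℝ) * t * I) * planck t) +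
       I * (∫ t in Ioi (0 : ℝ), f ((0 : ℝ) + (1 : ℝ) * t * I) * planck t) -
       I * (∫ t in Ioi (0 : ℝ), f ((m : ℝ) + (1 : ℝ) * t * I) * planck t)) := by
  have hm0 : (0 : ℝ) ≤ m := Nat.cast_nonneg m
  set F : ℝ → ℂ := fun x => f (max 0 (min x m) : ℝ) with hF
  have hFc : Continuous F := by
    rw [← continuousOn_univ]
    exact hc.comp (f := fun x : ℝ => ((max 0 (min x m) : ℝ) : ℂ))
      (Continuous.continuousOn (by fun_prop)) fun x _ => by simp
  have hF0 : ∀ x, x ∉ Ioc (0 : ℝ) m → F x = 0 := by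
    intro x hx
    rw [mem_Ioc, not_and_or, not_lt, not_le] at hx
    rcases hx with hx | hx
    · simp [hF, max_eq_left ((min_le_left x (m : ℝ)).trans hx), h0]
    · simp [hF, min_eq_right hx.le, hfm]
  have hF1 : ∀ x : ℝ, 0 ≤ x → x ≤ m → F x = f x := fun x h1 h2 => by
    simp only [hF, min_eq_left h2, max_eq_right h1]
  have hint : ∀ g : ℝ → ℂ, ∫ x, F x * g x = ∫ x in (0 : ℝ)..m, f x * g x := by
    intro g
    rw [intervalIntegral.integral_of_le hm0,
      ← setIntegral_eq_integral_of_forall_compl_eq_zero (s := Ioc (0 : ℝ) m)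
        fun x hx => by rw [hF0 x hx, zero_mul]]
    exact setIntegral_congr_fun measurableSet_Ioc fun x hx => by
      rw [hF1 x hx.1.le hx.2]
  have hmeas : ∀ x : ℝ, x = 0 ∨ x = m → ∀ ε : ℝ,
      AEStronglyMeasurable (fun t : ℝ => f (x + ε * t * I)) (volume.restrict (Ioi 0)) := by
    intro x hx ε
    refine continuousOn_vertical hc fun t _ => ?_
    rcases hx with rfl | rfl <;> simp
  have hint' : ∀ x : ℝ, x = 0 ∨ x = m → ∀ ε : ℝ, ε = 1 ∨ ε = -1 → ∀ l : ℕ,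
      IntegrableOn (fun t : ℝ => f (x + ε * t * I) *
        Real.exp (-(2 * Real.pi * (l + 1)) * t)) (Ioi 0) := fun x hx ε hε l =>
    integrableOn_mul_exp_of_planck (hmeas x hx ε) (hi x hx ε hε) l
  have hz : (0 : ℝ) = 0 ∨ (0 : ℝ) = m := Or.inl rfl
  have hmm : (m : ℝ) = 0 ∨ (m : ℝ) = m := Or.inr rfl
  have h1 : (1 : ℝ) = 1 ∨ (1 : ℝ) = -1 := Or.inl rfl
  have h2 : (-1 : ℝ) = 1 ∨ (-1 : ℝ) = -1 := Or.inr rfl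
  have key := tsum_eq_integral_add_planck hFc (p := 2) one_lt_two ?_
    (Dm := fun t => -I * f ((0 : ℝ) + (-1 : ℝ) * t * I) + I * f ((m : ℝ) + (-1 : ℝ) * t * I))
    (Dp := fun t => I * f ((0 : ℝ) + (1 : ℝ) * t * I) - I * f ((m : ℝ) + (1 : ℝ) * t * I))
    (((hmeas _ hz _).const_mul _).add ((hmeas _ hmm _).const_mul _))
    (((hmeas _ hz _).const_mul _).sub ((hmeas _ hmm _).const_mul _)) ?_ ?_ ?_ ?_
  · have hsum : ∑' n : ℤ, F n = ∑ n ∈ Finset.range (m + 1), f n := by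
      rw [tsum_eq_sum (s := (Finset.range (m + 1)).map Nat.castEmbedding), Finset.sum_map]
      · refine Finset.sum_congr rfl fun n hn => ?_
        have hn' : (n : ℝ) ≤ m := by
          exact_mod_cast Nat.lt_succ_iff.1 (Finset.mem_range.1 hn)
        simp [hF1 n (Nat.cast_nonneg n) hn']
      · intro n hn
        refine hF0 _ fun h => hn ?_
        have ha : 0 < n := by exact_mod_cast h.1
        have hb' : n ≤ m := by exact_mod_cast h.2
        simp only [Finset.mem_map, Finset.mem_range]
        exact ⟨n.toNat, by omega, by simp; omega⟩
    rw [← hsum, key]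
    have hI := hint fun _ => 1
    simp only [mul_one] at hI
    rw [hI]
    congr 1
    simp only [add_mul, sub_mul, mul_assoc (-I), mul_assoc I]
    have := hi 0 hz 1 h1
    rw [integral_add ((hi _ hz _ h2).const_mul _) ((hi _ hmm _ h2).const_mul _),
      integral_sub ((hi _ hz _ h1).const_mul _) ((hi _ hmm _ h1).const_mul _)]
    simp only [integral_const_mul, ofReal_zero]
    ring
  · refine Asymptotics.IsBigO.of_bound 0 ?_
    filter_upwards [(isCompact_Icc (a := (0 : ℝ)) (b := m)).compl_mem_cocompact] with x hx
    rw [hF0 x fun h => hx ⟨h.1.le, h.2⟩]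
    simp
  · simp only [add_mul, mul_assoc (-I), mul_assoc I]
    exact ((hi _ hz _ h2).const_mul _).add ((hi _ hmm _ h2).const_mul _)
  · simp only [sub_mul, mul_assoc I]
    exact ((hi _ hz _ h1).const_mul _).sub ((hi _ hmm _ h1).const_mul _)
  · intro l
    have := fourier_integral_eq hc hd hb h2 l
    simp only [ofReal_neg, ofReal_one, neg_one_mul] at this
    rw [hint, this]
    simp only [add_mul, mul_assoc (-I), mul_assoc I]
    rw [integral_add ((hint' _ hz _ h2 l).const_mul _) ((hint' _ hmm _ h2 l).const_mul _),
      integral_const_mul, integral_const_mul]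
    simp
  · intro l
    have := fourier_integral_eq hc hd hb h1 l
    simp only [ofReal_one, one_mul] at this
    rw [hint, this]
    simp only [sub_mul, mul_assoc I]
    rw [integral_sub ((hint' _ hz _ h1 l).const_mul _) ((hint' _ hmm _ h1 l).const_mul _),
      integral_const_mul, integral_const_mul]
    simp

/-- The Abel–Plana formula on `[0, ∞)` for a decaying function vanishing at `0`. -/
theorem tsum_nat_eq_integral_add_planck {p C : ℝ} (hp : 1 < p) {f : ℂ → ℂ}
    (hc : ContinuousOn f {z | 0 ≤ z.re}) (hd : DifferentiableOn ℂ f {z | 0 < z.re})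
    (hb : ∀ z : ℂ, 0 ≤ z.re → ‖f z‖ ≤ C * (1 + z.re) ^ (-p) * Real.exp |z.im|) (h0 : f 0 = 0)
    (hi : ∀ ε : ℝ, ε = 1 ∨ ε = -1 →
      IntegrableOn (fun t : ℝ => f ((0 : ℝ) + ε * t * I) * planck t) (Ioi 0)) :
    ∑' n : ℕ, f n = (∫ x in Ioi (0 : ℝ), f x) +
      (-I * (∫ t in Ioi (0 : ℝ), f ((0 : ℝ) + (-1 : ℝ) * t * I) * planck t) +
       I * ∫ t in Ioi (0 : ℝ), f ((0 : ℝ) + (1 : ℝ) * t * I) * planck t) := by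
  have hC : 0 ≤ C := by simpa [h0] using hb 0 le_rfl
  set F : ℝ → ℂ := fun x => f (max 0 x : ℝ) with hF
  have hFc : Continuous F := by
    rw [← continuousOn_univ]
    exact hc.comp (f := fun x : ℝ => ((max 0 x : ℝ) : ℂ))
      (Continuous.continuousOn (by fun_prop)) fun x _ => by simp
  have hF0 : ∀ x, x ∉ Ioi (0 : ℝ) → F x = 0 := by
    intro x hx
    rw [mem_Ioi, not_lt] at hx
    simp [hF, max_eq_left hx, h0]
  have hF1 : ∀ x : ℝ, 0 ≤ x → F x = f x := fun x h1 => by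
    simp only [hF, max_eq_right h1]
  have hFb : ∀ x : ℝ, 0 < x → ‖f x‖ ≤ C * x ^ (-p) := fun x hx => by
    refine (hb x (by simpa using hx.le)).trans ?_
    simp only [ofReal_re, ofReal_im, abs_zero, Real.exp_zero, mul_one]
    exact mul_le_mul_of_nonneg_left
      (Real.rpow_le_rpow_of_nonpos hx (by linarith) (by linarith)) hC
  have hint : ∀ g : ℝ → ℂ, ∫ x, F x * g x = ∫ x in Ioi (0 : ℝ), f x * g x := by
    intro g
    rw [← setIntegral_eq_integral_of_forall_compl_eq_zero (s := Ioi (0 : ℝ))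
        fun x hx => by rw [hF0 x hx, zero_mul]]
    exact setIntegral_congr_fun measurableSet_Ioi fun x hx => by
      rw [hF1 x (le_of_lt hx)]
  have hfi : IntegrableOn (fun x : ℝ => f x) (Ioi 0) := by
    have hcont : ContinuousOn (fun x : ℝ => f x) (Ici 0) :=
      hc.comp (by fun_prop) fun x hx => by simpa using hx
    rw [← Ioc_union_Ioi_eq_Ioi zero_le_one, integrableOn_union]
    constructor
    · exact ((hcont.mono fun x hx => hx.1).integrableOn_Icc).mono_set Ioc_subset_Icc_self
    · refine Integrable.mono' ((integrableOn_Ioi_rpow_of_lt (by linarith : -p < -1)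
        one_pos).const_mul C) ((hcont.mono fun x (hx : 1 < x) =>
          (zero_le_one.trans hx.le : (0 : ℝ) ≤ x)).aestronglyMeasurable measurableSet_Ioi) ?_
      exact (ae_restrict_mem measurableSet_Ioi).mono fun x hx =>
        hFb x (zero_lt_one.trans hx)
  have hmeas : ∀ ε : ℝ,
      AEStronglyMeasurable (fun t : ℝ => f ((0 : ℝ) + ε * t * I)) (volume.restrict (Ioi 0)) :=
    fun ε => continuousOn_vertical hc fun t _ => by simp
  have hfourier : ∀ ε : ℝ, ε = 1 ∨ ε = -1 → ∀ l : ℕ,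
      ∫ x, F x * Complex.exp (ε * (2 * Real.pi * (l + 1)) * I * x) =
        ε * I * (∫ t in Ioi (0 : ℝ),
          f ((0 : ℝ) + ε * t * I) * Real.exp (-(2 * Real.pi * (l + 1)) * t)) := by
    intro ε hε l
    rw [hint]
    have hleft : IntegrableOn (fun x : ℝ =>
        f x * Complex.exp (ε * (2 * Real.pi * (l + 1)) * I * x)) (Ioi 0) := by
      refine hfi.mul_bdd (c := 1) (Continuous.aestronglyMeasurable (by fun_prop))
        (Eventually.of_forall fun x => ?_)
      rw [Complex.norm_exp]
      simp
    have hlim := (intervalIntegral_tendsto_integral_Ioi 0 hleft tendsto_id).comp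
      tendsto_natCast_atTop_atTop
    have hexp : IntegrableOn (fun t : ℝ => Real.exp (-1 * t)) (Ioi 0) :=
      integrableOn_exp_mul_Ioi (by norm_num) 0
    have hzero : Tendsto (fun m : ℕ => ∫ t in Ioi (0 : ℝ),
        f ((m : ℝ) + ε * t * I) * Real.exp (-(2 * Real.pi * (l + 1)) * t)) atTop (𝓝 0) := by
      have hb0 : Tendsto (fun m : ℕ => C * (1 + (m : ℝ)) ^ (-p) *
          ∫ t in Ioi (0 : ℝ), Real.exp (-1 * t)) atTop (𝓝 0) := by
        have h1 : Tendsto (fun m : ℕ => 1 + (m : ℝ)) atTop atTop :=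
          tendsto_atTop_add_const_left _ _ tendsto_natCast_atTop_atTop
        have := (tendsto_rpow_neg_atTop (by linarith : 0 < p)).comp h1
        simpa using (this.const_mul C).mul_const _
      refine squeeze_zero_norm (fun m => ?_) hb0
      rw [← integral_const_mul]
      refine norm_integral_le_of_norm_le (hexp.const_mul _) ?_
      refine (ae_restrict_mem measurableSet_Ioi).mono fun t (ht : 0 < t) => ?_
      rw [norm_mul, norm_real, Real.norm_of_nonneg (Real.exp_pos _).le]
      have hε1 : |ε| = 1 := by rcases hε with rfl | rfl <;> simp
      have := hb ((m : ℝ) + ε * t * I) (by simp)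
      simp only [add_re, ofReal_natCast, natCast_re, mul_re, ofReal_re, ofReal_im, I_re, I_im,
        mul_zero, zero_mul, sub_zero, mul_im, add_zero, mul_one, sub_self, add_im, natCast_im,
        zero_add, abs_mul, hε1, one_mul, abs_of_pos ht] at this
      rw [ofReal_natCast]
      refine (mul_le_mul_of_nonneg_right this (Real.exp_pos _).le).trans ?_
      rw [mul_assoc, ← Real.exp_add]
      refine mul_le_mul_of_nonneg_left (Real.exp_le_exp.2 ?_) (by positivity)
      have h3 := Real.pi_gt_three
      have h4 : 0 ≤ Real.pi * l * t := by positivity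
      nlinarith
    refine tendsto_nhds_unique (hlim.congr fun m => ?_)
      (by simpa using (tendsto_const_nhds (x := ε * I * (∫ t in Ioi (0 : ℝ),
          f ((0 : ℝ) + ε * t * I) * Real.exp (-(2 * Real.pi * (l + 1)) * t)))).sub
            (hzero.const_mul (ε * I)))
    have := fourier_integral_eq (m := m) (C := C) (hc.mono fun z hz => hz.1)
      (hd.mono fun z hz => hz.1) (fun z hz _ => (hb z hz).trans ?_) hε l
    · simpa using this
    · refine mul_le_mul_of_nonneg_right ?_ (Real.exp_pos _).le
      exact mul_le_of_le_one_right hC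
        (Real.rpow_le_one_of_one_le_of_nonpos (by linarith) (by linarith))
  have h1 : (1 : ℝ) = 1 ∨ (1 : ℝ) = -1 := Or.inl rfl
  have h2 : (-1 : ℝ) = 1 ∨ (-1 : ℝ) = -1 := Or.inr rfl
  have key := tsum_eq_integral_add_planck hFc hp ?_
    (Dm := fun t => -I * f ((0 : ℝ) + (-1 : ℝ) * t * I))
    (Dp := fun t => I * f ((0 : ℝ) + (1 : ℝ) * t * I))
    ((hmeas _).const_mul _) ((hmeas _).const_mul _) ?_ ?_ ?_ ?_
  · have hsum : ∑' n : ℤ, F n = ∑' n : ℕ, f n := by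
      rw [← (Nat.cast_injective (R := ℤ)).tsum_eq (f := fun n : ℤ => F n)]
      · refine tsum_congr fun n => ?_
        simp [hF1 n (Nat.cast_nonneg n)]
      · intro n hn
        by_contra h
        refine hn (hF0 _ fun h' => h ?_)
        have : (0 : ℝ) < n := h'
        have : 0 < n := by exact_mod_cast this
        exact ⟨n.toNat, by simp; omega⟩
    rw [← hsum, key]
    have hI := hint fun _ => 1
    simp only [mul_one] at hI
    rw [hI]
    simp only [mul_assoc (-I), mul_assoc I, integral_const_mul]
  · refine Asymptotics.IsBigO.of_bound C (Eventually.of_forall fun x => ?_)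
    rw [Real.norm_of_nonneg (by positivity)]
    by_cases hx : 0 < x
    · rw [hF1 x hx.le, abs_of_pos hx]
      exact hFb x hx
    · rw [hF0 x hx, norm_zero]
      positivity
  · simp only [mul_assoc (-I)]
    exact (hi _ h2).const_mul _
  · simp only [mul_assoc I]
    exact (hi _ h1).const_mul _
  · intro l
    have := hfourier _ h2 l
    simp only [ofReal_neg, ofReal_one, neg_one_mul] at this
    rw [this]
    simp only [mul_assoc (-I), integral_const_mul]
    simp
  · intro l
    have := hfourier _ h1 l
    simp only [ofReal_one, one_mul] at this
    rw [this]
    simp only [mul_assoc I, integral_const_mul]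
    simp

theorem ofReal_mul_cpow {a : ℝ} (ha : 0 < a) {w : ℂ} (hw : w ≠ 0) (s : ℂ) :
    ((a : ℂ) * w) ^ s = (a : ℂ) ^ s * w ^ s := by
  have ha' : (a : ℂ) ≠ 0 := ofReal_ne_zero.2 ha.ne'
  rw [cpow_def_of_ne_zero (mul_ne_zero ha' hw), cpow_def_of_ne_zero ha', cpow_def_of_ne_zero hw,
    log_ofReal_mul ha hw, ← Complex.exp_add, ofReal_log ha.le]
  ring_nf

theorem sign_mul_I_cpow {ε t : ℝ} (hε : ε = 1 ∨ ε = -1) (ht : 0 < t) (s : ℂ) :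
    ((ε : ℂ) * t * I) ^ (-s) = exp (-(ε * (I * (Real.pi * s / 2)))) * (t : ℂ) ^ (-s) := by
  have h : (ε : ℂ) * t * I = (t : ℂ) * (ε * I) := by ring
  have hne : (ε : ℂ) * I ≠ 0 := by rcases hε with rfl | rfl <;> simp
  have hlog : log ((ε : ℂ) * I) = ε * (Real.pi / 2 * I) := by
    rcases hε with rfl | rfl
    · simp [log_I]
    · rw [show ((-1 : ℝ) : ℂ) * I = -I by simp, log_neg_I]
      push_cast
      ring
  rw [h, ofReal_mul_cpow ht hne, mul_comm, cpow_def_of_ne_zero hne, hlog]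
  ring_nf

theorem ofReal_add_mul_I_cpow {a : ℝ} (ha : 0 < a) (b : ℝ) (s : ℂ) :
    ((a : ℂ) + b * I) ^ s = (a : ℂ) ^ s * (1 + ((b / a : ℝ) : ℂ) * I) ^ s := by
  have ha' : (a : ℂ) ≠ 0 := ofReal_ne_zero.2 ha.ne'
  rw [← ofReal_mul_cpow ha]
  · congr 1
    push_cast
    field_simp
  · intro h
    have := congrArg Complex.re h
    simp at this

theorem pairRem_zero (β m : ℝ) (s : ℂ) (t : ℝ) : pairRem 0 β m s t = pairPow β s (t / m) := by
  simp [pairRem, pairPoly]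

theorem pairPow_neg_one_neg (s : ℂ) (t : ℝ) : pairPow (-1) s (-t) = pairPow (-1) s t := by
  simp only [pairPow]
  push_cast
  rw [mul_comm]
  ring_nf

theorem cpow_mul_pairPow_neg_one {m : ℝ} (hm : 0 < m) {ε t : ℝ} (hε : ε = 1 ∨ ε = -1) (s : ℂ) :
    ((m : ℂ) - ε * t * I) ^ (-s) * ((m : ℂ) + ε * t * I) ^ (-s) =
      (m : ℂ) ^ (-(2 * s)) * pairRem 0 (-1) (ε * m) s t := by
  have h1 := ofReal_add_mul_I_cpow hm (-(ε * t)) (-s)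
  have h2 := ofReal_add_mul_I_cpow hm (ε * t) (-s)
  have hm' : (m : ℂ) ≠ 0 := ofReal_ne_zero.2 hm.ne'
  have e : t / (ε * m) = ε * t / m := by rcases hε with rfl | rfl <;> field_simp
  rw [pairRem_zero, e, show -(2 * s) = -s + -s by ring, cpow_add _ _ hm', pairPow,
    show (m : ℂ) - ε * t * I = m + ((-(ε * t) : ℝ) : ℂ) * I by push_cast; ring, h1,
    show (m : ℂ) + ε * t * I = m + ((ε * t : ℝ) : ℂ) * I by push_cast; ring, h2]
  push_cast
  ring_nf

theorem cpow_mul_pairPow_half {m : ℝ} (hm : 0 < m) {ε t : ℝ} (hε : ε = 1 ∨ ε = -1) (s : ℂ) :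
    ((m : ℂ) + ε * t * I) ^ (-s) * ((2 * m : ℂ) + ε * t * I) ^ (-s) =
      (m : ℂ) ^ (-(2 * s)) * 2 ^ (-s) * pairRem 0 (1 / 2) (ε * m) s t := by
  have h1 := ofReal_add_mul_I_cpow hm (ε * t) (-s)
  have h2 := ofReal_add_mul_I_cpow (a := 2 * m) (by positivity) (ε * t) (-s)
  have hm' : (m : ℂ) ≠ 0 := ofReal_ne_zero.2 hm.ne'
  have e : t / (ε * m) = ε * t / m := by rcases hε with rfl | rfl <;> field_simp
  have h3 := mul_cpow_ofReal_nonneg (a := 2) (b := m) (by positivity) hm.le (-s)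
  rw [pairRem_zero, e, show -(2 * s) = -s + -s by ring, cpow_add _ _ hm', pairPow,
    show (m : ℂ) + ε * t * I = m + ((ε * t : ℝ) : ℂ) * I by push_cast; ring, h1,
    show (2 * m : ℂ) + ε * t * I = ((2 * m : ℝ) : ℂ) + ((ε * t : ℝ) : ℂ) * I by push_cast; ring, h2]
  push_cast at h3 ⊢
  rw [h3]
  have : ∀ x : ℂ, x / (2 * m) = 1 / 2 * (x / m) := fun x => by field_simp
  rw [this]
  ring

theorem integrableOn_planckInt_pairRem {s a : ℂ} {J : ℕ} (ha : a.re < J) {β m : ℝ} (hβ : |β| ≤ 1)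
    (hm : 1 ≤ |m|) :
    IntegrableOn (fun t : ℝ => (t : ℂ) ^ (-a) * pairRem J β m s t * planck t) (Ioi 0) := by
  obtain ⟨C, hC, K, h⟩ := pairRem_bound_locally J hβ s
  exact integrableOn_planckInt_integrand (C := C * (1 / |m|) ^ J) (by positivity)
    (measurable_pairRem J β m s) (fun t ht => h s (Metric.mem_ball_self one_pos) m hm t ht) ha

theorem planckInt_pairRem_zero {s a : ℂ} (ha : a.re < 0) {β m : ℝ} (hβ : |β| ≤ 1) (hm : 1 ≤ |m|) :
    planckInt a (pairRem 0 β m s) =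
      planckInt a (fun _ => 1) + planckInt a (pairRem 1 β m s) := by
  have h1 : IntegrableOn (fun t : ℝ => (t : ℂ) ^ (-a) * (1 : ℂ) * planck t) (Ioi 0) :=
    integrableOn_planckInt_integrand (g := fun _ => (1 : ℂ)) (C := 1) (J := 0) (K := 0) zero_le_one
      measurable_const (fun t _ => by simp) (by simpa using ha)
  have h2 := integrableOn_planckInt_pairRem (J := 1) (s := s) (a := a) (by simp; linarith) hβ hm
  simp only [planckInt]
  rw [← integral_add h1 h2]
  refine integral_congr_ae (Eventually.of_forall fun t => ?_)
  simp only [pairRem_zero]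
  simp only [pairRem, pairPoly_one]
  ring

theorem norm_cpow_neg_le {s z : ℂ} {K : ℕ} (hs : ‖s‖ ≤ K) (hs0 : s.re ≤ 0) {L : ℝ} (hL : 1 ≤ L)
    (hz : ‖z‖ ≤ L) : ‖z ^ (-s)‖ ≤ L ^ K * Real.exp (Real.pi * K) := by
  refine (norm_cpow_le_of_norm_le hs z).trans (mul_le_mul_of_nonneg_right ?_ (Real.exp_pos _).le)
  refine (Real.rpow_le_rpow (norm_nonneg z) hz (by linarith)).trans ?_
  rw [← Real.rpow_natCast]
  exact Real.rpow_le_rpow_of_exponent_le hL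
    ((neg_le_abs _).trans ((abs_re_le_norm s).trans hs))

theorem I_mul_exp_sub_exp (x : ℂ) :
    I * (exp (-(I * x)) - exp (I * x)) = 2 * sin x := by
  rw [Complex.sin, mul_comm I x]
  ring_nf

/-- The contribution of the imaginary direction to the inner sum. -/
noncomputable def innerVert (m : ℝ) (s : ℂ) : ℂ :=
  (m : ℂ) ^ (-(2 * s)) * ((1 + 2 ^ (-s)) * riemannZeta s +
    (I * exp (-(I * (Real.pi * s / 2))) * planckInt s (pairRem 1 (-1) m s) -
      I * exp (I * (Real.pi * s / 2)) * planckInt s (pairRem 1 (-1) (-m) s)) +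
    2 ^ (-s) * (I * exp (-(I * (Real.pi * s / 2))) * planckInt s (pairRem 1 (1 / 2) (-m) s) -
      I * exp (I * (Real.pi * s / 2)) * planckInt s (pairRem 1 (1 / 2) m s)))

theorem sum_inner_eq {m : ℕ} (hm : 0 < m) {s : ℂ} (hs : s.re < 0) :
    ∑ n ∈ Finset.range (m + 1), ((n : ℂ) ^ (-s) * ((m : ℂ) - n) ^ (-s) * ((m : ℂ) + n) ^ (-s)) =
      (∫ x in (0 : ℝ)..m, ((x : ℂ) ^ (-s) * ((m : ℂ) - x) ^ (-s) * ((m : ℂ) + x) ^ (-s))) +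
        innerVert m s := by
  have hm1 : (1 : ℝ) ≤ m := by exact_mod_cast hm
  have hm0 : (0 : ℝ) < m := by linarith
  have hne : -s ≠ 0 := fun h => by simp [neg_eq_zero.1 h] at hs
  set f : ℂ → ℂ := fun z => z ^ (-s) * ((m : ℂ) - z) ^ (-s) * ((m : ℂ) + z) ^ (-s) with hf
  have hcp : ∀ z : ℂ, 0 ≤ z.re → ContinuousAt (fun z : ℂ => z ^ (-s)) z := fun z hz =>
    continuousAt_cpow_const_of_re_pos (Or.inl hz) (by simpa using hs)
  have hc : ContinuousOn f {z | 0 ≤ z.re ∧ z.re ≤ m} := by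
    rintro z ⟨h1, h2⟩
    refine ContinuousAt.continuousWithinAt (((hcp z h1).mul ?_).mul ?_)
    · exact ContinuousAt.comp (g := fun z : ℂ => z ^ (-s)) (f := fun z => (m : ℂ) - z)
        (hcp _ (by simp; linarith)) (by fun_prop)
    · exact ContinuousAt.comp (g := fun z : ℂ => z ^ (-s)) (f := fun z => (m : ℂ) + z)
        (hcp _ (by simp; linarith)) (by fun_prop)
  have hd : DifferentiableOn ℂ f {z | 0 < z.re ∧ z.re < m} := by
    rintro z ⟨h1, h2⟩
    refine DifferentiableAt.differentiableWithinAt ?_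
    refine ((differentiableAt_id.cpow_const (Or.inl (by simpa using h1))).mul
      (((differentiableAt_const _).sub differentiableAt_id).cpow_const (Or.inl ?_))).mul
      (((differentiableAt_const _).add differentiableAt_id).cpow_const (Or.inl ?_)) <;>
    · simp
      linarith
  obtain ⟨K, hK⟩ := exists_nat_ge ‖s‖
  have hb : ∀ z : ℂ, 0 ≤ z.re → z.re ≤ m → ‖f z‖ ≤
      ((2 * m) ^ (3 * K) * Real.exp (Real.pi * K) ^ 3 * ((3 * K).factorial * Real.exp 1)) *
        Real.exp |z.im| := by
    intro z h1 h2
    set L : ℝ := 2 * m * (1 + |z.im|) with hL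
    have hzi := abs_nonneg z.im
    have hL2 : 2 * m + |z.im| ≤ L := by rw [hL]; nlinarith
    have hL1 : 1 ≤ L := by linarith
    have hn : ∀ w : ℂ, |w.re| ≤ 2 * m → |w.im| = |z.im| → ‖w‖ ≤ L := fun w h3 h4 =>
      (norm_le_abs_re_add_abs_im w).trans (by rw [h4]; linarith)
    have e1 := norm_cpow_neg_le hK hs.le hL1 (hn z (abs_le.2 ⟨by linarith, by linarith⟩) rfl)
    have e2 := norm_cpow_neg_le hK hs.le hL1 (hn (m - z)
      (abs_le.2 ⟨by simp; linarith, by simp; linarith⟩) (by simp))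
    have e3 := norm_cpow_neg_le hK hs.le hL1 (hn (m + z)
      (abs_le.2 ⟨by simp; linarith, by simp; linarith⟩) (by simp))
    have e4 := one_add_pow_le (3 * K) hzi
    calc ‖f z‖ = ‖z ^ (-s)‖ * ‖((m : ℂ) - z) ^ (-s)‖ * ‖((m : ℂ) + z) ^ (-s)‖ := by
          simp [hf]
      _ ≤ (L ^ K * Real.exp (Real.pi * K)) * (L ^ K * Real.exp (Real.pi * K)) *
          (L ^ K * Real.exp (Real.pi * K)) := by gcongr
      _ = (2 * m) ^ (3 * K) * Real.exp (Real.pi * K) ^ 3 * (1 + |z.im|) ^ (3 * K) := by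
          rw [hL, mul_pow (2 * (m : ℝ)), pow_mul' (2 * (m : ℝ)), pow_mul' (1 + |z.im|)]; ring
      _ ≤ (2 * m) ^ (3 * K) * Real.exp (Real.pi * K) ^ 3 *
          ((3 * K).factorial * Real.exp 1 * Real.exp |z.im|) := by gcongr
      _ = _ := by ring
  have v0 : ∀ ε : ℝ, ε = 1 ∨ ε = -1 → ∀ t ∈ Ioi (0 : ℝ), f ((0 : ℝ) + ε * t * I) * planck t =
      (m : ℂ) ^ (-(2 * s)) * exp (-(ε * (I * (Real.pi * s / 2)))) *
        ((t : ℂ) ^ (-s) * pairRem 0 (-1) (ε * m) s t * planck t) := by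
    intro ε hε t ht
    have h1 := sign_mul_I_cpow hε ht s
    have h2 := cpow_mul_pairPow_neg_one hm0 (t := t) hε s
    simp only [ofReal_natCast] at h2
    simp only [hf, ofReal_zero, zero_add]
    rw [mul_assoc (_ ^ (-s)), h2, h1]
    ring
  have vm : ∀ ε : ℝ, ε = 1 ∨ ε = -1 → ∀ t ∈ Ioi (0 : ℝ), f ((m : ℝ) + ε * t * I) * planck t =
      (m : ℂ) ^ (-(2 * s)) * 2 ^ (-s) * exp (ε * (I * (Real.pi * s / 2))) *
        ((t : ℂ) ^ (-s) * pairRem 0 (1 / 2) (ε * m) s t * planck t) := by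
    intro ε hε t ht
    have h1 := sign_mul_I_cpow (ε := -ε) (by rcases hε with rfl | rfl <;> simp) ht s
    have h2 := cpow_mul_pairPow_half hm0 (t := t) hε s
    simp only [ofReal_natCast] at h2
    simp only [hf, ofReal_natCast]
    rw [show (m : ℂ) - (m + ε * t * I) = ((-ε : ℝ) : ℂ) * t * I by push_cast; ring,
      show (m : ℂ) + (m + ε * t * I) = 2 * m + ε * t * I by ring, mul_right_comm (_ ^ (-s)), h2, h1,
      ofReal_neg, neg_mul, neg_neg]
    ring
  have habs : ∀ ε : ℝ, ε = 1 ∨ ε = -1 → 1 ≤ |ε * m| := fun ε hε => by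
    rcases hε with rfl | rfl <;> simpa using hm1
  have hint : ∀ β : ℝ, |β| ≤ 1 → ∀ ε : ℝ, ε = 1 ∨ ε = -1 →
      IntegrableOn (fun t : ℝ => (t : ℂ) ^ (-s) * pairRem 0 β (ε * m) s t * planck t) (Ioi 0) :=
    fun β hβ ε hε => integrableOn_planckInt_pairRem (by simpa using hs) hβ (habs ε hε)
  have hh : |(1 / 2 : ℝ)| ≤ 1 := by rw [abs_of_pos] <;> norm_num
  have hn1 : |(-1 : ℝ)| ≤ 1 := by simp
  have hmain := sum_eq_integral_add_planck (m := m) hc hd hb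
    (by simp [hf, zero_cpow hne]) (by simp [hf, zero_cpow hne]) (by
      rintro x (rfl | rfl) ε hε
      · exact IntegrableOn.congr_fun ((hint (-1) hn1 ε hε).const_mul _)
          (fun t ht => (v0 ε hε t ht).symm) measurableSet_Ioi
      · exact IntegrableOn.congr_fun ((hint (1 / 2) hh ε hε).const_mul _)
          (fun t ht => (vm ε hε t ht).symm) measurableSet_Ioi)
  rw [setIntegral_congr_fun measurableSet_Ioi (v0 (-1) (Or.inr rfl)),
    setIntegral_congr_fun measurableSet_Ioi (vm (-1) (Or.inr rfl)),
    setIntegral_congr_fun measurableSet_Ioi (v0 1 (Or.inl rfl)),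
    setIntegral_congr_fun measurableSet_Ioi (vm 1 (Or.inl rfl)),
    integral_const_mul, integral_const_mul, integral_const_mul, integral_const_mul] at hmain
  have hp := fun β (hβ : |β| ≤ 1) ε (hε : ε = 1 ∨ ε = -1) =>
    planckInt_pairRem_zero (s := s) hs hβ (habs ε hε)
  have p1 := hp (-1) hn1 1 (Or.inl rfl)
  have p2 := hp (-1) hn1 (-1) (Or.inr rfl)
  have p3 := hp (1 / 2) hh 1 (Or.inl rfl)
  have p4 := hp (1 / 2) hh (-1) (Or.inr rfl)
  have hfold : ∀ g : ℝ → ℂ, ∫ t in Ioi (0 : ℝ), (t : ℂ) ^ (-s) * g t * planck t = planckInt s g :=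
    fun _ => rfl
  have hz := two_mul_sin_mul_planckInt_one hs
  rw [← I_mul_exp_sub_exp] at hz
  rw [hfold, hfold, hfold, hfold, p1, p2, p3, p4] at hmain
  rw [hmain, innerVert, ← hz]
  simp only [one_mul, neg_mul, neg_neg, ofReal_neg, ofReal_one, ofReal_natCast, hf]
  ring

/-- The horizontal contribution to the inner sum, for `m = 1`. -/
noncomputable def innerInt (s : ℂ) : ℂ :=
  Gamma ((1 - s) / 2) * Gamma (1 - s) / (2 * Gamma ((3 - 3 * s) / 2))

theorem integral_inner_eq {m : ℕ} (hm : 0 < m) {s : ℂ} (hs : s.re < 0) :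
    (∫ x in (0 : ℝ)..m, ((x : ℂ) ^ (-s) * ((m : ℂ) - x) ^ (-s) * ((m : ℂ) + x) ^ (-s))) =
      (m : ℂ) ^ (1 - 3 * s) * innerInt s := by
  have hm0 : (0 : ℝ) < m := by exact_mod_cast hm
  have hm' : (m : ℂ) ≠ 0 := by exact_mod_cast hm.ne'
  have hb := betaIntegral_scaled ((1 - s) / 2) (1 - s) (a := (m : ℝ) ^ 2) (by positivity)
  have hG := Gamma_mul_Gamma_eq_betaIntegral (s := (1 - s) / 2) (t := 1 - s)
    (by simp; linarith) (by simp; linarith)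
  have hne : Gamma ((1 - s) / 2 + (1 - s)) ≠ 0 :=
    Gamma_ne_zero_of_re_pos (by simp; linarith)
  rw [intervalIntegral.integral_of_le (by positivity), integral_Ioc_eq_integral_Ioo] at hb
  set g : ℝ → ℂ := (Ioo 0 ((m : ℝ) ^ 2)).indicator fun x : ℝ =>
    (x : ℂ) ^ ((1 - s) / 2 - 1) * (((m : ℝ) ^ 2 : ℝ) - (x : ℂ)) ^ (1 - s - 1) with hg
  have h1 := integral_comp_rpow_Ioi_of_pos (g := g) (p := 2) (by norm_num)
  have h2 : ∫ x in Ioi 0, g x = ((m : ℝ) ^ 2 : ℝ) ^ ((1 - s) / 2 + (1 - s) - 1) *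
      betaIntegral ((1 - s) / 2) (1 - s) := by
    rw [← hb, hg, setIntegral_indicator measurableSet_Ioo]
    congr 2
    ext x
    simp +contextual
  have h3 : ∀ x ∈ Ioi (0 : ℝ), ((2 : ℝ) * x ^ ((2 : ℝ) - 1)) • g (x ^ (2 : ℝ)) =
      (Ioo 0 (m : ℝ)).indicator (fun x : ℝ =>
        2 * ((x : ℂ) ^ (-s) * ((m : ℂ) - x) ^ (-s) * ((m : ℂ) + x) ^ (-s))) x := by
    intro x hx
    rw [mem_Ioi] at hx
    have hx' : (x : ℂ) ≠ 0 := ofReal_ne_zero.2 hx.ne'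
    simp only [hg, indicator_apply, mem_Ioo, Real.rpow_two]
    have hiff : (0 < x ^ 2 ∧ x ^ 2 < (m : ℝ) ^ 2) ↔ (0 < x ∧ x < m) := by
      rw [sq_lt_sq₀ hx.le hm0.le]
      simp [hx, pow_pos hx 2]
    by_cases h : 0 < x ∧ x < m
    · rw [if_pos h, if_pos (hiff.2 h)]
      have e1 : (((m : ℝ) ^ 2 : ℝ) - ((x ^ 2 : ℝ) : ℂ)) ^ (1 - s - 1) =
          ((m : ℂ) - x) ^ (-s) * ((m : ℂ) + x) ^ (-s) := by
        have := mul_cpow_ofReal_nonneg (a := m - x) (b := m + x) (by linarith) (by linarith) (-s)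
        push_cast at this ⊢
        rw [← this]
        ring_nf
      have e2 : (((x ^ 2 : ℝ) : ℂ)) ^ ((1 - s) / 2 - 1) * x = (x : ℂ) ^ (-s) := by
        have := mul_cpow_ofReal_nonneg hx.le hx.le ((1 - s) / 2 - 1)
        push_cast
        rw [sq, this, ← cpow_add _ _ hx']
        nth_rewrite 2 [← cpow_one (x : ℂ)]
        rw [← cpow_add _ _ hx']
        ring_nf
      rw [e1, ← e2, show (2 : ℝ) - 1 = 1 by norm_num, Real.rpow_one, real_smul]
      push_cast
      ring
    · rw [if_neg h, if_neg (fun h' => h (hiff.1 h')), smul_zero]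
  rw [h2, setIntegral_congr_fun measurableSet_Ioi h3, setIntegral_indicator measurableSet_Ioo,
    integral_const_mul] at h1
  have h4 : Ioi (0 : ℝ) ∩ Ioo 0 (m : ℝ) = Ioo 0 (m : ℝ) := by
    ext x
    simp +contextual
  rw [h4, ← integral_Ioc_eq_integral_Ioo, ← intervalIntegral.integral_of_le hm0.le] at h1
  have h5 : (((m : ℝ) ^ 2 : ℝ) : ℂ) ^ ((1 - s) / 2 + (1 - s) - 1) = (m : ℂ) ^ (1 - 3 * s) := by
    have := mul_cpow_ofReal_nonneg hm0.le hm0.le ((1 - s) / 2 + (1 - s) - 1)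
    push_cast at this ⊢
    rw [sq, this, ← cpow_add _ _ hm']
    ring_nf
  rw [h5] at h1
  rw [innerInt, hG, show (3 - 3 * s) / 2 = (1 - s) / 2 + (1 - s) by ring]
  rw [mul_comm 2 (Gamma _), mul_div_mul_left _ _ hne]
  linear_combination h1 / 2

/-- The horizontal contribution to the outer sum, for `m = 1`. -/
noncomputable def outerInt (s : ℂ) : ℂ :=
  Gamma ((3 * s - 1) / 2) * Gamma (1 - s) / (2 * Gamma ((1 + s) / 2))

/-- The substitution `x ↦ m(√u⁻¹ - 1)` turns the outer integral into a beta integral. -/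
theorem integral_outer_eq {m : ℕ} (hm : 0 < m) {s : ℂ} (hs : 1 / 2 < s.re) (hs1 : s.re < 1) :
    (∫ x in Ioi (0 : ℝ), ((x : ℂ) ^ (-s) * ((x : ℂ) + m) ^ (-s) * ((x : ℂ) + 2 * m) ^ (-s))) =
      (m : ℂ) ^ (1 - 3 * s) * outerInt s := by
  have hm0 : (0 : ℝ) < m := by exact_mod_cast hm
  have hm' : (m : ℂ) ≠ 0 := by exact_mod_cast hm.ne'
  have hG := Gamma_mul_Gamma_eq_betaIntegral (s := (3 * s - 1) / 2) (t := 1 - s)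
    (by simp; linarith) (by simp; linarith)
  have hne : Gamma ((3 * s - 1) / 2 + (1 - s)) ≠ 0 :=
    Gamma_ne_zero_of_re_pos (by simp; linarith)
  set g : ℝ → ℂ := (Ioo 0 (1 : ℝ)).indicator fun x : ℝ =>
    (x : ℂ) ^ ((3 * s - 1) / 2 - 1) * (1 - (x : ℂ)) ^ (1 - s - 1) with hg
  have h1 := integral_comp_rpow_Ioi (g := g) (p := -2) (by norm_num)
  have h2 : ∫ x in Ioi 0, g x = betaIntegral ((3 * s - 1) / 2) (1 - s) := by
    rw [betaIntegral, intervalIntegral.integral_of_le zero_le_one, integral_Ioc_eq_integral_Ioo,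
      hg, setIntegral_indicator measurableSet_Ioo]
    congr 2
    ext x
    simp +contextual
  have h3 : ∀ x ∈ Ioi (0 : ℝ), (|(-2 : ℝ)| * x ^ ((-2 : ℝ) - 1)) • g (x ^ (-2 : ℝ)) =
      (Ioi (1 : ℝ)).indicator (fun x : ℝ =>
        2 * (((x : ℂ) - 1) ^ (-s) * (x : ℂ) ^ (-s) * ((x : ℂ) + 1) ^ (-s))) x := by
    intro x hx
    rw [mem_Ioi] at hx
    have hx' : (x : ℂ) ≠ 0 := ofReal_ne_zero.2 hx.ne'
    have hinv : x ^ (-2 : ℝ) = (x⁻¹) ^ 2 := by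
      rw [Real.rpow_neg hx.le, Real.rpow_two, inv_pow]
    have hinv3 : x ^ ((-2 : ℝ) - 1) = (x⁻¹) ^ 3 := by
      rw [show (-2 : ℝ) - 1 = -((3 : ℕ) : ℝ) by norm_num, Real.rpow_neg hx.le, Real.rpow_natCast,
        inv_pow]
    simp only [hg, indicator_apply, mem_Ioo, mem_Ioi, hinv]
    have hiff : (0 < x⁻¹ ^ 2 ∧ x⁻¹ ^ 2 < 1) ↔ 1 < x := by
      rw [sq_lt_one_iff₀ (by positivity), inv_lt_one₀ hx]
      simp only [and_iff_right_iff_imp]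
      intro _
      positivity
    by_cases h : 1 < x
    · rw [if_pos h, if_pos (hiff.2 h)]
      have hxi : (0 : ℝ) ≤ x⁻¹ := by positivity
      have key : (x : ℂ)⁻¹ = exp (-(Real.log x : ℂ)) := by
        rw [Complex.exp_neg, ← ofReal_exp, Real.exp_log hx]
      have e1 : (1 - ((x⁻¹ ^ 2 : ℝ) : ℂ)) ^ (1 - s - 1) =
          ((x : ℂ) - 1) ^ (-s) * ((x : ℂ) + 1) ^ (-s) * (x : ℂ) ^ (2 * s) := by
        have i1 := mul_cpow_ofReal_nonneg (a := x - 1) (b := x + 1) (by linarith) (by linarith) (-s)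
        have i2 := mul_cpow_ofReal_nonneg (a := (x - 1) * (x + 1)) (b := x⁻¹ ^ 2)
          (mul_nonneg (by linarith) (by linarith)) (by positivity) (-s)
        have i3 := mul_cpow_ofReal_nonneg (a := x⁻¹) (b := x⁻¹) hxi hxi (-s)
        have i4 : ((x⁻¹ : ℝ) : ℂ) ^ (-s) = (x : ℂ) ^ s := by
          rw [ofReal_inv, inv_cpow, cpow_neg, inv_inv]
          rw [arg_ofReal_of_nonneg hx.le]
          exact Real.pi_pos.ne
        rw [i4, ← cpow_add _ _ hx'] at i3
        push_cast at i1 i2 i3 ⊢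
        rw [← i1, two_mul, ← i3, ← sq, ← i2]
        congr 1
        · field_simp
          ring
        · ring
      have e2 : (((x⁻¹ ^ 2 : ℝ) : ℂ)) ^ ((3 * s - 1) / 2 - 1) * (x : ℂ) ^ (2 * s) *
          ((x⁻¹ ^ 3 : ℝ) : ℂ) = (x : ℂ) ^ (-s) := by
        have i3 := mul_cpow_ofReal_nonneg (a := x⁻¹) (b := x⁻¹) hxi hxi ((3 * s - 1) / 2 - 1)
        have i4 : ((x⁻¹ : ℝ) : ℂ) ^ ((3 * s - 1) / 2 - 1) = (x : ℂ) ^ (-((3 * s - 1) / 2 - 1)) := by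
          rw [ofReal_inv, inv_cpow, cpow_neg]
          rw [arg_ofReal_of_nonneg hx.le]
          exact Real.pi_pos.ne
        have i5 : ((x⁻¹ ^ 3 : ℝ) : ℂ) = (x : ℂ) ^ (-(3 : ℂ)) := by
          rw [cpow_neg, show (3 : ℂ) = ((3 : ℕ) : ℂ) by norm_num, cpow_natCast]
          push_cast
          rw [inv_pow]
        rw [i5, sq, ofReal_mul, i3, i4, ← cpow_add _ _ hx', ← cpow_add _ _ hx', ← cpow_add _ _ hx']
        congr 1
        ring
      rw [e1, ← e2, hinv3, real_smul, abs_neg, abs_two]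
      push_cast
      ring
    · rw [if_neg h, if_neg (fun h' => h (hiff.1 h')), smul_zero]
  rw [h2, setIntegral_congr_fun measurableSet_Ioi h3, setIntegral_indicator measurableSet_Ioi,
    integral_const_mul, Ioi_inter_Ioi, sup_of_le_right zero_le_one] at h1
  have h4 : (∫ x in Ioi (1 : ℝ), (((x : ℂ) - 1) ^ (-s) * (x : ℂ) ^ (-s) * ((x : ℂ) + 1) ^ (-s))) =
      ∫ x in Ioi (0 : ℝ), ((x : ℂ) ^ (-s) * ((x : ℂ) + 1) ^ (-s) * ((x : ℂ) + 2) ^ (-s)) := by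
    rw [← integral_indicator measurableSet_Ioi, ← integral_indicator measurableSet_Ioi,
      ← integral_add_right_eq_self _ (1 : ℝ)]
    congr 1
    funext x
    simp only [indicator_apply, mem_Ioi, lt_add_iff_pos_left]
    push_cast
    rw [add_sub_cancel_right, add_assoc, one_add_one_eq_two]
  have h5 := integral_comp_mul_left_Ioi (fun x : ℝ =>
    (x : ℂ) ^ (-s) * ((x : ℂ) + m) ^ (-s) * ((x : ℂ) + 2 * m) ^ (-s)) 0 hm0
  have h6 : ∀ x ∈ Ioi (0 : ℝ), ((m * x : ℝ) : ℂ) ^ (-s) * (((m * x : ℝ) : ℂ) + m) ^ (-s) *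
      (((m * x : ℝ) : ℂ) + 2 * m) ^ (-s) = (m : ℂ) ^ (-(3 * s)) *
      ((x : ℂ) ^ (-s) * ((x : ℂ) + 1) ^ (-s) * ((x : ℂ) + 2) ^ (-s)) := by
    intro x hx
    rw [mem_Ioi] at hx
    have i1 := mul_cpow_ofReal_nonneg hm0.le hx.le (-s)
    have i2 := mul_cpow_ofReal_nonneg (b := x + 1) hm0.le (by linarith) (-s)
    have i3 := mul_cpow_ofReal_nonneg (b := x + 2) hm0.le (by linarith) (-s)
    rw [show -(3 * s) = -s + -s + -s by ring, cpow_add _ _ hm', cpow_add _ _ hm']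
    push_cast at i1 i2 i3 ⊢
    rw [show (m : ℂ) * x + m = m * (x + 1) by ring, show (m : ℂ) * x + 2 * m = m * (x + 2) by ring,
      i1, i2, i3]
    ring
  rw [mul_zero, setIntegral_congr_fun measurableSet_Ioi h6, integral_const_mul, ← h4,
    real_smul] at h5
  rw [outerInt, hG, show (1 + s) / 2 = (3 * s - 1) / 2 + (1 - s) by ring,
    mul_comm 2 (Gamma _), mul_div_mul_left _ _ hne, ← h1, show 1 - 3 * s = 1 + -(3 * s) by ring,
    cpow_add _ _ hm', cpow_one]
  rw [eq_comm, ← sub_eq_zero]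
  push_cast at h5
  have h7 : (m : ℂ) * (m : ℂ)⁻¹ = 1 := mul_inv_cancel₀ hm'
  linear_combination (m : ℂ) * h5 + h7 * (∫ x in Ioi (0 : ℝ),
    ((x : ℂ) ^ (-s) * ((x : ℂ) + m) ^ (-s) * ((x : ℂ) + 2 * m) ^ (-s)))

theorem eqOn_of_eqOn_open {f g : ℂ → ℂ} {U V : Set ℂ} (hU : IsOpen U) (hUc : IsPreconnected U)
    (hV : IsOpen V) (hne : V.Nonempty) (hVU : V ⊆ U) (hf : DifferentiableOn ℂ f U)
    (hg : DifferentiableOn ℂ g U) (h : EqOn f g V) : EqOn f g U := by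
  obtain ⟨z, hz⟩ := hne
  exact (hf.analyticOnNhd hU).eqOn_of_preconnected_of_eventuallyEq (hg.analyticOnNhd hU) hUc
    (hVU hz) (h.eventuallyEq_of_mem (hV.mem_nhds hz))

theorem isOpen_re_lt (c : ℝ) : IsOpen {s : ℂ | s.re < c} := isOpen_lt continuous_re continuous_const

theorem isOpen_re_gt (c : ℝ) : IsOpen {s : ℂ | c < s.re} := isOpen_lt continuous_const continuous_re

theorem differentiable_const_cpow_linear {c : ℂ} (hc : c ≠ 0) (u v : ℂ) :
    Differentiable ℂ fun s : ℂ => c ^ (u + v * s) :=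
  ((differentiable_const u).add (differentiable_id.const_mul v)).const_cpow (Or.inl hc)

theorem differentiable_const_cpow_neg {c : ℂ} (hc : c ≠ 0) :
    Differentiable ℂ fun s : ℂ => c ^ (-s) :=
  differentiable_id.neg.const_cpow (Or.inl hc)

theorem differentiableOn_Gamma_comp {f : ℂ → ℂ} {U : Set ℂ} (hf : DifferentiableOn ℂ f U)
    (h : ∀ s ∈ U, 0 < (f s).re) : DifferentiableOn ℂ (fun s => Gamma (f s)) U := by
  intro s hs
  refine DifferentiableAt.comp_differentiableWithinAt s (differentiableAt_Gamma _ fun n hn => ?_)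
    (hf s hs)
  have := h s hs
  rw [hn] at this
  simp at this
  linarith [(Nat.cast_nonneg n : (0 : ℝ) ≤ n)]

theorem differentiableOn_innerInt : DifferentiableOn ℂ innerInt {s | s.re < 1} := by
  have h1 : DifferentiableOn ℂ (fun s => Gamma ((1 - s) / 2)) {s | s.re < 1} :=
    differentiableOn_Gamma_comp (by fun_prop) fun s (hs : s.re < 1) => by simp; linarith
  have h2 : DifferentiableOn ℂ (fun s => Gamma (1 - s)) {s | s.re < 1} :=
    differentiableOn_Gamma_comp (by fun_prop) fun s (hs : s.re < 1) => by simp; linarith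
  have h3 : DifferentiableOn ℂ (fun s => Gamma ((3 - 3 * s) / 2)) {s | s.re < 1} :=
    differentiableOn_Gamma_comp (by fun_prop) fun s (hs : s.re < 1) => by simp; linarith
  exact (h1.mul h2).div (h3.const_mul 2) fun s (hs : s.re < 1) =>
    mul_ne_zero two_ne_zero (Gamma_ne_zero_of_re_pos (by simp; linarith))

theorem differentiableOn_riemannZeta : DifferentiableOn ℂ riemannZeta {s | s.re < 1} :=
  fun s (hs : s.re < 1) =>
    (differentiableAt_riemannZeta (by rintro rfl; simp at hs)).differentiableWithinAt

theorem abs_half_le : |(1 / 2 : ℝ)| ≤ 1 := by rw [abs_of_pos] <;> norm_num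

theorem abs_neg_one_le : |(-1 : ℝ)| ≤ 1 := by simp

theorem differentiableOn_innerVert {m : ℝ} (hm : 1 ≤ m) :
    DifferentiableOn ℂ (innerVert m) {s | s.re < 1} := by
  have hm0 : (m : ℂ) ≠ 0 := ofReal_ne_zero.2 (by linarith)
  have h1 : 1 ≤ |m| := hm.trans (le_abs_self m)
  have h2 : 1 ≤ |(-m)| := by rwa [abs_neg]
  have p1 := differentiableOn_planckInt_pairRem 1 abs_neg_one_le h1
  have p2 := differentiableOn_planckInt_pairRem 1 abs_neg_one_le h2
  have p3 := differentiableOn_planckInt_pairRem 1 abs_half_le h1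
  have p4 := differentiableOn_planckInt_pairRem 1 abs_half_le h2
  rw [Nat.cast_one] at p1 p2 p3 p4
  have c1 := (differentiable_const_cpow_linear hm0 0 (-2)).differentiableOn (s := {s | s.re < 1})
  have c2 := (differentiable_const_cpow_neg (c := 2) two_ne_zero).differentiableOn
    (s := {s | s.re < 1})
  have e1 : DifferentiableOn ℂ (fun s => I * exp (-(I * (Real.pi * s / 2)))) {s | s.re < 1} := by
    fun_prop
  have e2 : DifferentiableOn ℂ (fun s => I * exp (I * (Real.pi * s / 2))) {s | s.re < 1} := by
    fun_prop
  have := c1.mul ((((c2.const_add 1).mul differentiableOn_riemannZeta).add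
    ((e1.mul p1).sub (e2.mul p2))).add (c2.mul ((e1.mul p4).sub (e2.mul p3))))
  refine this.congr fun s _ => ?_
  simp only [innerVert, Pi.mul_apply, Pi.add_apply, Pi.sub_apply]
  ring_nf

/-- The inner sum: the terms of the Witten series with `m + n = y` fixed. -/
noncomputable def innerSum (y : ℕ) (s : ℂ) : ℂ :=
  ∑ n ∈ Finset.Ioo 0 y, ((n : ℂ) ^ (-s) * ((y : ℂ) - n) ^ (-s) * ((y : ℂ) + n) ^ (-s))

theorem differentiable_innerSum (y : ℕ) : Differentiable ℂ (innerSum y) := by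
  refine Differentiable.fun_sum fun n hn => ?_
  rw [Finset.mem_Ioo] at hn
  have h1 : (n : ℂ) ≠ 0 := by exact_mod_cast hn.1.ne'
  have h2 : (y : ℂ) - n ≠ 0 := sub_ne_zero.2 (by exact_mod_cast hn.2.ne')
  have h3 : (y : ℂ) + n ≠ 0 := by exact_mod_cast (by omega : y + n ≠ 0)
  exact ((differentiable_const_cpow_neg h1).mul (differentiable_const_cpow_neg h2)).mul
    (differentiable_const_cpow_neg h3)

theorem innerSum_eq {y : ℕ} (hy : 0 < y) {s : ℂ} (hs : s.re < 1) :
    innerSum y s = (y : ℂ) ^ (1 - 3 * s) * innerInt s + innerVert y s := by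
  have hy1 : (1 : ℝ) ≤ y := by exact_mod_cast hy
  have hy0 : (y : ℂ) ≠ 0 := by exact_mod_cast hy.ne'
  refine eqOn_of_eqOn_open (isOpen_re_lt 1) (convex_halfSpace_re_lt 1).isPreconnected
    (isOpen_re_lt 0) ⟨-1, by simp⟩ (fun z (hz : z.re < 0) => hz.trans one_pos)
    (g := fun s => (y : ℂ) ^ (1 - 3 * s) * innerInt s + innerVert y s)
    (differentiable_innerSum y).differentiableOn
    (DifferentiableOn.add (DifferentiableOn.mul ?_ differentiableOn_innerInt)
      (differentiableOn_innerVert hy1)) ?_ hs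
  · refine Differentiable.differentiableOn ?_
    simpa [sub_eq_add_neg] using differentiable_const_cpow_linear hy0 1 (-3)
  · intro s (hs : s.re < 0)
    have hne : -s ≠ 0 := fun h => by simp [neg_eq_zero.1 h] at hs
    simp only
    rw [← integral_inner_eq hy hs, ← sum_inner_eq hy hs, innerSum]
    refine Finset.sum_subset (fun n hn => ?_) fun n h1 h2 => ?_
    · simp only [Finset.mem_Ioo, Finset.mem_range] at hn ⊢
      omega
    · simp only [Finset.mem_Ioo, Finset.mem_range] at h1 h2
      rcases (by omega : n = 0 ∨ n = y) with rfl | rfl <;> simp [zero_cpow hne]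

theorem norm_outer_le {m : ℕ} (hm : 0 < m) {s a : ℂ} (hs : 0 < s.re) (ha : a.re < 0) {K : ℕ}
    (hsK : ‖s‖ ≤ K) (haK : ‖a‖ ≤ K) {z : ℂ} (hz : 0 ≤ z.re) :
    ‖z ^ (-a) * (z + m) ^ (-s) * (z + 2 * m) ^ (-s)‖ ≤
      (Real.exp (Real.pi * K) ^ 3 * (K.factorial * Real.exp 1)) * (1 + z.re) ^ (-(a.re + 2 * s.re)) *
        Real.exp |z.im| := by
  have hm1 : (1 : ℝ) ≤ m := by exact_mod_cast hm
  have hzi := abs_nonneg z.im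
  have hpos : 0 < 1 + z.re := by linarith
  have e1 : ‖z ^ (-a)‖ ≤ (1 + z.re) ^ (-a.re) * (K.factorial * Real.exp 1 * Real.exp |z.im|) *
      Real.exp (Real.pi * K) := by
    refine (norm_cpow_le_of_norm_le haK z).trans
      (mul_le_mul_of_nonneg_right ?_ (Real.exp_pos _).le)
    have h1 : ‖z‖ ≤ (1 + z.re) * (1 + |z.im|) := by
      refine (norm_le_abs_re_add_abs_im z).trans ?_
      rw [abs_of_nonneg hz]
      nlinarith
    refine (Real.rpow_le_rpow (norm_nonneg z) h1 (by linarith)).trans ?_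
    rw [Real.mul_rpow hpos.le (by positivity)]
    refine mul_le_mul_of_nonneg_left ?_ (by positivity)
    refine le_trans ?_ (one_add_pow_le K hzi)
    rw [← Real.rpow_natCast]
    exact Real.rpow_le_rpow_of_exponent_le (by linarith)
      ((neg_le_abs _).trans ((abs_re_le_norm a).trans haK))
  have e2 : ∀ c : ℝ, 1 ≤ c → ‖(z + c) ^ (-s)‖ ≤ (1 + z.re) ^ (-s.re) * Real.exp (Real.pi * K) := by
    intro c hc
    refine (norm_cpow_le_of_norm_le hsK _).trans
      (mul_le_mul_of_nonneg_right ?_ (Real.exp_pos _).le)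
    refine Real.rpow_le_rpow_of_nonpos hpos ?_ (by linarith)
    refine le_trans ?_ ((le_abs_self _).trans (abs_re_le_norm (z + c)))
    simp
    linarith
  have e3 := e2 m hm1
  have e4 := e2 (2 * m) (by linarith)
  push_cast at e3 e4
  rw [norm_mul, norm_mul]
  calc _ ≤ ((1 + z.re) ^ (-a.re) * (K.factorial * Real.exp 1 * Real.exp |z.im|) *
        Real.exp (Real.pi * K)) * ((1 + z.re) ^ (-s.re) * Real.exp (Real.pi * K)) *
        ((1 + z.re) ^ (-s.re) * Real.exp (Real.pi * K)) := by gcongr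
    _ = _ := by
      rw [show -(a.re + 2 * s.re) = -a.re + -s.re + -s.re by ring, Real.rpow_add hpos,
        Real.rpow_add hpos]
      ring

/-- The contribution of the imaginary direction to the outer sum. -/
noncomputable def outerVert (m : ℝ) (s a : ℂ) : ℂ :=
  (m : ℂ) ^ (-(2 * s)) * 2 ^ (-s) * (riemannZeta a +
    (I * exp (-(I * (Real.pi * a / 2))) * planckInt a (pairRem 1 (1 / 2) m s) -
      I * exp (I * (Real.pi * a / 2)) * planckInt a (pairRem 1 (1 / 2) (-m) s)))

theorem tsum_outer_eq_of_neg {m : ℕ} (hm : 0 < m) {s a : ℂ} (hs : 0 < s.re) (ha : a.re < 0)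
    (has : 1 < a.re + 2 * s.re) :
    ∑' x : ℕ, ((x : ℂ) ^ (-a) * ((x : ℂ) + m) ^ (-s) * ((x : ℂ) + 2 * m) ^ (-s)) =
      (∫ x in Ioi (0 : ℝ), ((x : ℂ) ^ (-a) * ((x : ℂ) + m) ^ (-s) * ((x : ℂ) + 2 * m) ^ (-s))) +
        outerVert m s a := by
  have hm1 : (1 : ℝ) ≤ m := by exact_mod_cast hm
  have hm0 : (0 : ℝ) < m := by linarith
  have hne : -a ≠ 0 := fun h => by simp [neg_eq_zero.1 h] at ha
  set f : ℂ → ℂ := fun z => z ^ (-a) * (z + m) ^ (-s) * (z + 2 * m) ^ (-s) with hf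
  have hcs : ∀ c : ℝ, 0 < c → ∀ z : ℂ, 0 ≤ z.re →
      DifferentiableAt ℂ (fun z : ℂ => (z + c) ^ (-s)) z := fun c hc z hz =>
    (differentiableAt_id.add_const (c : ℂ)).cpow_const (Or.inl (by simp; linarith))
  have hc1 := hcs m hm0
  have hc2 := hcs (2 * m) (by linarith)
  push_cast at hc1 hc2
  have hc : ContinuousOn f {z | 0 ≤ z.re} := fun z (hz : 0 ≤ z.re) =>
    (((continuousAt_cpow_const_of_re_pos (Or.inl hz) (by simpa using ha)).mul
      (hc1 z hz).continuousAt).mul (hc2 z hz).continuousAt).continuousWithinAt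
  have hd : DifferentiableOn ℂ f {z | 0 < z.re} := fun z (hz : 0 < z.re) =>
    (((differentiableAt_id.cpow_const (Or.inl hz)).mul (hc1 z hz.le)).mul
      (hc2 z hz.le)).differentiableWithinAt
  obtain ⟨K, hK⟩ := exists_nat_ge (max ‖s‖ ‖a‖)
  have v0 : ∀ ε : ℝ, ε = 1 ∨ ε = -1 → ∀ t ∈ Ioi (0 : ℝ), f ((0 : ℝ) + ε * t * I) * planck t =
      (m : ℂ) ^ (-(2 * s)) * 2 ^ (-s) * exp (-(ε * (I * (Real.pi * a / 2)))) *
        ((t : ℂ) ^ (-a) * pairRem 0 (1 / 2) (ε * m) s t * planck t) := by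
    intro ε hε t ht
    have h1 := sign_mul_I_cpow hε ht a
    have h2 := cpow_mul_pairPow_half hm0 (t := t) hε s
    simp only [ofReal_natCast] at h2
    simp only [hf, ofReal_zero, zero_add]
    rw [mul_assoc (_ ^ (-a)), add_comm _ (m : ℂ), add_comm _ (2 * m : ℂ), h2, h1]
    ring
  have habs : ∀ ε : ℝ, ε = 1 ∨ ε = -1 → 1 ≤ |ε * m| := fun ε hε => by
    rcases hε with rfl | rfl <;> simpa using hm1
  have hmain := tsum_nat_eq_integral_add_planck (f := f) has hc hd
    (fun z hz => norm_outer_le hm hs ha ((le_max_left _ _).trans hK) ((le_max_right _ _).trans hK) hz)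
    (by simp [hf, zero_cpow hne]) (fun ε hε => IntegrableOn.congr_fun
      ((integrableOn_planckInt_pairRem (by simpa using ha) abs_half_le (habs ε hε)).const_mul _)
      (fun t ht => (v0 ε hε t ht).symm) measurableSet_Ioi)
  rw [setIntegral_congr_fun measurableSet_Ioi (v0 (-1) (Or.inr rfl)),
    setIntegral_congr_fun measurableSet_Ioi (v0 1 (Or.inl rfl)),
    integral_const_mul, integral_const_mul] at hmain
  have p1 := planckInt_pairRem_zero (s := s) ha abs_half_le (habs 1 (Or.inl rfl))
  have p2 := planckInt_pairRem_zero (s := s) ha abs_half_le (habs (-1) (Or.inr rfl))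
  have hfold : ∀ g : ℝ → ℂ, ∫ t in Ioi (0 : ℝ), (t : ℂ) ^ (-a) * g t * planck t = planckInt a g :=
    fun _ => rfl
  have hz := two_mul_sin_mul_planckInt_one ha
  rw [← I_mul_exp_sub_exp] at hz
  rw [hfold, hfold, p1, p2] at hmain
  have hz2 : (∫ x in Ioi (0 : ℝ), ((x : ℂ) ^ (-a) * ((x : ℂ) + m) ^ (-s) *
    ((x : ℂ) + 2 * m) ^ (-s))) = ∫ x in Ioi (0 : ℝ), f x := rfl
  rw [hz2]
  refine hmain.trans ?_
  rw [outerVert, ← hz]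
  simp only [one_mul, neg_mul, neg_neg, ofReal_neg, ofReal_one, ofReal_natCast]
  ring

theorem integrableOn_rpow_mul_one_add_rpow {α τ : ℝ} (hα : α < 1) (h : 1 < α + τ) :
    IntegrableOn (fun x : ℝ => x ^ (-α) * (1 + x) ^ (-τ)) (Ioi 0) := by
  have hmeas : Measurable fun x : ℝ => x ^ (-α) * (1 + x) ^ (-τ) := by fun_prop
  rw [← Ioc_union_Ioi_eq_Ioi zero_le_one]
  refine IntegrableOn.union ?_ ?_
  · have h1 := (intervalIntegral.intervalIntegrable_rpow' (a := 0) (b := 1) (r := -α)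
      (by linarith)).1
    refine Integrable.mono' h1 hmeas.aestronglyMeasurable
      ((ae_restrict_mem measurableSet_Ioc).mono fun x hx => ?_)
    have h0 : 0 < x := hx.1
    rw [Real.norm_of_nonneg (by positivity)]
    exact mul_le_of_le_one_right (by positivity)
      (Real.rpow_le_one_of_one_le_of_nonpos (by linarith) (by linarith))
  · have h1 := integrableOn_Ioi_rpow_of_lt (a := -α + -τ) (c := 1) (by linarith) one_pos
    refine Integrable.mono' h1 hmeas.aestronglyMeasurable
      ((ae_restrict_mem measurableSet_Ioi).mono fun x (hx : 1 < x) => ?_)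
    have h0 : 0 < x := by linarith
    rw [Real.norm_of_nonneg (by positivity), Real.rpow_add h0]
    exact mul_le_mul_of_nonneg_left
      (Real.rpow_le_rpow_of_nonpos h0 (by linarith) (by linarith)) (by positivity)

theorem norm_ofReal_outer_le {m : ℕ} (hm : 0 < m) {s a : ℂ} (hs : 0 < s.re) {x : ℝ} (hx : 0 < x) :
    ‖(x : ℂ) ^ (-a) * ((x : ℂ) + m) ^ (-s) * ((x : ℂ) + 2 * m) ^ (-s)‖ ≤
      x ^ (-a.re) * (1 + x) ^ (-(2 * s.re)) := by
  have hm1 : (1 : ℝ) ≤ m := by exact_mod_cast hm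
  have e2 : ∀ c : ℝ, 1 ≤ c → ‖((x : ℂ) + c) ^ (-s)‖ ≤ (1 + x) ^ (-s.re) := by
    intro c hc
    rw [← ofReal_add, norm_cpow_eq_rpow_re_of_pos (by linarith), neg_re]
    exact Real.rpow_le_rpow_of_nonpos (by linarith) (by linarith) (by linarith)
  have e3 := e2 m hm1
  have e4 := e2 (2 * m) (by linarith)
  push_cast at e3 e4
  rw [norm_mul, norm_mul, norm_cpow_eq_rpow_re_of_pos hx, neg_re, mul_assoc,
    show -(2 * s.re) = -s.re + -s.re by ring, Real.rpow_add (by linarith)]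
  gcongr

theorem rpow_neg_le_add {x α₁ α₂ α : ℝ} (hx : 0 < x) (h1 : α₁ ≤ α) (h2 : α ≤ α₂) :
    x ^ (-α) ≤ x ^ (-α₁) + x ^ (-α₂) := by
  have p1 := Real.rpow_pos_of_pos hx (-α₁)
  have p2 := Real.rpow_pos_of_pos hx (-α₂)
  rcases le_total 1 x with h | h
  · have := Real.rpow_le_rpow_of_exponent_le h (neg_le_neg h1)
    linarith
  · have := Real.rpow_le_rpow_of_exponent_ge hx h (neg_le_neg h2)
    linarith

theorem isOpen_strip (c d : ℝ) : IsOpen {s : ℂ | c < s.re ∧ s.re < d} :=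
  (isOpen_re_gt c).inter (isOpen_re_lt d)

theorem isPreconnected_strip (c d : ℝ) : IsPreconnected {s : ℂ | c < s.re ∧ s.re < d} :=
  ((convex_halfSpace_re_gt c).inter (convex_halfSpace_re_lt d)).isPreconnected

theorem differentiableOn_integral_outer {m : ℕ} (hm : 0 < m) {s : ℂ} (hs : 0 < s.re) :
    DifferentiableOn ℂ (fun a : ℂ => ∫ x in Ioi (0 : ℝ),
      ((x : ℂ) ^ (-a) * ((x : ℂ) + m) ^ (-s) * ((x : ℂ) + 2 * m) ^ (-s)))
      {a | 1 - 2 * s.re < a.re ∧ a.re < 1} := by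
  refine differentiableOn_integral_of_dominated (isOpen_strip _ _) (fun a _ => ?_) ?_ ?_
  · exact Measurable.aestronglyMeasurable (by fun_prop)
  · refine (ae_restrict_mem measurableSet_Ioi).mono fun x (hx : 0 < x) => ?_
    exact (((differentiable_const_cpow_neg (ofReal_ne_zero.2 hx.ne')).mul_const _).mul_const
      _).differentiableOn
  · rintro a₀ ⟨ha1, ha2⟩
    obtain ⟨α₁, h1, h1'⟩ := exists_between ha1
    obtain ⟨α₂, h2, h2'⟩ := exists_between ha2
    refine ⟨_, (isOpen_strip α₁ α₂).mem_nhds ⟨h1', h2⟩,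
      fun x => x ^ (-α₁) * (1 + x) ^ (-(2 * s.re)) + x ^ (-α₂) * (1 + x) ^ (-(2 * s.re)),
      (integrableOn_rpow_mul_one_add_rpow (by linarith) (by linarith)).add
        (integrableOn_rpow_mul_one_add_rpow (by linarith) (by linarith)),
      (ae_restrict_mem measurableSet_Ioi).mono fun x (hx : 0 < x) a ha => ?_⟩
    refine (norm_ofReal_outer_le hm hs hx).trans ?_
    beta_reduce
    rw [← add_mul]
    exact mul_le_mul_of_nonneg_right (rpow_neg_le_add hx ha.1.le ha.2.le) (by positivity)

theorem norm_outerTerm_le {m : ℕ} (hm : 0 < m) {s a : ℂ} (hs : 0 < s.re) {p : ℝ}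
    (ha : p ≤ a.re + 2 * s.re) (x : ℕ) :
    ‖((x + 1 : ℕ) : ℂ) ^ (-a) * (((x + 1 : ℕ) : ℂ) + m) ^ (-s) *
      (((x + 1 : ℕ) : ℂ) + 2 * m) ^ (-s)‖ ≤ ((x + 1 : ℕ) : ℝ) ^ (-p) := by
  have hx : (0 : ℝ) < ((x + 1 : ℕ) : ℝ) := by positivity
  have hx1 : (1 : ℝ) ≤ ((x + 1 : ℕ) : ℝ) := by simp
  have := norm_ofReal_outer_le hm (a := a) hs hx
  rw [ofReal_natCast] at this
  refine this.trans ?_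
  calc _ ≤ ((x + 1 : ℕ) : ℝ) ^ (-a.re) * ((x + 1 : ℕ) : ℝ) ^ (-(2 * s.re)) := by
        refine mul_le_mul_of_nonneg_left ?_ (by positivity)
        exact Real.rpow_le_rpow_of_nonpos hx (by linarith) (by linarith)
    _ = ((x + 1 : ℕ) : ℝ) ^ (-a.re + -(2 * s.re)) := by rw [Real.rpow_add hx]
    _ ≤ _ := Real.rpow_le_rpow_of_exponent_le hx1 (by linarith)

theorem summable_succ_rpow {p : ℝ} (hp : 1 < p) :
    Summable fun x : ℕ => ((x + 1 : ℕ) : ℝ) ^ (-p) :=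
  (summable_nat_add_iff 1).2 (Real.summable_nat_rpow.2 (by linarith))

theorem differentiableOn_tsum_outer {m : ℕ} (hm : 0 < m) {s : ℂ} (hs : 0 < s.re) :
    DifferentiableOn ℂ (fun a : ℂ => ∑' x : ℕ, (((x + 1 : ℕ) : ℂ) ^ (-a) *
      (((x + 1 : ℕ) : ℂ) + m) ^ (-s) * (((x + 1 : ℕ) : ℂ) + 2 * m) ^ (-s)))
      {a | 1 - 2 * s.re < a.re} := by
  intro a₀ (ha : 1 - 2 * s.re < a₀.re)
  obtain ⟨α₁, h1, h1'⟩ := exists_between ha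
  refine DifferentiableAt.differentiableWithinAt (DifferentiableOn.differentiableAt
    (s := {a | α₁ < a.re}) ?_ ((isOpen_re_gt α₁).mem_nhds h1'))
  refine differentiableOn_tsum_of_summable_norm
    (summable_succ_rpow (p := α₁ + 2 * s.re) (by linarith)) (fun x => ?_) (isOpen_re_gt α₁)
    fun x a (ha : α₁ < a.re) => norm_outerTerm_le hm hs (by linarith) x
  exact (((differentiable_const_cpow_neg (Nat.cast_ne_zero.2 x.succ_ne_zero)).mul_const
    _).mul_const _).differentiableOn

theorem differentiableOn_outerVert {m : ℝ} (hm : 1 ≤ m) (s : ℂ) :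
    DifferentiableOn ℂ (outerVert m s) {a | a.re < 1} := by
  have hp : ∀ m' : ℝ, 1 ≤ |m'| →
      DifferentiableOn ℂ (fun a => planckInt a (pairRem 1 (1 / 2) m' s)) {a | a.re < 1} := by
    intro m' hm'
    obtain ⟨C, hC, K, h⟩ := pairRem_bound_locally 1 abs_half_le s
    exact differentiableOn_planckInt (J := 1) (isOpen_re_lt 1)
      (fun _ => measurable_pairRem 1 (1 / 2) m' s) (fun t _ => differentiableOn_const _)
      (fun a _ => ⟨univ, univ_mem, C * (1 / |m'|) ^ 1, by positivity, K, fun _ _ t ht =>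
        h s (Metric.mem_ball_self one_pos) m' hm' t ht⟩) (fun a (ha : a.re < 1) => by simpa using ha)
  have p1 := hp m (hm.trans (le_abs_self m))
  have p2 := hp (-m) (by rw [abs_neg]; exact hm.trans (le_abs_self m))
  have e1 : DifferentiableOn ℂ (fun s => I * exp (-(I * (Real.pi * s / 2)))) {s | s.re < 1} := by
    fun_prop
  have e2 : DifferentiableOn ℂ (fun s => I * exp (I * (Real.pi * s / 2))) {s | s.re < 1} := by
    fun_prop
  exact (differentiableOn_riemannZeta.add ((e1.mul p1).sub (e2.mul p2))).const_mul _

theorem tsum_outer_eq {m : ℕ} (hm : 0 < m) {s : ℂ} (hs : 1 / 2 < s.re) (hs1 : s.re < 1) :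
    ∑' x : ℕ, (((x + 1 : ℕ) : ℂ) ^ (-s) * (((x + 1 : ℕ) : ℂ) + m) ^ (-s) *
      (((x + 1 : ℕ) : ℂ) + 2 * m) ^ (-s)) =
      (m : ℂ) ^ (1 - 3 * s) * outerInt s + outerVert m s s := by
  have hs0 : 0 < s.re := by linarith
  have hm1 : (1 : ℝ) ≤ m := by exact_mod_cast hm
  rw [← integral_outer_eq hm hs hs1]
  refine eqOn_of_eqOn_open (isOpen_strip (1 - 2 * s.re) 1) (isPreconnected_strip _ _)
    (isOpen_strip (1 - 2 * s.re) 0)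
    ⟨((1 - 2 * s.re) / 2 : ℝ), ?_⟩ (fun a ha => ⟨ha.1, ha.2.trans one_pos⟩)
    ((differentiableOn_tsum_outer hm hs0).mono fun a ha => ha.1)
    ((differentiableOn_integral_outer hm hs0).add
      ((differentiableOn_outerVert hm1 s).mono fun a ha => ha.2)) ?_ ⟨by linarith, hs1⟩
  · constructor <;> rw [ofReal_re] <;> linarith
  · rintro a ⟨ha1, ha2⟩
    have hne : -a ≠ 0 := fun h => by simp [neg_eq_zero.1 h] at ha2
    have hsum : Summable fun x : ℕ =>
        ((x : ℂ) ^ (-a) * ((x : ℂ) + m) ^ (-s) * ((x : ℂ) + 2 * m) ^ (-s)) :=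
      (summable_nat_add_iff 1).1 (Summable.of_norm_bounded
        (summable_succ_rpow (p := a.re + 2 * s.re) (by linarith)) fun x =>
          norm_outerTerm_le hm hs0 le_rfl x)
    refine Eq.trans ?_ (tsum_outer_eq_of_neg hm hs0 ha2 (by linarith))
    rw [hsum.tsum_eq_zero_add]
    simp [zero_cpow hne]

/-- The terms of the Witten series of `B₂`, indexed from `0`. -/
noncomputable def wittenTerm (p : ℕ × ℕ) (s : ℂ) : ℂ :=
  ((p.1 + 1 : ℕ) : ℂ) ^ (-s) * ((p.2 + 1 : ℕ) : ℂ) ^ (-s) * ((p.1 + p.2 + 2 : ℕ) : ℂ) ^ (-s) *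
    ((p.1 + 2 * p.2 + 3 : ℕ) : ℂ) ^ (-s)

theorem norm_wittenTerm_le {s : ℂ} {σ : ℝ} (hσ : 0 ≤ σ) (hs : σ ≤ s.re) (p : ℕ × ℕ) :
    ‖wittenTerm p s‖ ≤ ((p.1 + 1 : ℕ) : ℝ) ^ (-(2 * σ)) * ((p.2 + 1 : ℕ) : ℝ) ^ (-(2 * σ)) := by
  have h : ∀ a b : ℕ, 0 < b → b ≤ a → ‖(a : ℂ) ^ (-s)‖ ≤ (b : ℝ) ^ (-σ) := by
    intro a b hb hab
    have hb1 : (1 : ℝ) ≤ b := by exact_mod_cast hb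
    have hab' : (b : ℝ) ≤ a := by exact_mod_cast hab
    rw [norm_natCast_cpow_of_pos (by omega), neg_re]
    exact (Real.rpow_le_rpow_of_nonpos (by linarith) hab' (by linarith)).trans
      (Real.rpow_le_rpow_of_exponent_le hb1 (by linarith))
  have h1 := h (p.1 + 1) (p.1 + 1) (by omega) le_rfl
  have h2 := h (p.2 + 1) (p.2 + 1) (by omega) le_rfl
  have h3 := h (p.1 + p.2 + 2) (p.1 + 1) (by omega) (by omega)
  have h4 := h (p.1 + 2 * p.2 + 3) (p.2 + 1) (by omega) (by omega)
  rw [wittenTerm, norm_mul, norm_mul, norm_mul, show -(2 * σ) = -σ + -σ by ring,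
    Real.rpow_add (by positivity), Real.rpow_add (by positivity)]
  calc _ ≤ ((p.1 + 1 : ℕ) : ℝ) ^ (-σ) * ((p.2 + 1 : ℕ) : ℝ) ^ (-σ) * ((p.1 + 1 : ℕ) : ℝ) ^ (-σ) *
        ((p.2 + 1 : ℕ) : ℝ) ^ (-σ) := by gcongr
    _ = _ := by ring

theorem summable_wittenBound {σ : ℝ} (hσ : 1 / 2 < σ) : Summable fun p : ℕ × ℕ =>
    ((p.1 + 1 : ℕ) : ℝ) ^ (-(2 * σ)) * ((p.2 + 1 : ℕ) : ℝ) ^ (-(2 * σ)) :=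
  (summable_succ_rpow (p := 2 * σ) (by linarith)).mul_of_nonneg
    (summable_succ_rpow (p := 2 * σ) (by linarith)) (fun _ => by positivity) fun _ => by positivity

theorem summable_wittenTerm {s : ℂ} (hs : 1 / 2 < s.re) : Summable fun p => wittenTerm p s :=
  Summable.of_norm_bounded (summable_wittenBound hs)
    fun p => norm_wittenTerm_le (by linarith) le_rfl p

/-- The Witten series of `B₂`. -/
noncomputable def wittenSum (s : ℂ) : ℂ := ∑' p : ℕ × ℕ, wittenTerm p s

theorem differentiableOn_wittenSum : DifferentiableOn ℂ wittenSum {s | 1 / 2 < s.re} := by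
  intro s₀ (hs : 1 / 2 < s₀.re)
  obtain ⟨σ, h1, h1'⟩ := exists_between hs
  refine DifferentiableAt.differentiableWithinAt (DifferentiableOn.differentiableAt
    (s := {a | σ < a.re}) ?_ ((isOpen_re_gt σ).mem_nhds h1'))
  refine differentiableOn_tsum_of_summable_norm (summable_wittenBound h1) (fun p => ?_)
    (isOpen_re_gt σ) fun p s (hs : σ < s.re) => norm_wittenTerm_le (by linarith) hs.le p
  have h := fun n : ℕ => differentiable_const_cpow_neg (Nat.cast_ne_zero (R := ℂ).2 n.succ_ne_zero)
  exact (((h p.1).mul (h p.2)).mul (h (p.1 + p.2 + 1))).mul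
    (h (p.1 + 2 * p.2 + 2)) |>.differentiableOn

theorem _root_.HasSum.congr_eq {f g : ℕ → ℂ} {a : ℂ} (hg : HasSum g a) (h : ∀ n, f n = g n) :
    HasSum f a := funext h ▸ hg

theorem hasSum_outer {s : ℂ} (hs : 1 / 2 < s.re) :
    HasSum (fun n : ℕ => ((n + 1 : ℕ) : ℂ) ^ (-s) * ∑' x : ℕ, (((x + 1 : ℕ) : ℂ) ^ (-s) *
      (((x + 1 : ℕ) : ℂ) + (n + 1 : ℕ)) ^ (-s) * (((x + 1 : ℕ) : ℂ) + 2 * (n + 1 : ℕ)) ^ (-s)))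
      (wittenSum s) := by
  have h := (summable_wittenTerm hs).prod_symm
  have h2 : ∑' p : ℕ × ℕ, wittenTerm p.swap s = wittenSum s :=
    (Equiv.prodComm ℕ ℕ).tsum_eq fun p => wittenTerm p s
  rw [← h2, h.tsum_prod]
  refine h.prod.hasSum.congr_eq fun n => ?_
  rw [← tsum_mul_left]
  refine tsum_congr fun x => ?_
  simp only [wittenTerm, Prod.swap]
  push_cast
  ring_nf

theorem hasSum_inner {s : ℂ} (hs : 1 / 2 < s.re) :
    HasSum (fun y : ℕ => ((y + 1 : ℕ) : ℂ) ^ (-s) * innerSum (y + 1) s) (wittenSum s) := by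
  have h := (Finset.HasAntidiagonal.sigmaAntidiagonalEquivProd (A := ℕ)).summable_iff.2 (summable_wittenTerm hs)
  have h2 := (Finset.HasAntidiagonal.sigmaAntidiagonalEquivProd (A := ℕ)).tsum_eq fun p => wittenTerm p s
  have h3 := h.hasSum.sigma fun k => hasSum_fintype _
  rw [wittenSum, ← h2]
  rw [← hasSum_nat_add_iff' 1]
  simp only [Finset.range_one, Finset.sum_singleton]
  rw [show innerSum (0 + 1) s = 0 by simp [innerSum, show Finset.Ioo 0 1 = (∅ : Finset ℕ) from rfl],
    mul_zero, sub_zero]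
  refine h3.congr_eq fun k => ?_
  rw [innerSum, Finset.mul_sum]
  refine Eq.trans ?_ (Finset.sum_coe_sort (Finset.HasAntidiagonal.antidiagonal k)
    (fun p => wittenTerm p s)).symm
  refine Finset.sum_nbij' (fun n => (k + 1 - n, n - 1)) (fun p => p.2 + 1) ?_ ?_ ?_ ?_ ?_
  · intro n hn
    simp only [Finset.mem_Ioo, Finset.HasAntidiagonal.mem_antidiagonal] at hn ⊢
    omega
  · intro p hp
    simp only [Finset.mem_Ioo, Finset.HasAntidiagonal.mem_antidiagonal] at hp ⊢
    omega
  · intro n hn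
    simp only [Finset.mem_Ioo] at hn
    omega
  · intro p hp
    simp only [Finset.HasAntidiagonal.mem_antidiagonal] at hp
    ext
    · simp only; omega
    · simp only; omega
  · intro n hn
    simp only [Finset.mem_Ioo] at hn
    obtain ⟨j, rfl⟩ : ∃ j, n = j + 1 := ⟨n - 1, by omega⟩
    obtain ⟨i, rfl⟩ : ∃ i, k = i + j := ⟨k - j, by omega⟩
    simp only [wittenTerm]
    rw [show i + j + 1 - (j + 1) = i by omega, show j + 1 - 1 = j by omega]
    push_cast
    ring_nf

/-- The even part in `m` of the Planck integral of the Taylor remainder. -/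
noncomputable def evenRem (J : ℕ) (β m : ℝ) (s : ℂ) : ℂ :=
  planckInt s (pairRem J β m s) + planckInt s (pairRem J β (-m) s)

theorem pairRem_neg_one_neg (m : ℝ) (s : ℂ) :
    pairRem 1 (-1) (-m) s = pairRem 1 (-1) m s := by
  funext t
  rw [pairRem, pairRem, pairPoly_one, pairPoly_one, div_neg, pairPow_neg_one_neg]

theorem innerVert_add_outerVert (m : ℝ) (s : ℂ) :
    innerVert m s + outerVert m s s = (m : ℂ) ^ (-(2 * s)) *
      (1 / 2 * (2 * riemannZeta s + 2 * sin (Real.pi * s / 2) * evenRem 1 (-1) m s) +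
        2 ^ (-s) * (2 * riemannZeta s + 2 * sin (Real.pi * s / 2) * evenRem 1 (1 / 2) m s)) := by
  rw [innerVert, outerVert, evenRem, evenRem, pairRem_neg_one_neg, ← I_mul_exp_sub_exp]
  ring

theorem hasSum_two_mul_wittenSum {s : ℂ} (hs : 1 / 2 < s.re) (hs1 : s.re < 1) :
    HasSum (fun k : ℕ => ((k + 1 : ℕ) : ℂ) ^ (-(4 * s - 1)) * (innerInt s + outerInt s) +
      (1 / 2 * (((k + 1 : ℕ) : ℂ) ^ (-(3 * s)) * (2 * riemannZeta s +
          2 * sin (Real.pi * s / 2) * evenRem 1 (-1) (k + 1 : ℕ) s)) +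
        2 ^ (-s) * (((k + 1 : ℕ) : ℂ) ^ (-(3 * s)) * (2 * riemannZeta s +
          2 * sin (Real.pi * s / 2) * evenRem 1 (1 / 2) (k + 1 : ℕ) s)))) (2 * wittenSum s) := by
  rw [two_mul (wittenSum s)]
  refine ((hasSum_inner hs).add (hasSum_outer hs)).congr_eq fun k => ?_
  rw [innerSum_eq k.succ_pos hs1, tsum_outer_eq k.succ_pos hs hs1]
  have h := innerVert_add_outerVert (k + 1 : ℕ) s
  have hk : ((k + 1 : ℕ) : ℂ) ≠ 0 := Nat.cast_ne_zero.2 k.succ_ne_zero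
  have e1 : ((k + 1 : ℕ) : ℂ) ^ (-(4 * s - 1)) =
      ((k + 1 : ℕ) : ℂ) ^ (-s) * ((k + 1 : ℕ) : ℂ) ^ (1 - 3 * s) := by
    rw [← cpow_add _ _ hk]
    ring_nf
  have e2 : ((k + 1 : ℕ) : ℂ) ^ (-(3 * s)) =
      ((k + 1 : ℕ) : ℂ) ^ (-s) * ((k + 1 : ℕ) : ℂ) ^ (-(2 * s)) := by
    rw [← cpow_add _ _ hk]
    ring_nf
  rw [ofReal_natCast] at h
  rw [e1, e2]
  linear_combination -((k + 1 : ℕ) : ℂ) ^ (-s) * h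

/-- The exponents of the nonconstant terms of `pairPoly`. -/
def pairs (J : ℕ) : Finset (ℕ × ℕ) := (Finset.range J ×ˢ Finset.range J).erase (0, 0)

theorem pos_of_mem_pairs {J : ℕ} {x : ℕ × ℕ} (h : x ∈ pairs J) : 1 ≤ x.1 + x.2 := by
  have := Finset.ne_of_mem_erase h
  rw [Ne, Prod.ext_iff] at this
  omega

/-- The coefficient of `t ^ (x.1 + x.2)` in `pairPoly`. -/
noncomputable def pairCoeff (β : ℝ) (x : ℕ × ℕ) (s : ℂ) : ℂ :=
  binomCoeff x.1 s * binomCoeff x.2 s * β ^ x.2 * I ^ (x.1 + x.2)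

theorem pairPoly_eq_one_add {J : ℕ} (hJ : 1 ≤ J) (β : ℝ) (s : ℂ) (t : ℝ) :
    pairPoly J β s t = 1 + ∑ x ∈ pairs J, pairCoeff β x s * (t : ℂ) ^ (x.1 + x.2) := by
  have h0 : ((0, 0) : ℕ × ℕ) ∈ Finset.range J ×ˢ Finset.range J := by simp; omega
  rw [pairPoly, Finset.sum_mul_sum, ← Finset.sum_product', ← Finset.add_sum_erase _ _ h0, pairs]
  congr 1
  · simp [binomCoeff]
  · refine Finset.sum_congr rfl fun x _ => ?_
    rw [pairCoeff]
    simp only [mul_pow, pow_add]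
    ring

theorem integrableOn_planckInt_pow {s : ℂ} {n : ℕ} (h : s.re < n) :
    IntegrableOn (fun t : ℝ => (t : ℂ) ^ (-s) * (t : ℂ) ^ n * planck t) (Ioi 0) := by
  refine integrableOn_planckInt_integrand (J := n) (K := 0) zero_le_one (g := fun t => (t : ℂ) ^ n)
    (by fun_prop) (fun t ht => ?_) h
  simp [abs_of_pos ht]

/-- The moments of the Planck kernel. -/
noncomputable def planckMoment (n : ℕ) (s : ℂ) : ℂ := planckInt s fun t => (t : ℂ) ^ n

theorem planckInt_pairRem_one {J : ℕ} (hJ : 1 ≤ J) {β m : ℝ} (hβ : |β| ≤ 1) (hm : 1 ≤ |m|) {s : ℂ}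
    (hs : s.re < 1) :
    planckInt s (pairRem 1 β m s) = planckInt s (pairRem J β m s) +
      ∑ x ∈ pairs J, pairCoeff β x s * (m : ℂ)⁻¹ ^ (x.1 + x.2) * planckMoment (x.1 + x.2) s := by
  have h1 : (1 : ℝ) ≤ J := by exact_mod_cast hJ
  have hx : ∀ x ∈ pairs J, s.re < (x.1 + x.2 : ℕ) := fun x hx =>
    hs.trans_le (by exact_mod_cast pos_of_mem_pairs hx)
  simp only [planckMoment, planckInt, ← integral_const_mul]
  rw [← integral_finsetSum _ fun x h => (integrableOn_planckInt_pow (hx x h)).const_mul _,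
    ← integral_add (integrableOn_planckInt_pairRem (by linarith) hβ hm)
      (integrable_finsetSum _ fun x h => (integrableOn_planckInt_pow (hx x h)).const_mul _)]
  refine integral_congr_ae (Eventually.of_forall fun t => ?_)
  simp only [pairRem]
  rw [pairPoly_one, pairPoly_eq_one_add hJ, ofReal_div]
  have e : ∑ x ∈ pairs J, pairCoeff β x s * (m : ℂ)⁻¹ ^ (x.1 + x.2) *
        ((t : ℂ) ^ (-s) * (t : ℂ) ^ (x.1 + x.2) * planck t) =
      (t : ℂ) ^ (-s) * (∑ x ∈ pairs J, pairCoeff β x s * ((t : ℂ) / m) ^ (x.1 + x.2)) *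
        planck t := by
    rw [Finset.mul_sum, Finset.sum_mul]
    refine Finset.sum_congr rfl fun x _ => ?_
    rw [div_eq_mul_inv, mul_pow]
    ring
  rw [e]
  ring

/-- The sum over both signs of the coefficients of `pairPoly`, times the Planck moment. -/
noncomputable def momentCoeff (β : ℝ) (x : ℕ × ℕ) (s : ℂ) : ℂ :=
  pairCoeff β x s * (1 + (-1) ^ (x.1 + x.2)) * planckMoment (x.1 + x.2) s

theorem evenRem_one {J : ℕ} (hJ : 1 ≤ J) {β m : ℝ} (hβ : |β| ≤ 1) (hm : 1 ≤ m) {s : ℂ}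
    (hs : s.re < 1) :
    evenRem 1 β m s = evenRem J β m s +
      ∑ x ∈ pairs J, momentCoeff β x s * (m : ℂ)⁻¹ ^ (x.1 + x.2) := by
  have h1 : 1 ≤ |m| := hm.trans (le_abs_self m)
  rw [evenRem, evenRem, planckInt_pairRem_one hJ hβ h1 hs,
    planckInt_pairRem_one hJ hβ (by rwa [abs_neg]) hs, add_add_add_comm, ← Finset.sum_add_distrib]
  congr 1
  refine Finset.sum_congr rfl fun x _ => ?_
  rw [momentCoeff, ofReal_neg, inv_neg, neg_pow (m : ℂ)⁻¹]
  ring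

theorem norm_evenRem_bound_locally (J : ℕ) {β : ℝ} (hβ : |β| ≤ 1) {s₀ : ℂ} (hs : s₀.re < J) :
    ∃ V ∈ 𝓝 s₀, ∃ C : ℝ, 0 ≤ C ∧ ∀ s ∈ V, ∀ m : ℝ, 1 ≤ m →
      ‖evenRem J β m s‖ ≤ C * (1 / m) ^ J := by
  obtain ⟨C, hC, K, h⟩ := pairRem_bound_locally J hβ s₀
  have hcont : ContinuousAt (fun s : ℂ => Real.Gamma (J - s.re)) s₀ := by
    refine ContinuousAt.comp (g := Real.Gamma) (f := fun s : ℂ => J - s.re)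
      (Real.differentiableAt_Gamma fun m hm => ?_).continuousAt (by fun_prop)
    linarith [(Nat.cast_nonneg m : (0 : ℝ) ≤ m)]
  have hG := hcont.eventually (Iio_mem_nhds (lt_add_one _))
  have hre := (isOpen_re_lt J).mem_nhds (show s₀ ∈ {s : ℂ | s.re < J} from hs)
  set B := Real.Gamma (J - s₀.re) + 1
  have hB : 0 ≤ B := by
    have := Real.Gamma_pos_of_pos (sub_pos.2 hs)
    simp only [B]
    linarith
  refine ⟨_, inter_mem (Metric.ball_mem_nhds s₀ one_pos) (inter_mem hG hre),
    2 * (C * (K.factorial * Real.exp 1) * B), by positivity, ?_⟩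
  rintro s ⟨h1, h2, h3⟩ m hm
  have h2 : Real.Gamma (J - s.re) < B := h2
  have h3 : s.re < J := h3
  have hm0 : 0 < m := by linarith
  have key : ∀ m' : ℝ, |m'| = m → ‖planckInt s (pairRem J β m' s)‖ ≤
      C * (K.factorial * Real.exp 1) * B * (1 / m) ^ J := by
    intro m' hm'
    refine (norm_planckInt_le (C := C * (1 / m) ^ J) (by positivity)
      (fun t ht => hm' ▸ h s h1 m' (by rwa [hm']) t ht) h3).trans ?_
    have : ∫ t in Ioi (0 : ℝ), t ^ (J - 1 - s.re) * Real.exp (-t) ≤ B := by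
      refine le_trans (le_of_eq ?_) h2.le
      rw [Real.Gamma_eq_integral (by linarith)]
      refine integral_congr_ae (Eventually.of_forall fun t => ?_)
      simp only
      rw [mul_comm]
      ring_nf
    calc _ ≤ C * (1 / m) ^ J * (K.factorial * Real.exp 1) * B := by gcongr
      _ = _ := by ring
  have a1 := key m (abs_of_pos hm0)
  have a2 := key (-m) (by rw [abs_neg, abs_of_pos hm0])
  refine (norm_add_le _ _).trans ?_
  linarith

theorem differentiableOn_evenRem (J : ℕ) {β m : ℝ} (hβ : |β| ≤ 1) (hm : 1 ≤ m) :
    DifferentiableOn ℂ (evenRem J β m) {s | s.re < J} := by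
  have h1 : 1 ≤ |m| := hm.trans (le_abs_self m)
  exact (differentiableOn_planckInt_pairRem J hβ h1).add
    (differentiableOn_planckInt_pairRem J hβ (by rwa [abs_neg]))

theorem evenRem_terms_bound_locally (J : ℕ) {β : ℝ} (hβ : |β| ≤ 1) {s₀ : ℂ} (hs : s₀.re < J)
    (hs' : (1 - J) / 3 < s₀.re) :
    ∃ V ∈ 𝓝 s₀, ∃ u : ℕ → ℝ, Summable u ∧ ∀ s ∈ V, ∀ k : ℕ,
      ‖((k + 1 : ℕ) : ℂ) ^ (-(3 * s)) * evenRem J β (k + 1 : ℕ) s‖ ≤ u k := by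
  obtain ⟨V, hV, C, hC, h⟩ := norm_evenRem_bound_locally J hβ hs
  obtain ⟨σ, hσ, hσ'⟩ := exists_between hs'
  refine ⟨_, inter_mem hV ((isOpen_re_gt σ).mem_nhds hσ'), fun k => C *
    ((k + 1 : ℕ) : ℝ) ^ (-(3 * σ + J)), (summable_succ_rpow (by linarith)).mul_left C, ?_⟩
  rintro s ⟨h1, h2⟩ k
  have h2 : σ < s.re := h2
  have hk : (1 : ℝ) ≤ (k + 1 : ℕ) := by push_cast; linarith [(Nat.cast_nonneg k : (0 : ℝ) ≤ k)]
  have hre : (-(3 * s)).re = -(3 * s.re) := by simp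
  rw [norm_mul, norm_natCast_cpow_of_pos k.succ_pos, hre]
  have h3 := h s h1 _ hk
  have h4 : ((k + 1 : ℕ) : ℝ) ^ (-(3 * s.re)) ≤ ((k + 1 : ℕ) : ℝ) ^ (-(3 * σ)) :=
    Real.rpow_le_rpow_of_exponent_le hk (by linarith)
  calc _ ≤ ((k + 1 : ℕ) : ℝ) ^ (-(3 * σ)) * (C * (1 / ((k + 1 : ℕ) : ℝ)) ^ J) := by gcongr
    _ = C * ((k + 1 : ℕ) : ℝ) ^ (-(3 * σ + J)) := by
      rw [neg_add, Real.rpow_add (by positivity), Real.rpow_neg (by positivity) (J : ℝ),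
        Real.rpow_natCast, one_div, inv_pow]
      ring

/-- The Dirichlet series of the remainders. -/
noncomputable def remSeries (J : ℕ) (β : ℝ) (s : ℂ) : ℂ :=
  ∑' k : ℕ, ((k + 1 : ℕ) : ℂ) ^ (-(3 * s)) * evenRem J β (k + 1 : ℕ) s

theorem summable_remSeries (J : ℕ) {β : ℝ} (hβ : |β| ≤ 1) {s : ℂ} (hs : s.re < J)
    (hs' : (1 - J) / 3 < s.re) :
    Summable fun k : ℕ => ((k + 1 : ℕ) : ℂ) ^ (-(3 * s)) * evenRem J β (k + 1 : ℕ) s := by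
  obtain ⟨V, hV, u, hu, h⟩ := evenRem_terms_bound_locally J hβ hs hs'
  exact Summable.of_norm_bounded hu (h s (mem_of_mem_nhds hV))

theorem differentiableOn_remSeries (J : ℕ) {β : ℝ} (hβ : |β| ≤ 1) :
    DifferentiableOn ℂ (remSeries J β) {s | (1 - J) / 3 < s.re ∧ s.re < J} := by
  rintro s₀ ⟨hs', hs⟩
  obtain ⟨V, hV, u, hu, h⟩ := evenRem_terms_bound_locally J hβ hs hs'
  obtain ⟨W, hWV, hW, hsW⟩ := mem_nhds_iff.1
    (inter_mem hV ((isOpen_re_lt J).mem_nhds (show s₀ ∈ {s : ℂ | s.re < J} from hs)))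
  refine DifferentiableAt.differentiableWithinAt (DifferentiableOn.differentiableAt
    (s := W) ?_ (hW.mem_nhds hsW))
  refine differentiableOn_tsum_of_summable_norm hu (fun k => ?_) hW
    fun k s hs => h s (hWV hs).1 k
  have hk : (1 : ℝ) ≤ (k + 1 : ℕ) := by push_cast; linarith [(Nat.cast_nonneg k : (0 : ℝ) ≤ k)]
  refine DifferentiableOn.mul ?_
    ((differentiableOn_evenRem J hβ hk).mono fun s hs => (hWV hs).2)
  refine Differentiable.differentiableOn ?_
  exact (differentiable_id.const_mul 3).neg.const_cpow (Or.inl (Nat.cast_ne_zero.2 k.succ_ne_zero))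

theorem hasSum_riemannZeta {w : ℂ} (hw : 1 < w.re) :
    HasSum (fun k : ℕ => ((k + 1 : ℕ) : ℂ) ^ (-w)) (riemannZeta w) := by
  have h : Summable fun k : ℕ => ((k + 1 : ℕ) : ℂ) ^ (-w) := by
    refine Summable.of_norm ?_
    refine (summable_succ_rpow hw).congr fun k => ?_
    rw [norm_natCast_cpow_of_pos k.succ_pos, neg_re]
  rw [zeta_eq_tsum_one_div_nat_add_one_cpow hw]
  convert h.hasSum using 3 with k
  rw [cpow_neg, one_div]
  push_cast
  rfl

/-- The part of the continuation which comes from the vertical integrals. -/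
noncomputable def vertSum (J : ℕ) (β : ℝ) (s : ℂ) : ℂ :=
  2 * riemannZeta s * riemannZeta (3 * s) + 2 * sin (Real.pi * s / 2) *
    (∑ x ∈ pairs J, momentCoeff β x s * riemannZeta (3 * s + (x.1 + x.2 : ℕ)) + remSeries J β s)

theorem hasSum_vertSum {J : ℕ} (hJ : 1 ≤ J) {β : ℝ} (hβ : |β| ≤ 1) {s : ℂ} (hs : 1 / 2 < s.re)
    (hs1 : s.re < 1) :
    HasSum (fun k : ℕ => ((k + 1 : ℕ) : ℂ) ^ (-(3 * s)) * (2 * riemannZeta s +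
      2 * sin (Real.pi * s / 2) * evenRem 1 β (k + 1 : ℕ) s)) (vertSum J β s) := by
  have hJ' : (1 : ℝ) ≤ J := by exact_mod_cast hJ
  have hre : 1 < (3 * s).re := by simp; linarith
  have h1 := (hasSum_riemannZeta hre).mul_left (2 * riemannZeta s)
  have h2 := (summable_remSeries J hβ (s := s) (by linarith) (by linarith)).hasSum
  have h3 : HasSum (fun k : ℕ => ∑ x ∈ pairs J, momentCoeff β x s *
      ((k + 1 : ℕ) : ℂ) ^ (-(3 * s + (x.1 + x.2 : ℕ))))
      (∑ x ∈ pairs J, momentCoeff β x s * riemannZeta (3 * s + (x.1 + x.2 : ℕ))) := by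
    refine hasSum_sum fun x _ => (hasSum_riemannZeta ?_).mul_left _
    rw [add_re, natCast_re]
    linarith [(Nat.cast_nonneg (x.1 + x.2) : (0 : ℝ) ≤ (x.1 + x.2 : ℕ))]
  refine (h1.add ((h3.add h2).mul_left (2 * sin (Real.pi * s / 2)))).congr_eq fun k => ?_
  have hk : (1 : ℝ) ≤ (k + 1 : ℕ) := by push_cast; linarith [(Nat.cast_nonneg k : (0 : ℝ) ≤ k)]
  have hk0 : ((k + 1 : ℕ) : ℂ) ≠ 0 := Nat.cast_ne_zero.2 k.succ_ne_zero
  have e : ∑ x ∈ pairs J, momentCoeff β x s * ((k + 1 : ℕ) : ℂ) ^ (-(3 * s + (x.1 + x.2 : ℕ))) =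
      ((k + 1 : ℕ) : ℂ) ^ (-(3 * s)) *
        ∑ x ∈ pairs J, momentCoeff β x s * (((k + 1 : ℕ) : ℝ) : ℂ)⁻¹ ^ (x.1 + x.2) := by
    rw [Finset.mul_sum]
    refine Finset.sum_congr rfl fun x _ => ?_
    rw [neg_add, cpow_add _ _ hk0, cpow_neg _ ((x.1 + x.2 : ℕ) : ℂ), cpow_natCast, inv_pow,
      ofReal_natCast]
    ring
  rw [evenRem_one hJ hβ hk hs1, e]
  ring

/-- The continuation of the Witten series to `(1 - J) / 3 < re s < 1`. -/
noncomputable def wittenCont (J : ℕ) (s : ℂ) : ℂ :=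
  1 / 2 * (riemannZeta (4 * s - 1) * (innerInt s + outerInt s) +
    (1 / 2 * vertSum J (-1) s + 2 ^ (-s) * vertSum J (1 / 2) s))

theorem wittenSum_eq_wittenCont {J : ℕ} (hJ : 1 ≤ J) {s : ℂ} (hs : 1 / 2 < s.re)
    (hs1 : s.re < 1) : wittenSum s = wittenCont J s := by
  have hre : 1 < (4 * s - 1).re := by simp; linarith
  have h1 := (hasSum_riemannZeta hre).mul_right (innerInt s + outerInt s)
  have h2 := (hasSum_vertSum hJ abs_neg_one_le hs hs1).mul_left (1 / 2)
  have h3 := (hasSum_vertSum hJ abs_half_le hs hs1).mul_left (2 ^ (-s))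
  have h := (hasSum_two_mul_wittenSum hs hs1).unique (h1.add (h2.add h3))
  rw [wittenCont, ← h]
  ring

theorem meromorphicAt_riemannZeta (z : ℂ) : MeromorphicAt riemannZeta z := by
  have hG : MeromorphicAt Gammaℝ z := by
    refine MeromorphicAt.mul ?_ ?_
    · refine AnalyticAt.meromorphicAt (Differentiable.analyticAt ?_ z)
      exact (differentiable_id.neg.div_const 2).const_cpow
        (Or.inl (ofReal_ne_zero.2 Real.pi_ne_zero))
    · exact (Meromorphic.Gamma (z / 2)).comp_analyticAt (g := fun s : ℂ => s / 2) (by fun_prop)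
  have hid : MeromorphicAt (fun s : ℂ => s) z := analyticAt_id.meromorphicAt
  have h : MeromorphicAt (fun s => completedRiemannZeta s / Gammaℝ s) z := by
    refine MeromorphicAt.div ?_ hG
    rw [show completedRiemannZeta = fun s => completedRiemannZeta₀ s - 1 / s - 1 / (1 - s) from
      funext completedRiemannZeta_eq]
    exact (((differentiable_completedZeta₀.analyticAt z).meromorphicAt.sub
      ((MeromorphicAt.const 1 z).div hid)).sub
      ((MeromorphicAt.const 1 z).div ((MeromorphicAt.const 1 z).sub hid)))
  refine h.congr ?_
  have h0 : ∀ᶠ s in 𝓝[≠] z, s ≠ 0 := by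
    rcases eq_or_ne z 0 with rfl | hz
    · exact self_mem_nhdsWithin
    · exact nhdsWithin_le_nhds (isOpen_ne.mem_nhds hz)
  exact h0.mono fun s hs => (riemannZeta_def_of_ne_zero hs).symm

theorem meromorphicAt_riemannZeta_comp {f : ℂ → ℂ} {z : ℂ} (hf : AnalyticAt ℂ f z) :
    MeromorphicAt (fun s => riemannZeta (f s)) z :=
  (meromorphicAt_riemannZeta (f z)).comp_analyticAt hf

theorem meromorphicAt_Gamma_comp {f : ℂ → ℂ} {z : ℂ} (hf : AnalyticAt ℂ f z) :
    MeromorphicAt (fun s => Gamma (f s)) z :=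
  (Meromorphic.Gamma (f z)).comp_analyticAt hf

theorem analyticAt_momentCoeff (β : ℝ) {x : ℕ × ℕ} (hx : 1 ≤ x.1 + x.2) {z : ℂ} (hz : z.re < 1) :
    AnalyticAt ℂ (momentCoeff β x) z := by
  have h : z.re < (x.1 + x.2 : ℕ) := hz.trans_le (by exact_mod_cast hx)
  have h1 := (differentiableOn_planckInt_pow (x.1 + x.2)).analyticAt
    ((isOpen_re_lt _).mem_nhds (show z ∈ {s : ℂ | s.re < (x.1 + x.2 : ℕ)} from h))
  have h2 := (differentiable_binomCoeff x.1).analyticAt z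
  have h3 := (differentiable_binomCoeff x.2).analyticAt z
  exact ((((h2.mul h3).mul analyticAt_const).mul analyticAt_const).mul analyticAt_const).mul h1

theorem analyticAt_remSeries {J : ℕ} {β : ℝ} (hβ : |β| ≤ 1) {z : ℂ} (h : (1 - J) / 3 < z.re)
    (h' : z.re < J) : AnalyticAt ℂ (remSeries J β) z :=
  (differentiableOn_remSeries J hβ).analyticAt ((isOpen_strip _ _).mem_nhds ⟨h, h'⟩)

theorem analyticAt_sin_pi_mul_div_two (z : ℂ) :
    AnalyticAt ℂ (fun s : ℂ => sin (Real.pi * s / 2)) z :=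
  Differentiable.analyticAt (by fun_prop) z

theorem meromorphicAt_vertSum {J : ℕ} (hJ : 1 ≤ J) {β : ℝ} (hβ : |β| ≤ 1) {z : ℂ}
    (h : (1 - J) / 3 < z.re) (h' : z.re < 1) : MeromorphicAt (vertSum J β) z := by
  have hJ' : (1 : ℝ) ≤ J := by exact_mod_cast hJ
  have m1 := (MeromorphicAt.const (2 : ℂ) z).mul (meromorphicAt_riemannZeta z)
  have m2 := meromorphicAt_riemannZeta_comp (f := fun s : ℂ => 3 * s) (z := z) (by fun_prop)
  have m3 := (MeromorphicAt.const (2 : ℂ) z).mul (analyticAt_sin_pi_mul_div_two z).meromorphicAt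
  have m4 := (analyticAt_remSeries hβ h (h'.trans_le hJ')).meromorphicAt
  have m5 : MeromorphicAt (fun s => ∑ x ∈ pairs J, momentCoeff β x s *
      riemannZeta (3 * s + (x.1 + x.2 : ℕ))) z := by
    refine MeromorphicAt.fun_sum fun x hx => ?_
    exact (analyticAt_momentCoeff β (pos_of_mem_pairs hx) h').meromorphicAt.mul
      (meromorphicAt_riemannZeta_comp (f := fun s : ℂ => 3 * s + (x.1 + x.2 : ℕ)) (by fun_prop))
  exact (m1.mul m2).add (m3.mul (m5.add m4))

theorem analyticAt_two_cpow_neg (z : ℂ) : AnalyticAt ℂ (fun s : ℂ => (2 : ℂ) ^ (-s)) z :=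
  (differentiable_const_cpow_neg two_ne_zero).analyticAt z

theorem meromorphicAt_wittenCont {J : ℕ} (hJ : 1 ≤ J) {z : ℂ} (h : (1 - J) / 3 < z.re)
    (h' : z.re < 1) : MeromorphicAt (wittenCont J) z := by
  have m1 := meromorphicAt_riemannZeta_comp (f := fun s : ℂ => 4 * s - 1) (z := z) (by fun_prop)
  have m2 := (differentiableOn_innerInt.analyticAt
    ((isOpen_re_lt 1).mem_nhds (show z ∈ {s : ℂ | s.re < 1} from h'))).meromorphicAt
  have m3 : MeromorphicAt outerInt z :=
    ((meromorphicAt_Gamma_comp (f := fun s : ℂ => (3 * s - 1) / 2) (by fun_prop)).mul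
      (meromorphicAt_Gamma_comp (f := fun s : ℂ => 1 - s) (by fun_prop))).div
      ((MeromorphicAt.const (2 : ℂ) z).mul
        (meromorphicAt_Gamma_comp (f := fun s : ℂ => (1 + s) / 2) (by fun_prop)))
  have m4 := (MeromorphicAt.const (1 / 2 : ℂ) z).mul
    (meromorphicAt_vertSum hJ abs_neg_one_le h h')
  have m5 := (analyticAt_two_cpow_neg z).meromorphicAt.mul
    (meromorphicAt_vertSum hJ abs_half_le h h')
  exact (MeromorphicAt.const (1 / 2 : ℂ) z).mul ((m1.mul (m2.add m3)).add (m4.add m5))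

/-- `f` is analytic at `z` and vanishes there to order at least two. -/
def DoubleZero (f : ℂ → ℂ) (z : ℂ) : Prop := AnalyticAt ℂ f z ∧ f z = 0 ∧ deriv f z = 0

theorem doubleZero_mul {f g : ℂ → ℂ} {z : ℂ} (hf : AnalyticAt ℂ f z) (hg : AnalyticAt ℂ g z)
    (hf0 : f z = 0) (hg0 : g z = 0) : DoubleZero (fun s => f s * g s) z := by
  refine ⟨hf.mul hg, by simp [hf0], ?_⟩
  have := (hf.differentiableAt.hasDerivAt.mul hg.differentiableAt.hasDerivAt).deriv
  rw [hf0, hg0, zero_mul, mul_zero, add_zero] at this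
  exact this

theorem DoubleZero.add {f g : ℂ → ℂ} {z : ℂ} (hf : DoubleZero f z) (hg : DoubleZero g z) :
    DoubleZero (fun s => f s + g s) z := by
  refine ⟨hf.1.add hg.1, by simp [hf.2.1, hg.2.1], ?_⟩
  have := (hf.1.differentiableAt.hasDerivAt.add hg.1.differentiableAt.hasDerivAt).deriv
  rw [hf.2.2, hg.2.2, add_zero] at this
  exact this

theorem DoubleZero.analytic_mul {f g : ℂ → ℂ} {z : ℂ} (hf : AnalyticAt ℂ f z)
    (hg : DoubleZero g z) : DoubleZero (fun s => f s * g s) z := by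
  refine ⟨hf.mul hg.1, by simp [hg.2.1], ?_⟩
  have := (hf.differentiableAt.hasDerivAt.mul hg.1.differentiableAt.hasDerivAt).deriv
  rw [hg.2.1, hg.2.2, mul_zero, mul_zero, add_zero] at this
  exact this

theorem DoubleZero.congr {f g : ℂ → ℂ} {z : ℂ} (hg : DoubleZero g z) (h : f =ᶠ[𝓝 z] g) :
    DoubleZero f z :=
  ⟨hg.1.congr h.symm, h.eq_of_nhds.trans hg.2.1, h.deriv_eq.trans hg.2.2⟩

theorem analyticAt_riemannZeta {z : ℂ} (hz : z ≠ 1) : AnalyticAt ℂ riemannZeta z :=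
  DifferentiableOn.analyticAt (s := {1}ᶜ)
    (fun _ hs => (differentiableAt_riemannZeta hs).differentiableWithinAt)
    (isOpen_ne.mem_nhds hz)

theorem riemannZeta_neg_two_mul_nat {n : ℕ} (hn : 0 < n) : riemannZeta (-(2 * (n : ℂ))) = 0 := by
  obtain ⟨n, rfl⟩ := Nat.exists_eq_succ_of_ne_zero hn.ne'
  rw [← riemannZeta_neg_two_mul_nat_add_one n]
  push_cast
  ring_nf

theorem analyticAt_riemannZeta_comp {f : ℂ → ℂ} {z : ℂ} (hf : AnalyticAt ℂ f z) (h : f z ≠ 1) :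
    AnalyticAt ℂ (fun s => riemannZeta (f s)) z :=
  (analyticAt_riemannZeta h).comp hf

theorem sin_pi_mul_div_two_eq_zero (k : ℕ) : sin (Real.pi * (-(2 * (k : ℂ))) / 2) = 0 := by
  rw [show (Real.pi : ℂ) * (-(2 * (k : ℂ))) / 2 = -((k : ℂ) * Real.pi) by ring, sin_neg,
    sin_nat_mul_pi, neg_zero]

theorem pairRem_eq_zero {J k : ℕ} (h : 2 * k < J) {β : ℝ} (hβ : |β| ≤ 1) (m : ℝ) :
    pairRem J β m (-(2 * (k : ℂ))) = 0 := by
  funext t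
  rw [pairRem, show -(2 * (k : ℂ)) = -((2 * k : ℕ) : ℂ) by push_cast; ring,
    pairPow_neg_eq_pairPoly h hβ, sub_self, Pi.zero_apply]

theorem remSeries_eq_zero {J k : ℕ} (h : 2 * k < J) {β : ℝ} (hβ : |β| ≤ 1) :
    remSeries J β (-(2 * (k : ℂ))) = 0 := by
  simp [remSeries, evenRem, pairRem_eq_zero h hβ, planckInt]

theorem momentTerm_analyticAt_and_eq_zero (k : ℕ) (β : ℝ) {x : ℕ × ℕ}
    (hx : 1 ≤ x.1 + x.2) :
    AnalyticAt ℂ (fun s => momentCoeff β x s * riemannZeta (3 * s + (x.1 + x.2 : ℕ)))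
      (-(2 * (k : ℂ))) ∧
    momentCoeff β x (-(2 * (k : ℂ))) * riemannZeta (3 * (-(2 * (k : ℂ))) + (x.1 + x.2 : ℕ)) = 0 := by
  rcases Nat.even_or_odd (x.1 + x.2) with he | ho
  · obtain ⟨n, hn⟩ := he
    have e : 3 * (-(2 * (k : ℂ))) + (x.1 + x.2 : ℕ) = ((2 * ((n : ℤ) - 3 * k) : ℤ) : ℂ) := by
      rw [hn]
      push_cast
      ring
    refine ⟨(analyticAt_momentCoeff β hx (by simp; linarith [(Nat.cast_nonneg k : (0 : ℝ) ≤ k)])).mul (analyticAt_riemannZeta_comp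
      (f := fun s : ℂ => 3 * s + (x.1 + x.2 : ℕ)) (by fun_prop) ?_), ?_⟩
    · simp only [e]
      exact_mod_cast show 2 * ((n : ℤ) - 3 * k) ≠ 1 by omega
    · have h2 : -(2 * (k : ℂ)) = -((2 * k : ℕ) : ℂ) := by push_cast; ring
      rcases lt_or_ge (2 * k) x.1 with h | h
      · rw [momentCoeff, pairCoeff, h2, binomCoeff_neg_eq_zero h]
        ring
      rcases lt_or_ge (2 * k) x.2 with h' | h'
      · rw [momentCoeff, pairCoeff, h2, binomCoeff_neg_eq_zero h']
        ring
      rw [e, show ((2 * ((n : ℤ) - 3 * k) : ℤ) : ℂ) = -(2 * ((3 * k - n : ℕ) : ℂ)) by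
        rw [Nat.cast_sub (by omega)]; push_cast; ring,
        riemannZeta_neg_two_mul_nat (by omega), mul_zero]
  · have : momentCoeff β x = 0 := by
      funext s
      rw [momentCoeff, ho.neg_one_pow, Pi.zero_apply]
      ring
    simp only [this, Pi.zero_apply, zero_mul, and_true]
    exact analyticAt_const

theorem doubleZero_vertSum {J k : ℕ} (hk : 0 < k) (hJ : 6 * k + 1 < J) {β : ℝ} (hβ : |β| ≤ 1) :
    DoubleZero (vertSum J β) (-(2 * (k : ℂ))) := by
  have hJ' : (6 : ℝ) * k + 1 < J := by exact_mod_cast hJ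
  have hk' : (0 : ℝ) < k := by exact_mod_cast hk
  have hre : (-(2 * (k : ℂ))).re = -(2 * k) := by simp
  have hne : ∀ a : ℕ, -(2 * (a : ℂ)) ≠ 1 := by
    intro a h
    have := congrArg re h
    simp at this
    linarith [(Nat.cast_nonneg a : (0 : ℝ) ≤ a)]
  have e3 : 3 * (-(2 * (k : ℂ))) = -(2 * ((3 * k : ℕ) : ℂ)) := by push_cast; ring
  have d1 : DoubleZero (fun s => 2 * riemannZeta s * riemannZeta (3 * s)) (-(2 * (k : ℂ))) := by
    refine doubleZero_mul (f := fun s => 2 * riemannZeta s)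
      (analyticAt_const.mul (analyticAt_riemannZeta (hne k)))
      (analyticAt_riemannZeta_comp (f := fun s : ℂ => 3 * s) (by fun_prop) ?_) ?_ ?_
    · simp only [e3]
      exact hne _
    · simp only [riemannZeta_neg_two_mul_nat hk, mul_zero]
    · rw [e3]
      exact riemannZeta_neg_two_mul_nat (by omega)
  refine d1.add (doubleZero_mul (f := fun s => 2 * sin (Real.pi * s / 2))
    (analyticAt_const.mul (analyticAt_sin_pi_mul_div_two _)) ?_ ?_ ?_)
  · refine AnalyticAt.add ?_ (analyticAt_remSeries hβ ?_ ?_)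
    · exact Finset.analyticAt_fun_sum _ fun x hx =>
        (momentTerm_analyticAt_and_eq_zero k β (pos_of_mem_pairs hx)).1
    · rw [hre]; linarith
    · rw [hre]; linarith
  · simp only [sin_pi_mul_div_two_eq_zero, mul_zero]
  · rw [remSeries_eq_zero (by omega) hβ, add_zero]
    exact Finset.sum_eq_zero fun x hx =>
      (momentTerm_analyticAt_and_eq_zero k β (pos_of_mem_pairs hx)).2

theorem innerInt_add_outerInt {s : ℂ} (hs : s.re < 1) (h3 : cos (3 * (Real.pi * s / 2)) ≠ 0) :
    innerInt s + outerInt s = -2 * Gamma (1 - s) * Gamma ((1 - s) / 2) *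
      cos (Real.pi * s / 2) / (Gamma ((3 - 3 * s) / 2) * cos (3 * (Real.pi * s / 2))) *
      (sin (Real.pi * s / 2) * sin (Real.pi * s / 2)) := by
  set θ := (Real.pi : ℂ) * s / 2 with hθ
  have hc3 : cos (3 * θ) = cos θ * (4 * cos θ ^ 2 - 3) := by rw [cos_three_mul]; ring
  have hc : cos θ ≠ 0 := fun h => h3 (by rw [hc3, h, zero_mul])
  have hπ : (Real.pi : ℂ) ≠ 0 := ofReal_ne_zero.2 Real.pi_ne_zero
  have r1 := Gamma_mul_Gamma_one_sub ((3 * s - 1) / 2)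
  have r2 := Gamma_mul_Gamma_one_sub ((1 + s) / 2)
  rw [show 1 - (3 * s - 1) / 2 = (3 - 3 * s) / 2 by ring,
    show (Real.pi : ℂ) * ((3 * s - 1) / 2) = 3 * θ - Real.pi / 2 by rw [hθ]; ring,
    sin_sub_pi_div_two] at r1
  rw [show 1 - (1 + s) / 2 = (1 - s) / 2 by ring,
    show (Real.pi : ℂ) * ((1 + s) / 2) = θ + Real.pi / 2 by rw [hθ]; ring,
    sin_add_pi_div_two] at r2
  have g1 : Gamma ((3 - 3 * s) / 2) ≠ 0 := Gamma_ne_zero_of_re_pos (by simp; linarith)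
  have g3 : Gamma ((1 + s) / 2) ≠ 0 := by
    intro h
    rw [h, zero_mul] at r2
    exact div_ne_zero hπ hc r2.symm
  have g4 : Gamma ((1 - s) / 2) ≠ 0 := by
    intro h
    rw [h, mul_zero] at r2
    exact div_ne_zero hπ hc r2.symm
  have hA : Gamma ((3 * s - 1) / 2) = Real.pi / (-cos (3 * θ)) / Gamma ((3 - 3 * s) / 2) :=
    eq_div_of_mul_eq g1 r1
  have hB : Gamma ((1 + s) / 2) = Real.pi / cos θ / Gamma ((1 - s) / 2) := eq_div_of_mul_eq g4 r2
  have hs2 : sin θ * sin θ = 1 - cos θ ^ 2 := by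
    rw [← sin_sq_add_cos_sq θ]
    ring
  rw [innerInt, outerInt, hA, hB, hs2]
  have hd : 4 * cos θ ^ 2 - 3 ≠ 0 := fun h => h3 (by rw [hc3, h, mul_zero])
  rw [hc3]
  generalize Gamma ((3 - 3 * s) / 2) = a at g1
  generalize Gamma ((1 - s) / 2) = b at g4
  obtain ⟨d, hd'⟩ : ∃ d, d = 4 * cos θ ^ 2 - 3 := ⟨_, rfl⟩
  rw [← hd'] at hd ⊢
  rw [show 1 - cos θ ^ 2 = (1 - d) / 4 by rw [hd']; ring]
  field_simp
  ring

theorem doubleZero_innerInt_add_outerInt (k : ℕ) :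
    DoubleZero (fun s => innerInt s + outerInt s) (-(2 * (k : ℂ))) := by
  have hk : (0 : ℝ) ≤ k := Nat.cast_nonneg k
  have hre : (-(2 * (k : ℂ))).re < 1 := by simp; linarith
  have hcos : cos (3 * (Real.pi * (-(2 * (k : ℂ))) / 2)) ≠ 0 := by
    rw [show 3 * ((Real.pi : ℂ) * (-(2 * (k : ℂ))) / 2) = -(((3 * k : ℕ) : ℂ) * Real.pi) by
      push_cast; ring, cos_neg]
    intro h
    have := sin_sq_add_cos_sq (((3 * k : ℕ) : ℂ) * Real.pi)
    rw [h, sin_nat_mul_pi] at this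
    norm_num at this
  have ho : IsOpen {s : ℂ | s.re < 1} := isOpen_re_lt 1
  have hm : {s : ℂ | s.re < 1} ∈ 𝓝 (-(2 * (k : ℂ))) := ho.mem_nhds hre
  have hcc : Continuous fun s : ℂ => cos (3 * (Real.pi * s / 2)) := by fun_prop
  have hG : ∀ f : ℂ → ℂ, Differentiable ℂ f → (∀ s : ℂ, s.re < 1 → 0 < (f s).re) →
      AnalyticAt ℂ (fun s => Gamma (f s)) (-(2 * (k : ℂ))) := fun f hf h =>
    (differentiableOn_Gamma_comp hf.differentiableOn h).analyticAt hm
  refine DoubleZero.congr (g := fun s => _ * (sin (Real.pi * s / 2) * sin (Real.pi * s / 2))) ?_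
    ((Filter.Eventually.and hm (hcc.continuousAt.eventually_ne hcos)).mono fun s hs =>
      innerInt_add_outerInt hs.1 hs.2)
  refine DoubleZero.analytic_mul ?_ (doubleZero_mul (analyticAt_sin_pi_mul_div_two _)
    (analyticAt_sin_pi_mul_div_two _) (sin_pi_mul_div_two_eq_zero k)
    (sin_pi_mul_div_two_eq_zero k))
  have a1 := hG (fun s => 1 - s) (by fun_prop) fun s hs => by simp; linarith
  have a2 := hG (fun s => (1 - s) / 2) (by fun_prop) fun s hs => by simp; linarith
  have a3 := hG (fun s => (3 - 3 * s) / 2) (by fun_prop) fun s hs => by simp; linarith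
  have c1 : AnalyticAt ℂ (fun s : ℂ => cos (Real.pi * s / 2)) (-(2 * (k : ℂ))) :=
    Differentiable.analyticAt (by fun_prop) _
  have c3 : AnalyticAt ℂ (fun s : ℂ => cos (3 * (Real.pi * s / 2))) (-(2 * (k : ℂ))) :=
    Differentiable.analyticAt (by fun_prop) _
  refine (((analyticAt_const.mul a1).mul a2).mul c1).div (a3.mul c3) (mul_ne_zero ?_ hcos)
  exact Gamma_ne_zero_of_re_pos (by simp; linarith)

theorem doubleZero_wittenCont {J k : ℕ} (hk : 0 < k) (hJ : 6 * k + 1 < J) :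
    DoubleZero (wittenCont J) (-(2 * (k : ℂ))) := by
  have hz : AnalyticAt ℂ (fun s => riemannZeta (4 * s - 1)) (-(2 * (k : ℂ))) := by
    refine analyticAt_riemannZeta_comp (f := fun s : ℂ => 4 * s - 1) (by fun_prop) fun h => ?_
    have := congrArg re h
    simp at this
    linarith [(Nat.cast_nonneg k : (0 : ℝ) ≤ k)]
  exact ((doubleZero_innerInt_add_outerInt k).analytic_mul hz |>.add
    (((doubleZero_vertSum hk hJ abs_neg_one_le).analytic_mul analyticAt_const).add
    ((doubleZero_vertSum hk hJ abs_half_le).analytic_mul (analyticAt_two_cpow_neg _)))).analytic_mul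
    analyticAt_const

theorem eventuallyEq_nhdsNE_of_eqOn {f g : ℂ → ℂ} {U V : Set ℂ} (hUc : IsPreconnected U)
    (hV : IsOpen V) (hne : V.Nonempty) (hVU : V ⊆ U) (hf : ∀ z ∈ U, MeromorphicAt f z)
    (hg : ∀ z ∈ U, MeromorphicAt g z) (h : EqOn f g V) {z : ℂ} (hz : z ∈ U) :
    f =ᶠ[𝓝[≠] z] g := by
  obtain ⟨w, hw⟩ := hne
  have hfg : MeromorphicOn (f - g) U := fun x hx => (hf x hx).sub (hg x hx)
  have htop : meromorphicOrderAt (f - g) w = ⊤ := by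
    rw [meromorphicOrderAt_eq_top_iff]
    refine nhdsWithin_le_nhds ?_
    filter_upwards [hV.mem_nhds hw] with s hs
    rw [Pi.sub_apply, h hs, sub_self]
  have hz' : meromorphicOrderAt (f - g) z = ⊤ := by
    by_contra hne
    exact hfg.meromorphicOrderAt_ne_top_of_isPreconnected hUc hz (hVU hw) hne htop
  rw [meromorphicOrderAt_eq_top_iff] at hz'
  exact hz'.mono fun s hs => sub_eq_zero.1 hs

theorem exists_meromorphic_glue {D : ℂ → ℂ} {G : ℕ → ℂ → ℂ}
    (hD : DifferentiableOn ℂ D {s | 1 / 2 < s.re})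
    (hG : ∀ (N : ℕ) (z : ℂ), -(N : ℝ) < z.re → z.re < 1 → MeromorphicAt (G N) z)
    (hDG : ∀ (N : ℕ) (s : ℂ), 1 / 2 < s.re → s.re < 1 → D s = G N s) :
    ∃ F : ℂ → ℂ, (∀ z, MeromorphicAt F z) ∧ (∀ s : ℂ, 1 / 2 < s.re → F s = D s) ∧
      ∀ (N : ℕ) (z : ℂ), -(N : ℝ) < z.re → z.re < 1 → AnalyticAt ℂ (G N) z →
        F =ᶠ[𝓝 z] G N := by
  classical
  have hpair : ∀ (M N : ℕ) (z : ℂ), -(M : ℝ) < z.re → -(N : ℝ) < z.re → z.re < 1 →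
      G M =ᶠ[𝓝[≠] z] G N := by
    intro M N z hM hN h1
    have hmin : ∀ c : ℝ, c ≤ 0 → ({s : ℂ | 1 / 2 < s.re ∧ s.re < 1} ⊆
        {s : ℂ | c < s.re ∧ s.re < 1}) := fun c hc s hs => ⟨by linarith [hs.1], hs.2⟩
    refine eventuallyEq_nhdsNE_of_eqOn (isPreconnected_strip (max (-(M : ℝ)) (-(N : ℝ))) 1)
      (isOpen_strip (1 / 2) 1) ⟨((3 / 4 : ℝ) : ℂ), ?_⟩ (hmin _ (by simp)) ?_ ?_ ?_
      ⟨max_lt hM hN, h1⟩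
    · constructor <;> rw [ofReal_re] <;> norm_num
    · exact fun s hs => hG M s ((le_max_left _ _).trans_lt hs.1) hs.2
    · exact fun s hs => hG N s ((le_max_right _ _).trans_lt hs.1) hs.2
    · exact fun s hs => (hDG M s hs.1 hs.2).symm.trans (hDG N s hs.1 hs.2)
  set H : ℂ → ℂ := fun s => if 1 / 2 < s.re then D s else G (⌊|s.re|⌋₊ + 2) s with hH
  have hHD : ∀ z : ℂ, 1 / 2 < z.re → H =ᶠ[𝓝 z] D := fun z hz => by
    filter_upwards [(isOpen_re_gt (1 / 2)).mem_nhds hz] with s hs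
    exact if_pos hs
  have hHG : ∀ (N : ℕ) (z : ℂ), -(N : ℝ) < z.re → z.re < 1 → H =ᶠ[𝓝[≠] z] G N := by
    intro N z hN h1
    have hall : ∀ᶠ s in 𝓝[≠] z, ∀ M ∈ Finset.range (⌊|z.re| + 1⌋₊ + 3),
        -(M : ℝ) < z.re → G M s = G N s := by
      rw [Filter.eventually_all_finset]
      intro M _
      by_cases hM : -(M : ℝ) < z.re
      · exact (hpair M N z hM hN h1).mono fun s hs _ => hs
      · exact Eventually.of_forall fun s h => absurd h hM
    filter_upwards [hall, nhdsWithin_le_nhds (Metric.ball_mem_nhds z one_pos),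
      nhdsWithin_le_nhds ((isOpen_re_lt 1).mem_nhds h1)] with s hs hball (hs1 : s.re < 1)
    by_cases h2 : 1 / 2 < s.re
    · rw [hH]
      simp only [h2, if_true]
      exact hDG N s h2 hs1
    · rw [hH]
      simp only [h2, if_false]
      have hd : |s.re - z.re| < 1 := by
        rw [← sub_re]
        exact (abs_re_le_norm _).trans_lt (mem_ball_iff_norm.1 hball)
      have hle : |s.re| ≤ |z.re| + 1 := by
        have := abs_sub_abs_le_abs_sub s.re z.re
        linarith
      refine hs _ (Finset.mem_range.2 ?_) ?_
      · have := Nat.floor_le_floor hle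
        omega
      · have h3 := Nat.lt_floor_add_one |s.re|
        have h4 := neg_abs_le s.re
        have h5 := abs_lt.1 hd
        push_cast
        linarith
  have hHm : MeromorphicOn H univ := by
    intro z _
    by_cases hz : 1 / 2 < z.re
    · exact (hD.analyticAt ((isOpen_re_gt (1 / 2)).mem_nhds hz)).meromorphicAt.congr
        ((hHD z hz).symm.filter_mono nhdsWithin_le_nhds)
    · obtain ⟨N, hN⟩ := exists_nat_gt (-z.re)
      have h1 : -(N : ℝ) < z.re := by linarith
      have h2 : z.re < 1 := by linarith
      exact (hG N z h1 h2).congr (hHG N z h1 h2).symm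
  have hNF := meromorphicNFOn_toMeromorphicNFOn H univ
  have key : ∀ (f : ℂ → ℂ) (z : ℂ), AnalyticAt ℂ f z → H =ᶠ[𝓝[≠] z] f →
      toMeromorphicNFOn H univ =ᶠ[𝓝 z] f := fun f z hf h =>
    ((hNF (mem_univ z)).eventuallyEq_nhdsNE_iff_eventuallyEq_nhds hf.meromorphicNFAt).1
      ((hHm.toMeromorphicNFOn_eq_self_on_nhdsNE (mem_univ z)).trans h)
  refine ⟨toMeromorphicNFOn H univ, fun z => (hNF (mem_univ z)).meromorphicAt, fun s hs => ?_,
    fun N z h1 h2 ha => key _ z ha (hHG N z h1 h2)⟩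
  exact (key D s (hD.analyticAt ((isOpen_re_gt (1 / 2)).mem_nhds hs))
    ((hHD s hs).filter_mono nhdsWithin_le_nhds)).eq_of_nhds

theorem tsum_pnat_eq_wittenSum (s : ℂ) :
    ∑' p : ℕ+ × ℕ+, 1 / (((p.1 : ℕ) : ℂ) * ((p.2 : ℕ) : ℂ) *
      (((p.1 : ℕ) : ℂ) + ((p.2 : ℕ) : ℂ)) *
      (((p.1 : ℕ) : ℂ) + 2 * ((p.2 : ℕ) : ℂ))) ^ s = wittenSum s := by
  rw [wittenSum, ← (Equiv.prodCongr Equiv.pnatEquivNat Equiv.pnatEquivNat).tsum_eq]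
  refine tsum_congr fun p => ?_
  obtain ⟨a, b⟩ := p
  obtain ⟨a, rfl⟩ := Equiv.pnatEquivNat.symm.surjective a
  obtain ⟨b, rfl⟩ := Equiv.pnatEquivNat.symm.surjective b
  have e : ((a + 1 : ℕ) : ℂ) * (b + 1 : ℕ) * ((a + 1 : ℕ) + (b + 1 : ℕ)) *
      ((a + 1 : ℕ) + 2 * (b + 1 : ℕ)) =
      (((a + 1) * (b + 1) * (a + b + 2) : ℕ) : ℂ) * (a + 2 * b + 3 : ℕ) := by
    push_cast
    ring
  simp only [Equiv.prodCongr_apply, Prod.map_apply, wittenTerm, Equiv.pnatEquivNat_symm_apply,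
    Equiv.pnatEquivNat_apply, Nat.natPred_succPNat, Nat.succPNat_coe, Nat.succ_eq_add_one]
  rw [e, natCast_mul_natCast_cpow, Nat.cast_mul, natCast_mul_natCast_cpow, Nat.cast_mul,
    natCast_mul_natCast_cpow, one_div, mul_inv, mul_inv, mul_inv]
  simp only [cpow_neg]

end WittenB2

/-- The Witten zeta function of `B₂` (the double series
`Σ_{m,n≥1} (mn(m+n)(m+2n))^{-s}`) extends meromorphically to `ℂ` and vanishes to order at
least `2` at every negative even integer. -/
theorem stmt_7 :
    ∃ F : ℂ → ℂ,
      (∀ z : ℂ, MeromorphicAt F z) ∧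
      (∀ s : ℂ, 1 < s.re →
        F s = ∑' p : ℕ+ × ℕ+, 1 / (((p.1 : ℕ) : ℂ) * ((p.2 : ℕ) : ℂ) *
          (((p.1 : ℕ) : ℂ) + ((p.2 : ℕ) : ℂ)) *
          (((p.1 : ℕ) : ℂ) + 2 * ((p.2 : ℕ) : ℂ))) ^ s) ∧
      (∀ k : ℕ, 0 < k →
        AnalyticAt ℂ F (-(2 * (k : ℂ))) ∧ F (-(2 * (k : ℂ))) = 0 ∧
          deriv F (-(2 * (k : ℂ))) = 0) := by
  obtain ⟨F, hF, hFD, hFG⟩ := WittenB2.exists_meromorphic_glue WittenB2.differentiableOn_wittenSum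
    (G := fun N => WittenB2.wittenCont (3 * N + 1))
    (fun N z h h' => WittenB2.meromorphicAt_wittenCont (by omega) (by push_cast; linarith) h')
    (fun N s h h' => WittenB2.wittenSum_eq_wittenCont (by omega) h h')
  refine ⟨F, hF, fun s hs => ?_, fun k hk => ?_⟩
  · rw [hFD s (by linarith), WittenB2.tsum_pnat_eq_wittenSum]
  · have hk' : (0 : ℝ) < k := by exact_mod_cast hk
    have hz := WittenB2.doubleZero_wittenCont (J := 3 * (2 * k + 1) + 1) hk (by omega)
    exact hz.congr (hFG (2 * k + 1) _ (by simp) (by simp; linarith) hz.1)
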